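/- There exists a universal constant C > 0 with the following property. Let f(θ) = Σ_{i=1}^n u_i(a_iᵀ θ) be ridge separable on ℝ^d with ‖a_i‖ = 1, |u_i''| ≤ ρ₂ and |u_i'''| ≤ ρ₃ for all i, and suppose γ := ρ₃ / (n^{1/2} ρ₂^{3/2}) ≤ 1 and the probability measure μ ∝ e^{−f} satisfies Cheeger's isoperimetric inequality with coefficient ψ_μ > 0. Then for any ε ∈ (0,1), M ≥ 1 and any M-warm initial measure, Metropolized HMC with the step size and number of leapfrog steps chosen as in the optimal parameter choice (η² = c / ( nρ₂ (d + log(M/ε))^{1/2} (γ+1)^{2/3} log^{3/2}(M/ε) ), K = ⌈ c' / (2 (nρ₂)^{1/2} (γ+1)^{1/3} η) ⌉ for suitable universal constants c, c') reaches total variation error ε with gradient complexity at most C · ( n ρ₂ + n^{1/2} ρ₃ ρ₂^{−1/2} ) (d + log(M/ε))^{1/4} ψ_μ^{−2} log^{7/4}(M/ε). -/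

import Mathlib

open MeasureTheory Real
open scoped ENNReal NNReal

noncomputable section

/-- The Euclidean space `ℝ^d`. -/
abbrev Euc (d : ℕ) := EuclideanSpace ℝ (Fin d)

/-- `leapfrog f η k (q₀,p₀)` is the `k`-th leapfrog iterate with step size `η` for the
potential `f`, starting at `(q₀,p₀)`. -/
def leapfrog {d : ℕ} (f : Euc d → ℝ) (η : ℝ) : ℕ → Euc d × Euc d → Euc d × Euc d
  | 0, z => z
  | (k+1), z =>
      let w := leapfrog f η k z
      let q' := w.1 + η • w.2 - (η^2/2) • gradient f w.1
      (q', w.2 - (η/2) • gradient f w.1 - (η/2) • gradient f q')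

/-- `f` is `L`-smooth: the Hessian has operator norm at most `L` everywhere. -/
def LSmooth {d : ℕ} (f : Euc d → ℝ) (L : ℝ) : Prop :=
  ∀ x, ‖fderiv ℝ (gradient f) x‖ ≤ L

/-- The entries of the third-derivative tensor of `f` at `x`. -/
def tensor3 {ι : Type*} [Fintype ι] [DecidableEq ι]
    (f : EuclideanSpace ℝ ι → ℝ) (x : EuclideanSpace ℝ ι) (i j k : ι) : ℝ :=
  iteratedFDeriv ℝ 3 f x
    ![EuclideanSpace.single i 1, EuclideanSpace.single j 1, EuclideanSpace.single k 1]

/-- The `{1,2,3}`-norm (Frobenius norm) of a 3-tensor. -/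
def norm123 {ι : Type*} [Fintype ι] (A : ι → ι → ι → ℝ) : ℝ :=
  Real.sqrt (∑ i, ∑ j, ∑ k, (A i j k)^2)

/-- The `{1,2}{3}`-norm of a 3-tensor. -/
def norm12_3 {ι : Type*} [Fintype ι] (A : ι → ι → ι → ℝ) : ℝ :=
  sSup { s | ∃ (X : ι → ι → ℝ) (y : ι → ℝ), (∑ i, ∑ j, (X i j)^2) ≤ 1 ∧
    (∑ k, (y k)^2) ≤ 1 ∧ s = ∑ i, ∑ j, ∑ k, A i j k * X i j * y k }

/-- `f` is `γ L^{3/2}`-strongly Hessian Lipschitz. -/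
def StronglyHessLip {d : ℕ} (f : Euc d → ℝ) (γ L : ℝ) : Prop :=
  ∀ x, norm12_3 (tensor3 f x) ≤ γ * L ^ ((3:ℝ)/2)

/-- Distance between two sets. -/
def setDistance {α : Type*} [PseudoMetricSpace α] (S T : Set α) : ℝ :=
  sInf { r | ∃ x ∈ S, ∃ y ∈ T, r = dist x y }

/-- Cheeger isoperimetric inequality with coefficient `ψ`. -/
def CheegerIso {d : ℕ} (μ : Measure (Euc d)) (ψ : ℝ) : Prop :=
  ∀ S1 S2 S3 : Set (Euc d), MeasurableSet S1 → MeasurableSet S2 → MeasurableSet S3 →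
    Disjoint S1 S2 → Disjoint S1 S3 → Disjoint S2 S3 → S1 ∪ S2 ∪ S3 = Set.univ →
    ψ * setDistance S1 S2 * (μ S1).toReal * (μ S2).toReal ≤ (μ S3).toReal

/-- The probability measure proportional to `e^{-f}`. -/
def targetMeasure {d : ℕ} (f : Euc d → ℝ) : Measure (Euc d) :=
  ((volume.withDensity fun x => ENNReal.ofReal (Real.exp (-f x))) Set.univ)⁻¹ •
    (volume.withDensity fun x => ENNReal.ofReal (Real.exp (-f x)))

/-- The standard Gaussian measure `N(0, I_d)` on `ℝ^d`. -/
def stdGaussian (d : ℕ) : Measure (Euc d) :=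
  Measure.map (⇑(EuclideanSpace.equiv (Fin d) ℝ).symm)
    (Measure.pi fun _ : Fin d => ProbabilityTheory.gaussianReal 0 1)

/-- Metropolis acceptance probability of the HMC proposal. -/
def accProb {d : ℕ} (f : Euc d → ℝ) (K : ℕ) (η : ℝ) (q p : Euc d) : ℝ :=
  min 1 (Real.exp (-(f (leapfrog f η K (q,p)).1) - ‖(leapfrog f η K (q,p)).2‖^2/2
    + f q + ‖p‖^2/2))

/-- One step of Metropolized HMC with `K` leapfrog steps and step size `η`, from `q`. -/
def hmcKernel {d : ℕ} (f : Euc d → ℝ) (K : ℕ) (η : ℝ) (q : Euc d) : Measure (Euc d) :=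
  (stdGaussian d).bind fun p =>
    ENNReal.ofReal (accProb f K η q p) • Measure.dirac (leapfrog f η K (q,p)).1 +
    ENNReal.ofReal (1 - accProb f K η q p) • Measure.dirac q

/-- One step of the lazy version of Metropolized HMC. -/
def lazyHMC {d : ℕ} (f : Euc d → ℝ) (K : ℕ) (η : ℝ) (q : Euc d) : Measure (Euc d) :=
  (2:ℝ≥0∞)⁻¹ • Measure.dirac q + (2:ℝ≥0∞)⁻¹ • hmcKernel f K η q

/-- The law of the lazy Metropolized HMC chain after `n` steps started from `μ₀`. -/
def hmcIter {d : ℕ} (f : Euc d → ℝ) (K : ℕ) (η : ℝ) (μ0 : Measure (Euc d)) :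
    ℕ → Measure (Euc d)
  | 0 => μ0
  | (n+1) => (hmcIter f K η μ0 n).bind (lazyHMC f K η)

/-- Total variation distance between two measures. -/
def tvDist {α : Type*} [MeasurableSpace α] (P Q : Measure α) : ℝ :=
  sSup { r | ∃ A, MeasurableSet A ∧ r = |(P A).toReal - (Q A).toReal| }

/-- `ε`-mixing time of lazy Metropolized HMC started from `μ₀`, targetting `μ ∝ e^{-f}`. -/
def mixingTime {d : ℕ} (f : Euc d → ℝ) (K : ℕ) (η : ℝ) (μ0 : Measure (Euc d)) (ε : ℝ) : ℕ :=
  sInf { n : ℕ | tvDist (hmcIter f K η μ0 n) (targetMeasure f) ≤ ε }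

/-- `μ₀` is `M`-warm with respect to `μ`. -/
def Warm {α : Type*} [MeasurableSpace α] (μ0 μ : Measure α) (M : ℝ) : Prop :=
  ∀ S : Set α, MeasurableSet S → μ0 S ≤ ENNReal.ofReal M * μ S

/-- `e^{-f}` has subexponential tail. -/
def SubexpTail {d : ℕ} (f : Euc d → ℝ) : Prop :=
  ∃ lam > (0:ℝ), Filter.Tendsto (fun x : Euc d => Real.exp (lam * ‖x‖) * Real.exp (-f x))
    (Bornology.cobounded _) (nhds 0)

end

open scoped RealInnerProductSpace

/-- Layer-cake formula for the positive part of a difference. -/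
lemma lintegral_ofReal_sub_eq_lintegral_measure {X : Type*} [MeasurableSpace X]
    (ν : Measure (X × X)) [SFinite ν] {φ : X → ℝ} (hφ : Measurable φ) {B : ℝ}
    (hB : ∀ x, |φ x| ≤ B) :
    ∫⁻ z, ENNReal.ofReal (φ z.1 - φ z.2) ∂ν
      = ∫⁻ t in Set.Ico (-B) B, ν ({x | t < φ x} ×ˢ {x | t < φ x}ᶜ) := by
  have hm : MeasurableSet {w : (X × X) × ℝ | φ w.1.2 ≤ w.2 ∧ w.2 < φ w.1.1} :=
    (measurableSet_le (f := fun w : (X × X) × ℝ => φ w.1.2) (g := fun w => w.2)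
      (by fun_prop) (by fun_prop)).inter
      (measurableSet_lt (f := fun w : (X × X) × ℝ => w.2) (g := fun w => φ w.1.1)
      (by fun_prop) (by fun_prop))
  have h1 : ∀ z : X × X, ENNReal.ofReal (φ z.1 - φ z.2)
      = ∫⁻ t in Set.Ico (-B) B, (Set.indicator
        {w : (X × X) × ℝ | φ w.1.2 ≤ w.2 ∧ w.2 < φ w.1.1} (fun _ => (1 : ℝ≥0∞))) (z, t) := by
    intro z
    rw [← Real.volume_Ico]
    have hs : MeasurableSet (Set.Ico (φ z.2) (φ z.1)) := measurableSet_Ico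
    have : ∀ t, (Set.indicator
        {w : (X × X) × ℝ | φ w.1.2 ≤ w.2 ∧ w.2 < φ w.1.1} (fun _ => (1 : ℝ≥0∞))) (z, t)
        = (Set.Ico (φ z.2) (φ z.1)).indicator 1 t := by
      intro t; simp [Set.indicator, Set.mem_Ico]
    simp_rw [this]
    rw [lintegral_indicator_one hs, Measure.restrict_apply hs, Set.inter_eq_left.2]
    intro t ht
    have := abs_le.1 (hB z.1); have := abs_le.1 (hB z.2)
    exact ⟨by linarith [ht.1], by linarith [ht.2]⟩
  simp_rw [h1]
  rw [lintegral_lintegral_swap]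
  · refine lintegral_congr fun t => ?_
    rw [← lintegral_indicator_one]
    · refine lintegral_congr fun z => ?_
      simp [Set.indicator, Set.mem_prod, and_comm]
    · exact (measurableSet_lt (by fun_prop) (by fun_prop)).prod
        (measurableSet_lt (by fun_prop) (by fun_prop)).compl
  · exact (measurable_one.indicator hm).aemeasurable

lemma sq_sub_le_abs_sub_mul_abs (a b : ℝ) : (a - b) ^ 2 / 2 ≤ |(|a| * a - |b| * b)| := by
  rcases le_total 0 a with ha | ha <;> rcases le_total 0 b with hb | hb <;>
  simp only [abs_of_nonneg, abs_of_nonpos, ha, hb] <;>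
  rcases le_total a b with h | h <;>
  first
    | (refine le_trans ?_ (le_abs_self _); nlinarith [mul_nonneg ha hb, mul_self_nonneg (a-b), mul_self_nonneg (a+b)])
    | (refine le_trans ?_ (neg_le_abs _); nlinarith [mul_self_nonneg (a-b), mul_self_nonneg (a+b)])
    | (refine le_trans ?_ (le_abs_self _); nlinarith [mul_self_nonneg (a-b), mul_self_nonneg (a+b)])

lemma abs_sub_mul_abs_le (a b : ℝ) :
    |a| * a - |b| * b ≤ |a - b| * (|a| + |b|) := by
  rcases le_total 0 a with ha | ha <;> rcases le_total 0 b with hb | hb <;>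
  simp only [abs_of_nonneg, abs_of_nonpos, ha, hb] <;>
  nlinarith [le_abs_self (a-b), neg_le_abs (a-b), abs_nonneg (a-b)]


lemma isFiniteMeasure_of_map_fst_le {X : Type*} [MeasurableSpace X] {μ : Measure X}
    [IsFiniteMeasure μ] {ρ : Measure (X × X)} (h1 : ρ.map Prod.fst ≤ μ) : IsFiniteMeasure ρ := by
  refine ⟨?_⟩
  have := h1 Set.univ
  rw [Measure.map_apply measurable_fst MeasurableSet.univ, Set.preimage_univ] at this
  exact this.trans_lt (measure_lt_top μ _)

/-- A conductance bound with an additive defect implies a weak Poincaré inequality. -/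
lemma variance_le_of_flow_lower_bound {X : Type*} [MeasurableSpace X] {μ : Measure X}
    [IsProbabilityMeasure μ] {ρ : Measure (X × X)}
    (h1 : ρ.map Prod.fst ≤ μ) (h2 : ρ.map Prod.snd ≤ μ) {Φ s M : ℝ} (hΦ : 0 < Φ) (hs : 0 ≤ s)
    (hflow : ∀ S, MeasurableSet S → Φ * (μ.real S * μ.real Sᶜ - s) ≤ ρ.real (S ×ˢ Sᶜ))
    {h : X → ℝ} (hh : Measurable h) (h0 : ∀ x, 0 ≤ h x) (hM : ∀ x, h x ≤ M)
    {m : ℝ} (hm : m = ∫ x, h x ∂μ) :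
    ∫ x, (h x - m) ^ 2 ∂μ ≤ 64 / Φ ^ 2 * ∫ z, (h z.1 - h z.2) ^ 2 ∂ρ + 8 * s * M ^ 2 := by
  have := isFiniteMeasure_of_map_fst_le h1
  have hint : Integrable h μ := Integrable.of_bound hh.aestronglyMeasurable M
    (.of_forall fun x => by rw [Real.norm_eq_abs, abs_of_nonneg (h0 x)]; exact hM x)
  have hm0 : 0 ≤ m := hm ▸ integral_nonneg h0
  have hmM : m ≤ M := by
    have := integral_mono hint (integrable_const M) hM
    simpa [← hm] using this
  have hM0 : 0 ≤ M := hm0.trans hmM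
  have hc : ∀ x, |h x - m| ≤ M := fun x =>
    abs_le.2 ⟨by linarith [h0 x], by linarith [hM x]⟩
  set φ : X → ℝ := fun x => |h x - m| * (h x - m) with hφdef
  have hφ : Measurable φ := by fun_prop
  have hφB : ∀ x, |φ x| ≤ M ^ 2 := fun x => by
    rw [hφdef, abs_mul, abs_abs, sq]
    exact mul_le_mul (hc x) (hc x) (abs_nonneg _) hM0
  -- bounded measurable functions on the product are integrable
  have hbdd : ∀ (ν : Measure (X × X)) [IsFiniteMeasure ν] (F : X × X → ℝ) (B : ℝ),
      Measurable F → (∀ z, |F z| ≤ B) → Integrable F ν := fun ν _ F B hF hB =>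
    Integrable.of_bound hF.aestronglyMeasurable B (.of_forall fun z => hB z)
  have hposB : ∀ z : X × X, |max (φ z.1 - φ z.2) 0| ≤ 2 * M ^ 2 := fun z => by
    rw [abs_of_nonneg (le_max_right _ _)]
    have := abs_le.1 (hφB z.1); have := abs_le.1 (hφB z.2)
    exact max_le (by linarith) (by positivity)
  have hlint : ∀ (ν : Measure (X × X)) [IsFiniteMeasure ν],
      ∫⁻ z, ENNReal.ofReal (φ z.1 - φ z.2) ∂ν
        = ENNReal.ofReal (∫ z, max (φ z.1 - φ z.2) 0 ∂ν) := by
    intro ν _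
    rw [ofReal_integral_eq_lintegral_ofReal (hbdd ν _ _ (by fun_prop) hposB)
      (.of_forall fun z => le_max_right _ _)]
    refine lintegral_congr fun z => ?_
    rcases le_total (φ z.1 - φ z.2) 0 with hz | hz
    · rw [max_eq_right hz, ENNReal.ofReal_of_nonpos hz, ENNReal.ofReal_zero]
    · rw [max_eq_left hz]
  have hpos : ∀ ν : Measure (X × X), 0 ≤ ∫ z, max (φ z.1 - φ z.2) 0 ∂ν := fun ν =>
    integral_nonneg fun z => le_max_right _ _
  -- comparison of the two positive parts
  have key : Φ * ∫ z, max (φ z.1 - φ z.2) 0 ∂(μ.prod μ)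
      ≤ ∫ z, max (φ z.1 - φ z.2) 0 ∂ρ + Φ * s * (2 * M ^ 2) := by
    have e : ENNReal.ofReal Φ * ∫⁻ z, ENNReal.ofReal (φ z.1 - φ z.2) ∂(μ.prod μ)
        ≤ ∫⁻ z, ENNReal.ofReal (φ z.1 - φ z.2) ∂ρ
          + ENNReal.ofReal (Φ * s) * ENNReal.ofReal (2 * M ^ 2) := by
      rw [lintegral_ofReal_sub_eq_lintegral_measure (μ.prod μ) hφ hφB,
        lintegral_ofReal_sub_eq_lintegral_measure ρ hφ hφB]
      have hv : ENNReal.ofReal (Φ * s) * ENNReal.ofReal (2 * M ^ 2)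
          = ∫⁻ _ in Set.Ico (-M ^ 2) (M ^ 2), ENNReal.ofReal (Φ * s) := by
        rw [setLIntegral_const, Real.volume_Ico]; congr 2; ring
      rw [hv, ← lintegral_add_right _ measurable_const,
        ← lintegral_const_mul' _ _ ENNReal.ofReal_ne_top]
      refine lintegral_mono fun t => ?_
      have hS : MeasurableSet {x | t < φ x} := measurableSet_lt measurable_const hφ
      have := hflow _ hS
      rw [Measure.prod_prod, ← ofReal_measureReal, ← ofReal_measureReal, ← ofReal_measureReal,
        ← ENNReal.ofReal_mul (by positivity), ← ENNReal.ofReal_mul hΦ.le,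
        ← ENNReal.ofReal_add (by positivity) (by positivity)]
      exact ENNReal.ofReal_le_ofReal (by linarith)
    rw [hlint, hlint, ← ENNReal.ofReal_mul hΦ.le, ← ENNReal.ofReal_mul (by positivity),
      ← ENNReal.ofReal_add (hpos _) (by positivity),
      ENNReal.ofReal_le_ofReal_iff (add_nonneg (hpos _) (by positivity))] at e
    exact e
  have hV : Integrable (fun x => (h x - m) ^ 2) μ :=
    Integrable.of_bound (by fun_prop) (M ^ 2) (.of_forall fun x => by
      rw [Real.norm_eq_abs, abs_pow]; exact pow_le_pow_left₀ (abs_nonneg _) (hc x) 2)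
  set V := ∫ x, (h x - m) ^ 2 ∂μ with hVdef
  set D := ∫ z, (h z.1 - h z.2) ^ 2 ∂ρ with hDdef
  -- lower bound under the product measure
  have hlow : V / 2 ≤ ∫ z, max (φ z.1 - φ z.2) 0 ∂(μ.prod μ) := by
    have hsw : ∫ z, max (φ z.2 - φ z.1) 0 ∂(μ.prod μ)
        = ∫ z, max (φ z.1 - φ z.2) 0 ∂(μ.prod μ) := by
      rw [← integral_prod_swap]; rfl
    have hI1 := hbdd (μ.prod μ) (fun z => max (φ z.1 - φ z.2) 0) _ (by fun_prop) hposB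
    have hI2 := hbdd (μ.prod μ) (fun z => max (φ z.2 - φ z.1) 0) _ (by fun_prop)
      (fun z => hposB z.swap)
    have hsum : ∫ z, ((h z.1 - h z.2) ^ 2 / 2) ∂(μ.prod μ)
        ≤ ∫ z, (max (φ z.1 - φ z.2) 0 + max (φ z.2 - φ z.1) 0) ∂(μ.prod μ) := by
      refine integral_mono (hbdd _ _ (2 * M ^ 2) (by fun_prop) fun z => ?_) (hI1.add hI2)
        fun z => ?_
      · rw [abs_of_nonneg (by positivity)]
        have := h0 z.1; have := h0 z.2; have := hM z.1; have := hM z.2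
        nlinarith
      · have := sq_sub_le_abs_sub_mul_abs (h z.1 - m) (h z.2 - m)
        have e : (h z.1 - m - (h z.2 - m)) = h z.1 - h z.2 := by ring
        rw [e] at this
        refine this.trans ?_
        change |φ z.1 - φ z.2| ≤ _
        rcases le_total (φ z.1) (φ z.2) with hz | hz
        · rw [abs_of_nonpos (by linarith)]
          have := le_max_left (φ z.2 - φ z.1) 0
          have := le_max_right (φ z.1 - φ z.2) 0
          linarith
        · rw [abs_of_nonneg (by linarith)]
          have := le_max_right (φ z.2 - φ z.1) 0
          have := le_max_left (φ z.1 - φ z.2) 0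
          linarith
    rw [integral_add hI1 hI2, hsw, integral_div] at hsum
    have hA : Integrable (fun z : X × X => (h z.1 - m) ^ 2) (μ.prod μ) := hV.comp_fst μ
    have hB : Integrable (fun z : X × X => (h z.2 - m) ^ 2) (μ.prod μ) := hV.comp_snd μ
    have hAB : Integrable (fun z : X × X => (h z.1 - m) ^ 2 + (h z.2 - m) ^ 2) (μ.prod μ) := hA.add hB
    have hcr : Integrable (fun z : X × X => (h z.1 - m) * (h z.2 - m)) (μ.prod μ) :=
      (hint.sub (integrable_const m)).mul_prod (hint.sub (integrable_const m))
    have hexp : ∫ z, (h z.1 - h z.2) ^ 2 ∂(μ.prod μ) = 2 * V := by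
      have : ∀ z : X × X, (h z.1 - h z.2) ^ 2
          = (h z.1 - m) ^ 2 + (h z.2 - m) ^ 2 - 2 * ((h z.1 - m) * (h z.2 - m)) := fun z => by ring
      simp_rw [this]
      rw [integral_sub hAB (hcr.const_mul 2), integral_add hA hB, integral_const_mul,
        integral_prod_mul (fun x => h x - m) (fun x => h x - m),
        integral_fun_fst (fun x => (h x - m) ^ 2), integral_fun_snd (fun x => (h x - m) ^ 2),
        integral_sub hint (integrable_const m)]
      simp [← hm, ← hVdef]; ring
    rw [hexp] at hsum
    linarith
  -- upper bound under the flow measure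
  have hup : ∫ z, max (φ z.1 - φ z.2) 0 ∂ρ ≤ 8 / Φ * D + Φ / 8 * V := by
    have hD : Integrable (fun z : X × X => (h z.1 - h z.2) ^ 2) ρ :=
      hbdd ρ _ (M ^ 2) (by fun_prop) fun z => by
        rw [abs_pow]
        have := h0 z.1; have := h0 z.2; have := hM z.1; have := hM z.2
        exact pow_le_pow_left₀ (abs_nonneg _) (abs_le.2 ⟨by linarith, by linarith⟩) 2
    have hbd : ∀ x, |(h x - m) ^ 2| ≤ M ^ 2 := fun x => by
      rw [abs_pow]; exact pow_le_pow_left₀ (abs_nonneg _) (hc x) 2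
    have hA : Integrable (fun z : X × X => (h z.1 - m) ^ 2) ρ :=
      hbdd ρ _ _ (by fun_prop) fun z => hbd z.1
    have hB : Integrable (fun z : X × X => (h z.2 - m) ^ 2) ρ :=
      hbdd ρ _ _ (by fun_prop) fun z => hbd z.2
    have hAB : Integrable (fun z : X × X => (h z.1 - m) ^ 2 + (h z.2 - m) ^ 2) ρ := hA.add hB
    have hA' : ∫ z, (h z.1 - m) ^ 2 ∂ρ ≤ V := by
      rw [← integral_map (f := fun x => (h x - m) ^ 2) measurable_fst.aemeasurable (by fun_prop)]
      exact integral_mono_measure h1 (.of_forall fun x => by positivity) hV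
    have hB' : ∫ z, (h z.2 - m) ^ 2 ∂ρ ≤ V := by
      rw [← integral_map (f := fun x => (h x - m) ^ 2) measurable_snd.aemeasurable (by fun_prop)]
      exact integral_mono_measure h2 (.of_forall fun x => by positivity) hV
    have hle : ∫ z, max (φ z.1 - φ z.2) 0 ∂ρ ≤ ∫ z, (8 / Φ * (h z.1 - h z.2) ^ 2
        + Φ / 16 * ((h z.1 - m) ^ 2 + (h z.2 - m) ^ 2)) ∂ρ := by
      refine integral_mono (hbdd ρ _ _ (by fun_prop) hposB)
        ((hD.const_mul _).add (hAB.const_mul _)) fun z => ?_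
      refine max_le ?_ (by positivity)
      have := abs_sub_mul_abs_le (h z.1 - m) (h z.2 - m)
      have e : (h z.1 - m - (h z.2 - m)) = h z.1 - h z.2 := by ring
      rw [e] at this
      refine this.trans ?_
      have h3 : 8 / Φ * (h z.1 - h z.2) ^ 2
        + Φ / 16 * ((h z.1 - m) ^ 2 + (h z.2 - m) ^ 2)
        - |h z.1 - h z.2| * (|h z.1 - m| + |h z.2 - m|)
        = 8 / Φ * (|h z.1 - h z.2| - Φ / 16 * (|h z.1 - m| + |h z.2 - m|)) ^ 2
          + Φ / 32 * (|h z.1 - m| - |h z.2 - m|) ^ 2 := by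
        rw [← sq_abs (h z.1 - h z.2), ← sq_abs (h z.1 - m), ← sq_abs (h z.2 - m)]
        field_simp; ring
      have h4 : 0 ≤ 8 / Φ * (|h z.1 - h z.2| - Φ / 16 * (|h z.1 - m| + |h z.2 - m|)) ^ 2
          + Φ / 32 * (|h z.1 - m| - |h z.2 - m|) ^ 2 := by positivity
      linarith
    rw [integral_add (hD.const_mul _) (hAB.const_mul _), integral_const_mul,
      integral_const_mul, integral_add hA hB] at hle
    nlinarith
  have hD0 : 0 ≤ D := integral_nonneg fun z => by positivity
  have hfin : Φ * (V / 2) ≤ 8 / Φ * D + Φ / 8 * V + Φ * s * (2 * M ^ 2) := by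
    have := mul_le_mul_of_nonneg_left hlow hΦ.le
    linarith
  have h5 : Φ * (3 / 8 * V) ≤ Φ * (8 / Φ ^ 2 * D + s * (2 * M ^ 2)) := by
    have : Φ * (8 / Φ ^ 2 * D) = 8 / Φ * D := by field_simp
    rw [mul_add, this]; linarith
  have h6 := le_of_mul_le_mul_left h5 hΦ
  have h7 : 0 ≤ 8 / Φ ^ 2 * D := by positivity
  have h8 : 64 / Φ ^ 2 * D = 8 * (8 / Φ ^ 2 * D) := by ring
  have h9 : 0 ≤ s * M ^ 2 := by positivity
  rw [h8]; linarith


lemma exists_det_bounds_of_forall_apply_eq {E ι : Type*} [NormedAddCommGroup E]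
    [InnerProductSpace ℝ E] [FiniteDimensional ℝ E] (a y : ι → E) {r : ℝ} {N : ℕ}
    (hr : r ≤ 1 / 4) (hr0 : 0 ≤ r) (ha : ∀ i, ‖a i‖ = 1) (hy : ∀ i, ‖y i‖ ≤ r / N)
    (s : Finset ι) (hs : s.card ≤ N) (B : E →ₗ[ℝ] E)
    (hB : ∀ v, B v = v + ∑ i ∈ s, ⟪y i, v⟫ • a i) :
    (1 - 2 * (r / N)) ^ s.card ≤ LinearMap.det B ∧
      LinearMap.det B ≤ (1 + 2 * (r / N)) ^ s.card := by
  classical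
  induction s using Finset.induction_on generalizing B with
  | empty =>
    have : B = LinearMap.id := by ext v; simpa using hB v
    simp [this]
  | insert j s hj ih =>
    rw [Finset.card_insert_of_notMem hj] at hs
    have hN : (1 : ℝ) ≤ N := by exact_mod_cast (by omega : 1 ≤ N)
    have hN0 : (0 : ℝ) < N := by linarith
    have hrN : r / N ≤ 1 / 4 := (div_le_self hr0 hN).trans hr
    have hrN0 : 0 ≤ r / N := by positivity
    let B' : E →ₗ[ℝ] E := LinearMap.id + ∑ i ∈ s, ((innerₛₗ ℝ (y i)).smulRight (a i))
    have hB' : ∀ v, B' v = v + ∑ i ∈ s, ⟪y i, v⟫ • a i := fun v => by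
      simp [B', LinearMap.sum_apply]
    obtain ⟨hl, hu⟩ := ih (by omega) B' hB'
    have hdet : 0 < LinearMap.det B' := lt_of_lt_of_le (by apply pow_pos; linarith) hl
    have hunit : IsUnit B' := (LinearMap.isUnit_iff_isUnit_det B').2 hdet.ne'.isUnit
    obtain ⟨w, hw⟩ := ((Module.End.isUnit_iff B').1 hunit).2 (a j)
    have hsum : ‖∑ i ∈ s, ⟪y i, w⟫ • a i‖ ≤ r * ‖w‖ := by
      calc ‖∑ i ∈ s, ⟪y i, w⟫ • a i‖ ≤ ∑ i ∈ s, r / N * ‖w‖ := by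
            refine norm_sum_le_of_le _ fun i _ => ?_
            rw [norm_smul, ha, mul_one]
            exact (norm_inner_le_norm _ _).trans
              (mul_le_mul_of_nonneg_right (hy i) (norm_nonneg _))
        _ = s.card * (r / N) * ‖w‖ := by rw [Finset.sum_const, nsmul_eq_mul]; ring
        _ ≤ r * ‖w‖ := by
            refine mul_le_mul_of_nonneg_right ?_ (norm_nonneg _)
            have : (s.card : ℝ) ≤ N := by exact_mod_cast (by omega : s.card ≤ N)
            calc (s.card : ℝ) * (r / N) ≤ N * (r / N) := by gcongr
              _ = r := by field_simp
    have hwn : ‖w‖ ≤ 2 := by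
      have h1 : w = a j - ∑ i ∈ s, ⟪y i, w⟫ • a i := by rw [← hw, hB']; abel
      have h2 : ‖w‖ ≤ ‖a j‖ + ‖∑ i ∈ s, ⟪y i, w⟫ • a i‖ := by
        conv_lhs => rw [h1]
        exact norm_sub_le _ _
      rw [ha] at h2
      nlinarith [norm_nonneg w]
    have hcomp : B = B' ∘ₗ LinearMap.transvection (innerₛₗ ℝ (y j)) w := by
      ext v
      rw [LinearMap.comp_apply, LinearMap.transvection.apply, map_add, map_smul, hw, hB', hB,
        Finset.sum_insert hj]
      simp only [innerₛₗ_apply_apply]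
      abel
    rw [hcomp, LinearMap.det_comp, LinearMap.transvection.det, Finset.card_insert_of_notMem hj]
    have hin : |⟪y j, w⟫| ≤ 2 * (r / N) := by
      calc |⟪y j, w⟫| ≤ ‖y j‖ * ‖w‖ := abs_real_inner_le_norm _ _
        _ ≤ r / N * 2 := mul_le_mul (hy j) hwn (norm_nonneg _) hrN0
        _ = _ := by ring
    obtain ⟨h1, h2⟩ := abs_le.1 hin
    simp only [innerₛₗ_apply_apply]
    have h3 : (0 : ℝ) ≤ 1 - 2 * (r / N) := by linarith
    constructor
    · rw [pow_succ]
      exact mul_le_mul hl (by linarith) h3 hdet.le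
    · rw [pow_succ]
      exact mul_le_mul hu (by linarith) (by linarith) (by positivity)

/-- The determinant of `id + ∑ i, a i ⊗ y i` is within a factor two of one when the `a i` are
unit vectors and the norms of the `y i` are at most `1 / (4 n)`. -/
lemma det_mem_Icc_of_forall_apply_eq {E : Type*} [NormedAddCommGroup E]
    [InnerProductSpace ℝ E] [FiniteDimensional ℝ E] {n : ℕ} (a y : Fin n → E)
    (ha : ∀ i, ‖a i‖ = 1) (hy : ∀ i, ‖y i‖ ≤ 1 / 4 / n) (B : E →ₗ[ℝ] E)
    (hB : ∀ v, B v = v + ∑ i, ⟪y i, v⟫ • a i) :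
    1 / 2 ≤ LinearMap.det B ∧ LinearMap.det B ≤ 2 := by
  obtain ⟨h1, h2⟩ := exists_det_bounds_of_forall_apply_eq a y (r := 1 / 4) (N := n) le_rfl
    (by norm_num) ha hy Finset.univ (by simp) B hB
  rw [Finset.card_univ, Fintype.card_fin] at h1 h2
  rcases Nat.eq_zero_or_pos n with rfl | hn
  · simp only [pow_zero] at h1 h2
    constructor <;> linarith
  have hn1 : (1 : ℝ) ≤ n := by exact_mod_cast hn
  constructor
  · refine le_trans ?_ h1
    have := one_add_mul_le_pow (a := -(2 * (1 / 4 / (n : ℝ)))) (by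
      have : 1 / 4 / (n : ℝ) ≤ 1 / 4 := div_le_self (by norm_num) hn1
      linarith) n
    calc (1 : ℝ) / 2 = 1 + n * -(2 * (1 / 4 / (n : ℝ))) := by field_simp; norm_num
      _ ≤ _ := this
      _ = _ := by rw [← sub_eq_add_neg]
  · refine h2.trans ?_
    calc (1 + 2 * (1 / 4 / (n : ℝ))) ^ n ≤ (Real.exp (2 * (1 / 4 / (n : ℝ)))) ^ n := by
          gcongr
          linarith [Real.add_one_le_exp (2 * (1 / 4 / (n : ℝ)))]
      _ = Real.exp (1 / 2) := by rw [← Real.exp_nat_mul]; congr 1; field_simp; norm_num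
      _ ≤ 2 := by
          have h : Real.exp (1 / 2) ^ 2 = Real.exp 1 := by rw [← Real.exp_nat_mul]; norm_num
          have := Real.exp_one_lt_d9
          nlinarith [Real.exp_pos (1 / 2)]


/-- Two-sided change of variables for a differentiable bijection whose Jacobian is comparable
to a constant. -/
lemma lintegral_comp_le_and_le_lintegral_comp {E : Type*} [NormedAddCommGroup E]
    [NormedSpace ℝ E] [FiniteDimensional ℝ E] [MeasurableSpace E] [BorelSpace E]
    (μ : Measure E) [μ.IsAddHaarMeasure] {F : E → E} (hbij : Function.Bijective F)
    {F' : E → E →L[ℝ] E} (hF : ∀ x, HasFDerivAt F (F' x) x) {D : ℝ} (hD : 0 < D)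
    (hdet : ∀ x, D / 2 ≤ |(F' x).det| ∧ |(F' x).det| ≤ 2 * D) (g : E → ℝ≥0∞) :
    ∫⁻ x, g (F x) ∂μ ≤ ENNReal.ofReal (2 / D) * ∫⁻ x, g x ∂μ ∧
      ∫⁻ x, g x ∂μ ≤ ENNReal.ofReal (2 * D) * ∫⁻ x, g (F x) ∂μ := by
  have key := lintegral_image_eq_lintegral_abs_det_fderiv_mul μ MeasurableSet.univ
    (fun x _ => (hF x).hasFDerivWithinAt) hbij.1.injOn g
  rw [Set.image_univ, hbij.2.range_eq, Measure.restrict_univ] at key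
  constructor
  · rw [key, ← lintegral_const_mul' _ _ ENNReal.ofReal_ne_top]
    refine lintegral_mono fun x => ?_
    rw [← mul_assoc, ← ENNReal.ofReal_mul (by positivity)]
    refine le_mul_of_one_le_left' (ENNReal.one_le_ofReal.2 ?_)
    have := (hdet x).1
    calc (1 : ℝ) = 2 / D * (D / 2) := by field_simp
      _ ≤ _ := by gcongr
  · rw [key, ← lintegral_const_mul' _ _ ENNReal.ofReal_ne_top]
    refine lintegral_mono fun x => ?_
    gcongr
    exact (hdet x).2

/-- A Lipschitz perturbation of a positive multiple of the identity is bijective. -/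
lemma bijective_of_norm_sub_sub_smul_le {E : Type*} [NormedAddCommGroup E]
    [NormedSpace ℝ E] [CompleteSpace E] {F : E → E} {τ : ℝ} (hτ : 0 < τ)
    (h : ∀ x y, ‖F x - F y - τ • (x - y)‖ ≤ τ / 4 * ‖x - y‖) : Function.Bijective F := by
  have hG : ApproximatesLinearOn (fun x => τ⁻¹ • F x)
      (((ContinuousLinearEquiv.refl ℝ E) : E ≃L[ℝ] E) : E →L[ℝ] E) Set.univ (1 / 4) := by
    intro x _ y _
    have e : τ⁻¹ • F x - τ⁻¹ • F y - (((ContinuousLinearEquiv.refl ℝ E) : E ≃L[ℝ] E) :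
        E →L[ℝ] E) (x - y) = τ⁻¹ • (F x - F y - τ • (x - y)) := by
      rw [smul_sub, smul_sub, smul_smul, inv_mul_cancel₀ hτ.ne', one_smul]; rfl
    rw [e, norm_smul, Real.norm_of_nonneg (by positivity)]
    calc τ⁻¹ * ‖F x - F y - τ • (x - y)‖ ≤ τ⁻¹ * (τ / 4 * ‖x - y‖) := by gcongr; exact h x y
      _ = _ := by push_cast; field_simp
  have hc : Subsingleton E ∨ (1 / 4 : ℝ≥0) <
      ‖((ContinuousLinearEquiv.refl ℝ E).symm : E →L[ℝ] E)‖₊⁻¹ := by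
    rcases subsingleton_or_nontrivial E with hE | hE
    · exact .inl hE
    · right
      have : ‖((ContinuousLinearEquiv.refl ℝ E).symm : E →L[ℝ] E)‖₊ = 1 := by
        ext; exact ContinuousLinearMap.norm_id
      rw [this]
      norm_num [← NNReal.coe_lt_coe]
  have hb := (hG.toHomeomorph _ hc).bijective
  have e : F = (fun x => τ • x) ∘ (fun x => τ⁻¹ • F x) := by
    ext x; simp [smul_smul, hτ.ne']
  rw [e]
  exact (MulAction.bijective (Units.mk0 τ hτ.ne')).comp hb


/-- A ridge separable potential built from unit vectors and profiles with bounded second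
derivative. -/
structure IsRidge {d n : ℕ} (u : Fin n → ℝ → ℝ) (a : Fin n → Euc d) (ρ : ℝ) : Prop where
  contDiff : ∀ i, ContDiff ℝ 3 (u i)
  norm_eq_one : ∀ i, ‖a i‖ = 1
  abs_deriv_deriv_le : ∀ i z, |deriv (deriv (u i)) z| ≤ ρ
  pos : 0 < ρ
  card_pos : 0 < n

/-- The ridge separable potential. -/
noncomputable def ridgePotential {d n : ℕ} (u : Fin n → ℝ → ℝ) (a : Fin n → Euc d) (θ : Euc d) : ℝ :=
  ∑ i, u i ⟪a i, θ⟫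

/-- The gradient of the ridge separable potential. -/
noncomputable def ridgeGrad {d n : ℕ} (u : Fin n → ℝ → ℝ) (a : Fin n → Euc d) (θ : Euc d) : Euc d :=
  ∑ i, deriv (u i) ⟪a i, θ⟫ • a i

/-- The normalized analysis map `v ↦ (n^{-1/2} ⟪a i, v⟫)_i`. -/
noncomputable def ridgeMap {d n : ℕ} (a : Fin n → Euc d) : Euc d →ₗ[ℝ] Euc n :=
  (Real.sqrt n)⁻¹ • ((WithLp.linearEquiv 2 ℝ (Fin n → ℝ)).symm.toLinearMap ∘ₗ
    LinearMap.pi fun i => innerₛₗ ℝ (a i))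

lemma ridgeMap_apply {d n : ℕ} (a : Fin n → Euc d) (v : Euc d) (i : Fin n) :
    ridgeMap a v i = (Real.sqrt n)⁻¹ * ⟪a i, v⟫ := by
  simp [ridgeMap]

lemma norm_ridgeMap_sq {d n : ℕ} (a : Fin n → Euc d) (v : Euc d) :
    ‖ridgeMap a v‖ ^ 2 = (∑ i, ⟪a i, v⟫ ^ 2) / n := by
  rw [EuclideanSpace.norm_sq_eq]
  simp_rw [ridgeMap_apply, Real.norm_eq_abs, sq_abs, mul_pow, inv_pow]
  rw [Real.sq_sqrt (Nat.cast_nonneg n), ← Finset.mul_sum]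
  ring

namespace IsRidge

variable {d n : ℕ} {u : Fin n → ℝ → ℝ} {a : Fin n → Euc d} {ρ : ℝ} (hr : IsRidge u a ρ)
include hr

lemma card_cast_pos : (0 : ℝ) < n := by exact_mod_cast hr.card_pos

lemma smooth_pos : 0 < n * ρ := mul_pos hr.card_cast_pos hr.pos

lemma norm_ridgeMap_le (v : Euc d) : ‖ridgeMap a v‖ ≤ ‖v‖ := by
  refine le_of_sq_le_sq ?_ (norm_nonneg v)
  rw [norm_ridgeMap_sq, div_le_iff₀ hr.card_cast_pos]
  calc ∑ i, ⟪a i, v⟫ ^ 2 ≤ ∑ _i : Fin n, ‖v‖ ^ 2 := by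
        refine Finset.sum_le_sum fun i _ => ?_
        rw [← sq_abs]
        refine pow_le_pow_left₀ (abs_nonneg _) ?_ 2
        simpa [hr.norm_eq_one i] using abs_real_inner_le_norm (a i) v
    _ = _ := by simp [mul_comm]

lemma hasDerivAt (i : Fin n) (z : ℝ) : HasDerivAt (u i) (deriv (u i) z) z :=
  ((hr.contDiff i).differentiable (by norm_num) z).hasDerivAt

lemma contDiff_deriv (i : Fin n) : ContDiff ℝ 2 (deriv (u i)) := by
  have h : ContDiff ℝ (2 + 1) (u i) := by
    have := hr.contDiff i
    norm_num at this ⊢; exact this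
  exact (contDiff_succ_iff_deriv.1 h).2.2

lemma hasDerivAt_deriv (i : Fin n) (z : ℝ) :
    HasDerivAt (deriv (u i)) (deriv (deriv (u i)) z) z :=
  ((hr.contDiff_deriv i).differentiable (by norm_num) z).hasDerivAt

lemma abs_deriv_sub_le (i : Fin n) (s t : ℝ) :
    |deriv (u i) s - deriv (u i) t| ≤ ρ * |s - t| := by
  have := Convex.norm_image_sub_le_of_norm_deriv_le (f := deriv (u i)) (s := Set.univ) (C := ρ)
    (fun x _ => (hr.hasDerivAt_deriv i x).differentiableAt)
    (fun x _ => hr.abs_deriv_deriv_le i x) convex_univ (Set.mem_univ t) (Set.mem_univ s)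
  simpa [Real.norm_eq_abs] using this

lemma abs_taylor_le (i : Fin n) (s t : ℝ) :
    |u i (s + t) - u i s - deriv (u i) s * t| ≤ ρ / 2 * t ^ 2 := by
  -- integrate the Lipschitz bound on the derivative along the segment
  have hc : Continuous (deriv (u i)) := (hr.contDiff_deriv i).continuous
  have h1 : ∫ r in (0 : ℝ)..1, (deriv (u i) (s + r * t) - deriv (u i) s) * t
      = u i (s + t) - u i s - deriv (u i) s * t := by
    have hd : ∀ r ∈ Set.uIcc (0 : ℝ) 1, HasDerivAt
        (fun r => u i (s + r * t) - r * (deriv (u i) s * t))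
        ((deriv (u i) (s + r * t) - deriv (u i) s) * t) r := by
      intro r _
      have e1 : HasDerivAt (fun r => s + r * t) t r := by
        simpa using ((hasDerivAt_id r).mul_const t).const_add s
      have e2 := (hr.hasDerivAt i (s + r * t)).comp r e1
      have e3 : HasDerivAt (fun r : ℝ => r * (deriv (u i) s * t)) (deriv (u i) s * t) r := by
        simpa using (hasDerivAt_id r).mul_const (deriv (u i) s * t)
      exact (e2.sub e3).congr_deriv (by ring)
    rw [intervalIntegral.integral_eq_sub_of_hasDerivAt hd
      (Continuous.intervalIntegrable (by fun_prop) _ _)]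
    simp; ring
  rw [← h1]
  have h2 : ∀ r ∈ Set.Icc (0 : ℝ) 1,
      ‖(deriv (u i) (s + r * t) - deriv (u i) s) * t‖ ≤ r * (ρ * t ^ 2) := by
    intro r hr'
    rw [Real.norm_eq_abs, abs_mul]
    have := hr.abs_deriv_sub_le i (s + r * t) s
    rw [add_sub_cancel_left, abs_mul, abs_of_nonneg hr'.1] at this
    calc _ ≤ ρ * (r * |t|) * |t| := by gcongr
      _ = r * (ρ * |t| ^ 2) := by ring
      _ = _ := by rw [sq_abs]
  have h3 := intervalIntegral.norm_integral_le_of_norm_le (a := (0 : ℝ)) (b := 1) (μ := volume)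
    zero_le_one
    (Filter.Eventually.of_forall fun r hr' => h2 r ⟨hr'.1.le, hr'.2⟩)
    (Continuous.intervalIntegrable (by fun_prop) _ _)
  rw [Real.norm_eq_abs] at h3
  refine h3.trans (le_of_eq ?_)
  rw [intervalIntegral.integral_mul_const, integral_id]
  ring

lemma abs_inner_ridgeGrad_sub_le (x y p : Euc d) :
    |⟪p, ridgeGrad u a x - ridgeGrad u a y⟫|
      ≤ n * ρ * (‖ridgeMap a (x - y)‖ * ‖ridgeMap a p‖) := by
  have hn := hr.card_cast_pos
  have h1 : ⟪p, ridgeGrad u a x - ridgeGrad u a y⟫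
      = ∑ i, (deriv (u i) ⟪a i, x⟫ - deriv (u i) ⟪a i, y⟫) * ⟪a i, p⟫ := by
    simp only [ridgeGrad, ← Finset.sum_sub_distrib, inner_sum, ← sub_smul, inner_smul_right]
    simp_rw [real_inner_comm]
  have hin : (∑ i, |⟪a i, x - y⟫| * |⟪a i, p⟫|)
      ≤ n * (‖ridgeMap a (x - y)‖ * ‖ridgeMap a p‖) := by
    refine le_of_sq_le_sq ?_ (by positivity)
    refine (Finset.sum_mul_sq_le_sq_mul_sq _ _ _).trans (le_of_eq ?_)
    simp_rw [sq_abs]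
    rw [mul_pow, mul_pow, norm_ridgeMap_sq, norm_ridgeMap_sq]
    field_simp
  rw [h1]
  calc _ ≤ ∑ i, |(deriv (u i) ⟪a i, x⟫ - deriv (u i) ⟪a i, y⟫) * ⟪a i, p⟫| :=
        Finset.abs_sum_le_sum_abs _ _
    _ ≤ ∑ i, ρ * (|⟪a i, x - y⟫| * |⟪a i, p⟫|) := by
        refine Finset.sum_le_sum fun i _ => ?_
        rw [abs_mul, ← mul_assoc, inner_sub_right]
        gcongr
        exact hr.abs_deriv_sub_le i _ _
    _ ≤ ρ * (n * (‖ridgeMap a (x - y)‖ * ‖ridgeMap a p‖)) := by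
        rw [← Finset.mul_sum]
        exact mul_le_mul_of_nonneg_left hin hr.pos.le
    _ = _ := by ring

lemma norm_ridgeGrad_sub_le (x y : Euc d) :
    ‖ridgeGrad u a x - ridgeGrad u a y‖ ≤ n * ρ * ‖ridgeMap a (x - y)‖ := by
  set w := ridgeGrad u a x - ridgeGrad u a y with hw
  have h := hr.abs_inner_ridgeGrad_sub_le x y w
  rw [← hw, real_inner_self_eq_norm_sq, abs_of_nonneg (by positivity)] at h
  have h2 := hr.norm_ridgeMap_le w
  have hL := hr.smooth_pos
  rcases (norm_nonneg w).eq_or_lt with h0 | h0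
  · rw [← h0]; positivity
  · refine le_of_mul_le_mul_right ?_ h0
    calc ‖w‖ * ‖w‖ = ‖w‖ ^ 2 := by ring
      _ ≤ _ := h
      _ ≤ n * ρ * (‖ridgeMap a (x - y)‖ * ‖w‖) := by gcongr
      _ = _ := by ring

lemma norm_ridgeGrad_sub_le' (x y : Euc d) :
    ‖ridgeGrad u a x - ridgeGrad u a y‖ ≤ n * ρ * ‖x - y‖ :=
  (hr.norm_ridgeGrad_sub_le x y).trans
    (mul_le_mul_of_nonneg_left (hr.norm_ridgeMap_le _) hr.smooth_pos.le)

lemma abs_ridgePotential_add_sub_le (q v : Euc d) :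
    |ridgePotential u a (q + v) - ridgePotential u a q - ⟪v, ridgeGrad u a q⟫|
      ≤ n * ρ / 2 * ‖ridgeMap a v‖ ^ 2 := by
  have hn := hr.card_cast_pos
  have h1 : ridgePotential u a (q + v) - ridgePotential u a q - ⟪v, ridgeGrad u a q⟫
      = ∑ i, (u i (⟪a i, q⟫ + ⟪a i, v⟫) - u i ⟪a i, q⟫ - deriv (u i) ⟪a i, q⟫ * ⟪a i, v⟫) := by
    simp only [ridgeGrad, ridgePotential, inner_sum, inner_smul_right, Finset.sum_sub_distrib,
      inner_add_right]
    simp_rw [real_inner_comm]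
  rw [h1, norm_ridgeMap_sq]
  calc _ ≤ ∑ i, ρ / 2 * ⟪a i, v⟫ ^ 2 := (Finset.abs_sum_le_sum_abs _ _).trans
        (Finset.sum_le_sum fun i _ => hr.abs_taylor_le i _ _)
    _ = _ := by rw [← Finset.mul_sum]; field_simp

lemma hasGradientAt (x : Euc d) :
    HasGradientAt (ridgePotential u a) (ridgeGrad u a x) x := by
  rw [hasGradientAt_iff_hasFDerivAt]
  have : ∀ i ∈ Finset.univ, HasFDerivAt (fun θ : Euc d => u i ⟪a i, θ⟫)
      (deriv (u i) ⟪a i, x⟫ • innerSL ℝ (a i)) x := fun i _ =>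
    (hr.hasDerivAt i _).comp_hasFDerivAt x (innerSL ℝ (a i)).hasFDerivAt
  refine (HasFDerivAt.fun_sum this).congr_fderiv ?_
  ext v
  simp [ridgeGrad]

lemma gradient_eq : gradient (ridgePotential u a) = ridgeGrad u a :=
  funext fun x => (hr.hasGradientAt x).gradient

lemma hasFDerivAt_ridgeGrad (x : Euc d) :
    HasFDerivAt (ridgeGrad u a)
      (∑ i, (deriv (deriv (u i)) ⟪a i, x⟫ • innerSL ℝ (a i)).smulRight (a i)) x := by
  refine HasFDerivAt.fun_sum fun i _ => ?_
  exact ((hr.hasDerivAt_deriv i _).comp_hasFDerivAt x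
    (innerSL ℝ (a i)).hasFDerivAt).smul_const (a i)

lemma continuous_ridgeGrad : Continuous (ridgeGrad u a) :=
  continuous_iff_continuousAt.2 fun x => (hr.hasFDerivAt_ridgeGrad x).continuousAt

lemma continuous_ridgePotential : Continuous (ridgePotential u a) :=
  continuous_iff_continuousAt.2 fun x =>
    (hasGradientAt_iff_hasFDerivAt.1 (hr.hasGradientAt x)).continuousAt

end IsRidge


/-- The half-step momentum following the `k`-th leapfrog iterate. -/
noncomputable def leapfrogHalf {d : ℕ} (f : Euc d → ℝ) (η : ℝ) (k : ℕ) (z : Euc d × Euc d) :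
    Euc d :=
  (leapfrog f η k z).2 - (η / 2) • gradient f (leapfrog f η k z).1

lemma leapfrog_succ_fst {d : ℕ} (f : Euc d → ℝ) (η : ℝ) (k : ℕ) (z : Euc d × Euc d) :
    (leapfrog f η (k + 1) z).1 = (leapfrog f η k z).1 + η • leapfrogHalf f η k z := by
  simp only [leapfrog, leapfrogHalf]
  rw [smul_sub, smul_smul]
  have : η * (η / 2) = η ^ 2 / 2 := by ring
  rw [this]; abel

lemma leapfrogHalf_succ {d : ℕ} (f : Euc d → ℝ) (η : ℝ) (k : ℕ) (z : Euc d × Euc d) :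
    leapfrogHalf f η (k + 1) z
      = leapfrogHalf f η k z - η • gradient f (leapfrog f η (k + 1) z).1 := by
  simp only [leapfrog, leapfrogHalf]
  module

lemma leapfrog_succ_snd {d : ℕ} (f : Euc d → ℝ) (η : ℝ) (k : ℕ) (z : Euc d × Euc d) :
    (leapfrog f η (k + 1) z).2
      = leapfrogHalf f η k z - (η / 2) • gradient f (leapfrog f η (k + 1) z).1 := by
  simp only [leapfrog, leapfrogHalf]

lemma leapfrog_snd {d : ℕ} (f : Euc d → ℝ) (η : ℝ) (k : ℕ) (z : Euc d × Euc d) :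
    (leapfrog f η k z).2
      = leapfrogHalf f η k z + (η / 2) • gradient f (leapfrog f η k z).1 := by
  simp only [leapfrogHalf]; abel

namespace IsRidge

variable {d n : ℕ} {u : Fin n → ℝ → ℝ} {a : Fin n → Euc d} {ρ : ℝ} (hr : IsRidge u a ρ)
include hr

/-- Two leapfrog trajectories stay close to the corresponding free motions. -/
lemma norm_leapfrog_sub_le {η : ℝ} (hη : 0 ≤ η) {K : ℕ} (hK : n * ρ * (K * η) ^ 2 ≤ 1)
    (x y p p' : Euc d) (k : ℕ) (hk : k ≤ K) :
    ‖(leapfrog (ridgePotential u a) η k (y, p')).1 - (leapfrog (ridgePotential u a) η k (x, p)).1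
        - (y - x) - (k * η) • (p' - p)‖
      ≤ n * ρ * (k * η) ^ 2 * (‖y - x‖ + K * η * ‖p' - p‖) ∧
    ‖leapfrogHalf (ridgePotential u a) η k (y, p')
        - leapfrogHalf (ridgePotential u a) η k (x, p) - (p' - p)‖
      ≤ (2 * k + 1) * (η * (n * ρ)) * (‖y - x‖ + K * η * ‖p' - p‖) := by
  have hL := hr.smooth_pos
  set S := ‖y - x‖ + K * η * ‖p' - p‖ with hS
  have hS0 : 0 ≤ S := by positivity
  have hclose : ∀ k : ℕ, k ≤ K → ∀ v : Euc d, ‖v - (y - x) - (k * η) • (p' - p)‖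
      ≤ n * ρ * (k * η) ^ 2 * S → ‖v‖ ≤ 2 * S := by
    intro k hk v hv
    have hkK : (k : ℝ) ≤ K := by exact_mod_cast hk
    have h1 : n * ρ * (k * η) ^ 2 * S ≤ 1 * S := by
      refine mul_le_mul_of_nonneg_right (le_trans ?_ hK) hS0
      gcongr
    have h2 : v = (v - (y - x) - (k * η) • (p' - p)) + ((y - x) + (k * η) • (p' - p)) := by abel
    have h3 : ‖(y - x) + (k * η) • (p' - p)‖ ≤ S := by
      refine (norm_add_le _ _).trans ?_
      rw [norm_smul, Real.norm_of_nonneg (by positivity), hS]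
      gcongr
    rw [h2]
    refine (norm_add_le _ _).trans ?_
    linarith
  induction k with
  | zero =>
    refine ⟨by simp [leapfrog], ?_⟩
    have e : leapfrogHalf (ridgePotential u a) η 0 (y, p')
        - leapfrogHalf (ridgePotential u a) η 0 (x, p) - (p' - p)
        = -(η / 2) • (ridgeGrad u a y - ridgeGrad u a x) := by
      simp only [leapfrogHalf, leapfrog, hr.gradient_eq]; module
    rw [e, norm_smul, norm_neg, Real.norm_of_nonneg (by positivity)]
    have h2 := hr.norm_ridgeGrad_sub_le' y x
    have h3 : ‖y - x‖ ≤ S := le_add_of_nonneg_right (by positivity)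
    calc η / 2 * ‖ridgeGrad u a y - ridgeGrad u a x‖ ≤ η / 2 * (n * ρ * S) := by
          gcongr; exact h2.trans (by gcongr)
      _ ≤ η * (n * ρ * S) := by
          have : 0 ≤ η * (n * ρ * S) := by positivity
          linarith
      _ = _ := by push_cast; ring
  | succ k ih =>
    obtain ⟨h1, h2⟩ := ih (by omega)
    have hq : ‖(leapfrog (ridgePotential u a) η (k + 1) (y, p')).1
        - (leapfrog (ridgePotential u a) η (k + 1) (x, p)).1
        - (y - x) - ((k + 1 : ℕ) * η) • (p' - p)‖ ≤ n * ρ * ((k + 1 : ℕ) * η) ^ 2 * S := by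
      rw [leapfrog_succ_fst, leapfrog_succ_fst]
      set qy := (leapfrog (ridgePotential u a) η k (y, p')).1
      set qx := (leapfrog (ridgePotential u a) η k (x, p)).1
      set wy := leapfrogHalf (ridgePotential u a) η k (y, p')
      set wx := leapfrogHalf (ridgePotential u a) η k (x, p)
      have e : qy + η • wy - (qx + η • wx) - (y - x) - ((k + 1 : ℕ) * η) • (p' - p)
          = (qy - qx - (y - x) - (k * η) • (p' - p)) + η • (wy - wx - (p' - p)) := by
        push_cast; module
      rw [e]
      refine (norm_add_le _ _).trans ?_
      rw [norm_smul, Real.norm_of_nonneg hη]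
      have := mul_le_mul_of_nonneg_left h2 hη
      refine (add_le_add h1 this).trans (le_of_eq ?_)
      push_cast; ring
    refine ⟨hq, ?_⟩
    have hc := hclose (k + 1) hk _ hq
    rw [leapfrogHalf_succ, leapfrogHalf_succ, hr.gradient_eq]
    have hg := hr.norm_ridgeGrad_sub_le' (leapfrog (ridgePotential u a) η (k + 1) (y, p')).1
      (leapfrog (ridgePotential u a) η (k + 1) (x, p)).1
    set gy := ridgeGrad u a (leapfrog (ridgePotential u a) η (k + 1) (y, p')).1
    set gx := ridgeGrad u a (leapfrog (ridgePotential u a) η (k + 1) (x, p)).1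
    set wy := leapfrogHalf (ridgePotential u a) η k (y, p')
    set wx := leapfrogHalf (ridgePotential u a) η k (x, p)
    have e : wy - η • gy - (wx - η • gx) - (p' - p) = (wy - wx - (p' - p)) - η • (gy - gx) := by
      module
    rw [e]
    refine (norm_sub_le _ _).trans ?_
    rw [norm_smul, Real.norm_of_nonneg hη]
    have : η * ‖gy - gx‖ ≤ η * (n * ρ * (2 * S)) := by
      gcongr; exact hg.trans (by gcongr)
    refine (add_le_add h2 this).trans (le_of_eq ?_)
    push_cast; ring

/-- The position after `k` leapfrog steps, as a function of the initial momentum, is the free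
motion plus a combination of ridge directions with small coefficients. -/
lemma exists_hasFDerivAt_leapfrog {η : ℝ} (hη : 0 ≤ η) {K : ℕ}
    (hK : n * ρ * (K * η) ^ 2 ≤ 1 / 8) (x p : Euc d) (k : ℕ) (hk : k ≤ K) :
    (∃ (J : Euc d →L[ℝ] Euc d) (y : Fin n → Euc d),
      HasFDerivAt (fun p => (leapfrog (ridgePotential u a) η k (x, p)).1) J p ∧
      (∀ v, J v = (k * η) • v + ∑ i, ⟪y i, v⟫ • a i) ∧ ∀ i, ‖y i‖ ≤ k * η * (1 / 4 / n)) ∧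
    ∃ (V : Euc d →L[ℝ] Euc d) (z : Fin n → Euc d),
      HasFDerivAt (fun p => leapfrogHalf (ridgePotential u a) η k (x, p)) V p ∧
      (∀ v, V v = v + ∑ i, ⟪z i, v⟫ • a i) ∧ ∀ i, ‖z i‖ ≤ 1 / 4 / n * (k / K) := by
  have hn := hr.card_cast_pos
  have hρ := hr.pos
  induction k with
  | zero =>
    refine ⟨⟨0, 0, ?_, by simp, by simp⟩, ⟨ContinuousLinearMap.id ℝ _, 0, ?_, by simp, by simp⟩⟩
    · simpa [leapfrog] using hasFDerivAt_const x p
    · simp only [leapfrog, leapfrogHalf]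
      exact (hasFDerivAt_id p).sub_const _
  | succ k ih =>
    obtain ⟨⟨J, y, hJ, hJv, hy⟩, V, z, hV, hVv, hz⟩ := ih (by omega)
    have hK0 : (0 : ℝ) < K := by exact_mod_cast (by omega : 0 < K)
    have hkK : ((k + 1 : ℕ) : ℝ) ≤ K := by exact_mod_cast hk
    have hJ' : HasFDerivAt (fun p => (leapfrog (ridgePotential u a) η (k + 1) (x, p)).1)
        (J + η • V) p := by
      simp_rw [leapfrog_succ_fst]
      exact hJ.add (hV.const_smul η)
    have hJv' : ∀ v, (J + η • V) v
        = ((k + 1 : ℕ) * η) • v + ∑ i, ⟪y i + η • z i, v⟫ • a i := by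
      intro v
      rw [add_apply, smul_apply, hJv, hVv]
      simp_rw [inner_add_left, inner_smul_left, add_smul, Finset.sum_add_distrib, smul_add,
        Finset.smul_sum, smul_smul]
      push_cast
      simp only [conj_trivial]
      module
    have hy' : ∀ i, ‖y i + η • z i‖ ≤ (k + 1 : ℕ) * η * (1 / 4 / n) := by
      intro i
      refine (norm_add_le _ _).trans ?_
      rw [norm_smul, Real.norm_of_nonneg hη]
      have : ‖z i‖ ≤ 1 / 4 / n := (hz i).trans
        (mul_le_of_le_one_right (by positivity) ((div_le_one hK0).2 (by push_cast at hkK; linarith)))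
      calc _ ≤ k * η * (1 / 4 / n) + η * (1 / 4 / n) := by gcongr; exact hy i
        _ = _ := by push_cast; ring
    refine ⟨⟨J + η • V, fun i => y i + η • z i, hJ', hJv', hy'⟩, ?_⟩
    set q := (leapfrog (ridgePotential u a) η (k + 1) (x, p)).1 with hq
    set H : Euc d →L[ℝ] Euc d :=
      ∑ i, (deriv (deriv (u i)) ⟪a i, q⟫ • innerSL ℝ (a i)).smulRight (a i) with hH
    have hV' : HasFDerivAt (fun p => leapfrogHalf (ridgePotential u a) η (k + 1) (x, p))
        (V - η • (H.comp (J + η • V))) p := by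
      simp_rw [leapfrogHalf_succ, hr.gradient_eq]
      exact hV.sub (((hr.hasFDerivAt_ridgeGrad q).comp p hJ').const_smul η)
    refine ⟨_, fun i => z i - (η * deriv (deriv (u i)) ⟪a i, q⟫) •
      ContinuousLinearMap.adjoint (J + η • V) (a i), hV', ?_, ?_⟩
    · intro v
      rw [sub_apply, smul_apply,
        ContinuousLinearMap.comp_apply, hVv]
      simp_rw [inner_sub_left, inner_smul_left, ContinuousLinearMap.adjoint_inner_left, sub_smul,
        Finset.sum_sub_distrib]
      rw [add_sub_assoc]
      congr 2
      simp [hH, Finset.smul_sum, smul_smul, mul_assoc]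
    · intro i
      have hadj : ‖ContinuousLinearMap.adjoint (J + η • V) (a i)‖ ≤ 2 * (K * η) := by
        have hop : ‖J + η • V‖ ≤ 2 * (K * η) := by
          refine ContinuousLinearMap.opNorm_le_bound _ (by positivity) fun v => ?_
          rw [hJv']
          have h1 : ‖∑ i, ⟪y i + η • z i, v⟫ • a i‖ ≤ ∑ _i : Fin n, (K * η * (1 / 4 / n) * ‖v‖) := by
            refine norm_sum_le_of_le _ fun i _ => ?_
            rw [norm_smul, hr.norm_eq_one, mul_one]
            refine (norm_inner_le_norm _ _).trans ?_
            gcongr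
            exact (hy' i).trans (by gcongr)
          have h2 : ∑ _i : Fin n, (K * η * (1 / 4 / n) * ‖v‖) ≤ K * η * ‖v‖ := by
            rw [Finset.sum_const, Finset.card_univ, Fintype.card_fin, nsmul_eq_mul]
            have : (n : ℝ) * (K * η * (1 / 4 / n) * ‖v‖) = K * η * ‖v‖ / 4 := by field_simp
            rw [this]
            have : 0 ≤ K * η * ‖v‖ := by positivity
            linarith
          refine (norm_add_le _ _).trans ?_
          rw [norm_smul, Real.norm_of_nonneg (by positivity)]
          have h3 : (k + 1 : ℕ) * η * ‖v‖ ≤ K * η * ‖v‖ := by gcongr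
          linarith
        calc _ ≤ ‖ContinuousLinearMap.adjoint (J + η • V)‖ * ‖a i‖ :=
              ContinuousLinearMap.le_opNorm _ _
          _ ≤ _ := by
              rw [hr.norm_eq_one, mul_one, LinearIsometryEquiv.norm_map]; exact hop
      refine (norm_sub_le _ _).trans ?_
      rw [norm_smul, norm_mul, Real.norm_of_nonneg hη, Real.norm_eq_abs]
      have h1 : η * |deriv (deriv (u i)) ⟪a i, q⟫|
          * ‖ContinuousLinearMap.adjoint (J + η • V) (a i)‖ ≤ η * ρ * (2 * (K * η)) := by
        gcongr
        exact hr.abs_deriv_deriv_le i _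
      have h2 : η * ρ * (2 * (K * η)) ≤ 1 / 4 / n * (1 / K) := by
        rw [mul_one_div, div_div, le_div_iff₀ (by positivity)]
        calc η * ρ * (2 * (K * η)) * (n * K) = 2 * (n * ρ * (K * η) ^ 2) := by ring
          _ ≤ 1 / 4 := by linarith
      refine (add_le_add (hz i) (h1.trans h2)).trans (le_of_eq ?_)
      push_cast; ring

end IsRidge


/-- The Hamiltonian of position and momentum. -/
noncomputable def hamiltonian {d : ℕ} (f : Euc d → ℝ) (z : Euc d × Euc d) : ℝ :=
  f z.1 + ‖z.2‖ ^ 2 / 2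

namespace IsRidge

variable {d n : ℕ} {u : Fin n → ℝ → ℝ} {a : Fin n → Euc d} {ρ : ℝ} (hr : IsRidge u a ρ)
include hr

lemma norm_ridgeGrad_add_norm_ridgeMap_leapfrog_le {η : ℝ} (hη : 0 ≤ η) {K : ℕ}
    (hK : K * η * √(n * ρ) ≤ 1 / 4) (x p : Euc d) (k : ℕ) (hk : k < K) :
    ‖ridgeGrad u a (leapfrog (ridgePotential u a) η k (x, p)).1‖
        + √(n * ρ) * ‖ridgeMap a (leapfrogHalf (ridgePotential u a) η k (x, p))‖
      ≤ 4 * (‖ridgeGrad u a x‖ + √(n * ρ) * ‖ridgeMap a p‖) := by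
  set s := √(n * ρ) with hs
  have hs2 : s * s = n * ρ := Real.mul_self_sqrt hr.smooth_pos.le
  have hs0 : 0 ≤ s := Real.sqrt_nonneg _
  have hK1 : (1 : ℝ) ≤ K := by exact_mod_cast (by omega : 1 ≤ K)
  set h := η * s with hh
  have hh0 : 0 ≤ h := by positivity
  have hKh : K * h ≤ 1 / 4 := by rw [hh, ← mul_assoc]; exact hK
  have hh1 : h ≤ 1 / 4 := by nlinarith
  have step : ∀ k : ℕ, ‖ridgeGrad u a (leapfrog (ridgePotential u a) η k (x, p)).1‖
        + s * ‖ridgeMap a (leapfrogHalf (ridgePotential u a) η k (x, p))‖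
      ≤ (1 + 2 * h) ^ k * (2 * (‖ridgeGrad u a x‖ + s * ‖ridgeMap a p‖)) := by
    intro k
    induction k with
    | zero =>
      have e : leapfrogHalf (ridgePotential u a) η 0 (x, p) = p - (η / 2) • ridgeGrad u a x := by
        simp [leapfrogHalf, leapfrog, hr.gradient_eq]
      rw [e, map_sub, map_smul, pow_zero, one_mul]
      simp only [leapfrog]
      have h1 : ‖ridgeMap a p - (η / 2) • ridgeMap a (ridgeGrad u a x)‖
          ≤ ‖ridgeMap a p‖ + η / 2 * ‖ridgeGrad u a x‖ := by
        refine (norm_sub_le _ _).trans ?_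
        rw [norm_smul, Real.norm_of_nonneg (by positivity)]
        gcongr
        exact hr.norm_ridgeMap_le _
      have h2 := mul_le_mul_of_nonneg_left h1 hs0
      have h3 : s * (η / 2 * ‖ridgeGrad u a x‖) = h / 2 * ‖ridgeGrad u a x‖ := by rw [hh]; ring
      have h4 : h / 2 * ‖ridgeGrad u a x‖ ≤ 1 * ‖ridgeGrad u a x‖ := by gcongr; linarith
      have h5 : 0 ≤ s * ‖ridgeMap a p‖ := by positivity
      rw [mul_add, h3] at h2
      linarith
    | succ k ih =>
      rw [pow_succ, leapfrogHalf_succ, hr.gradient_eq]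
      set q := (leapfrog (ridgePotential u a) η k (x, p)).1
      set q' := (leapfrog (ridgePotential u a) η (k + 1) (x, p)).1 with hq'
      set w := leapfrogHalf (ridgePotential u a) η k (x, p)
      have eq : q' = q + η • w := leapfrog_succ_fst _ _ _ _
      set G := ‖ridgeGrad u a q‖
      set W := ‖ridgeMap a w‖
      have hG : ‖ridgeGrad u a q'‖ ≤ G + h * (s * W) := by
        have h1 := hr.norm_ridgeGrad_sub_le q' q
        rw [eq, add_sub_cancel_left, map_smul, norm_smul, Real.norm_of_nonneg hη, ← eq,
          ← hs2] at h1
        have h2 := norm_le_norm_add_norm_sub' (ridgeGrad u a q') (ridgeGrad u a q)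
        calc _ ≤ _ := h2
          _ ≤ G + s * s * (η * W) := by gcongr
          _ = _ := by rw [hh]; ring
      have hW : s * ‖ridgeMap a (w - η • ridgeGrad u a q')‖
          ≤ s * W + h * ‖ridgeGrad u a q'‖ := by
        rw [map_sub, map_smul]
        have : ‖ridgeMap a w - η • ridgeMap a (ridgeGrad u a q')‖
            ≤ W + η * ‖ridgeGrad u a q'‖ := by
          refine (norm_sub_le _ _).trans ?_
          rw [norm_smul, Real.norm_of_nonneg hη]
          gcongr
          exact hr.norm_ridgeMap_le _
        calc _ ≤ s * (W + η * ‖ridgeGrad u a q'‖) := by gcongr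
          _ = _ := by rw [hh]; ring
      have hG0 : 0 ≤ G := norm_nonneg _
      have hsW : 0 ≤ s * W := by positivity
      have h1 : (1 + h) * ‖ridgeGrad u a q'‖ ≤ (1 + h) * (G + h * (s * W)) := by gcongr
      have h2 : (1 + h) * (G + h * (s * W)) + s * W ≤ (1 + 2 * h) * (G + s * W) := by
        nlinarith [mul_nonneg hh0 hsW, mul_nonneg hh0 hG0,
          mul_nonneg hh0 (mul_nonneg hh0 hsW), mul_nonneg (sub_nonneg.2 hh1) (mul_nonneg hh0 hsW)]
      calc _ ≤ (1 + 2 * h) * (G + s * W) := by linarith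
        _ ≤ (1 + 2 * h) * ((1 + 2 * h) ^ k * (2 * (‖ridgeGrad u a x‖ + s * ‖ridgeMap a p‖))) := by
            gcongr
        _ = _ := by ring
  refine (step k).trans ?_
  have h1 : (1 + 2 * h) ^ k ≤ 2 := by
    calc (1 + 2 * h) ^ k ≤ Real.exp (2 * h) ^ k := by
          gcongr; linarith [Real.add_one_le_exp (2 * h)]
      _ = Real.exp (k * (2 * h)) := by rw [← Real.exp_nat_mul]
      _ ≤ Real.exp (1 / 2) := by
          gcongr
          have : (k : ℝ) ≤ K := by exact_mod_cast hk.le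
          nlinarith
      _ ≤ 2 := by
          have h : Real.exp (1 / 2) ^ 2 = Real.exp 1 := by rw [← Real.exp_nat_mul]; norm_num
          have := Real.exp_one_lt_d9
          nlinarith [Real.exp_pos (1 / 2)]
  calc _ ≤ 2 * (2 * (‖ridgeGrad u a x‖ + s * ‖ridgeMap a p‖)) := by gcongr
    _ = _ := by ring

lemma abs_hamiltonian_leapfrog_succ_sub_le {η : ℝ} (hη : 0 ≤ η)
    (z : Euc d × Euc d) (k : ℕ) {B : ℝ}
    (h1 : ‖ridgeGrad u a (leapfrog (ridgePotential u a) η k z).1‖ ≤ B)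
    (h2 : ‖ridgeGrad u a (leapfrog (ridgePotential u a) η (k + 1) z).1‖ ≤ B)
    (h3 : √(n * ρ) * ‖ridgeMap a (leapfrogHalf (ridgePotential u a) η k z)‖ ≤ B) :
    |hamiltonian (ridgePotential u a) (leapfrog (ridgePotential u a) η (k + 1) z)
        - hamiltonian (ridgePotential u a) (leapfrog (ridgePotential u a) η k z)|
      ≤ 2 * (η * B) ^ 2 := by
  have hL := hr.smooth_pos
  have hs2 : √(n * ρ) ^ 2 = n * ρ := Real.sq_sqrt hr.smooth_pos.le
  rw [hamiltonian, hamiltonian, leapfrog_succ_snd, leapfrog_snd, hr.gradient_eq]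
  set q := (leapfrog (ridgePotential u a) η k z).1
  set q' := (leapfrog (ridgePotential u a) η (k + 1) z).1 with hq'
  set w := leapfrogHalf (ridgePotential u a) η k z
  have eq : q' = q + η • w := leapfrog_succ_fst _ _ _ _
  set g := ridgeGrad u a q
  set g' := ridgeGrad u a q'
  have hT := hr.abs_ridgePotential_add_sub_le q (η • w)
  have hI := hr.abs_inner_ridgeGrad_sub_le q' q (η • w)
  have hd : q' - q = η • w := by rw [eq]; abel
  rw [hd] at hI
  rw [← eq] at hT
  have hB : n * ρ * ‖ridgeMap a (η • w)‖ ^ 2 ≤ (η * B) ^ 2 := by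
    rw [map_smul, norm_smul, Real.norm_of_nonneg hη, ← hs2]
    calc _ = (η * (√(n * ρ) * ‖ridgeMap a w‖)) ^ 2 := by ring
      _ ≤ _ := by gcongr
  have e : ridgePotential u a q' + ‖w - (η / 2) • g'‖ ^ 2 / 2
      - (ridgePotential u a q + ‖w + (η / 2) • g‖ ^ 2 / 2)
      = (ridgePotential u a q' - ridgePotential u a q - ⟪η • w, g⟫)
        - (1 / 2) * ⟪η • w, g' - g⟫ + η ^ 2 / 8 * (‖g'‖ ^ 2 - ‖g‖ ^ 2) := by
    rw [norm_sub_sq_real, norm_add_sq_real]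
    simp only [inner_smul_left, inner_smul_right, norm_smul, inner_sub_right, conj_trivial,
      Real.norm_of_nonneg (by positivity : 0 ≤ η / 2)]
    ring
  rw [e]
  have hg : |η ^ 2 / 8 * (‖g'‖ ^ 2 - ‖g‖ ^ 2)| ≤ (η * B) ^ 2 := by
    have hB0 : 0 ≤ B := (norm_nonneg _).trans h1
    rw [abs_mul, abs_of_nonneg (by positivity), mul_pow]
    have : |‖g'‖ ^ 2 - ‖g‖ ^ 2| ≤ B ^ 2 := by
      have := pow_le_pow_left₀ (norm_nonneg _) h1 2
      have := pow_le_pow_left₀ (norm_nonneg _) h2 2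
      rw [abs_le]; constructor <;> nlinarith [sq_nonneg ‖g'‖, sq_nonneg ‖g‖]
    have h8 : η ^ 2 / 8 ≤ η ^ 2 := by nlinarith [sq_nonneg η]
    exact mul_le_mul h8 this (abs_nonneg _) (sq_nonneg _)
  have h4 : n * ρ * (‖ridgeMap a (η • w)‖ * ‖ridgeMap a (η • w)‖)
      = n * ρ * ‖ridgeMap a (η • w)‖ ^ 2 := by ring
  have h5 : n * ρ / 2 * ‖ridgeMap a (η • w)‖ ^ 2
      = n * ρ * ‖ridgeMap a (η • w)‖ ^ 2 / 2 := by ring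
  rw [h4] at hI
  rw [h5] at hT
  rw [abs_le] at *
  constructor <;> linarith [hT.1, hT.2, hI.1, hI.2, hg.1, hg.2]

/-- Energy error of `K` leapfrog steps. -/
lemma abs_hamiltonian_leapfrog_sub_le {η : ℝ} (hη : 0 ≤ η) {K : ℕ}
    (hK : (K + 1) * η * √(n * ρ) ≤ 1 / 4) (x p : Euc d) :
    |hamiltonian (ridgePotential u a) (leapfrog (ridgePotential u a) η K (x, p))
        - hamiltonian (ridgePotential u a) (x, p)|
      ≤ 64 * K * η ^ 2 * (‖ridgeGrad u a x‖ ^ 2 + n * ρ * ‖ridgeMap a p‖ ^ 2) := by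
  have hs2 : √(n * ρ) ^ 2 = n * ρ := Real.sq_sqrt hr.smooth_pos.le
  set s := √(n * ρ) with hs
  have hs0 : 0 ≤ s := Real.sqrt_nonneg _
  set N := ‖ridgeGrad u a x‖ + s * ‖ridgeMap a p‖ with hN
  have hb : ∀ k ≤ K, ‖ridgeGrad u a (leapfrog (ridgePotential u a) η k (x, p)).1‖ ≤ 4 * N ∧
      s * ‖ridgeMap a (leapfrogHalf (ridgePotential u a) η k (x, p))‖ ≤ 4 * N := by
    intro k hk
    have := hr.norm_ridgeGrad_add_norm_ridgeMap_leapfrog_le hη (K := K + 1)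
      (by push_cast; exact hK) x p k (by omega)
    have h1 := norm_nonneg (ridgeGrad u a (leapfrog (ridgePotential u a) η k (x, p)).1)
    have h2 := mul_nonneg hs0
      (norm_nonneg (ridgeMap a (leapfrogHalf (ridgePotential u a) η k (x, p))))
    constructor <;> linarith
  have hsum : ∀ k ≤ K,
      |hamiltonian (ridgePotential u a) (leapfrog (ridgePotential u a) η k (x, p))
        - hamiltonian (ridgePotential u a) (x, p)| ≤ k * (2 * (η * (4 * N)) ^ 2) := by
    intro k
    induction k with
    | zero => intro _; simp [leapfrog]
    | succ k ih =>
      intro hk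
      have h1 := ih (by omega)
      have h2 := hr.abs_hamiltonian_leapfrog_succ_sub_le hη (x, p) k (hb k (by omega)).1
        (hb (k + 1) hk).1 (hb k (by omega)).2
      have h3 := abs_add_le
        (hamiltonian (ridgePotential u a) (leapfrog (ridgePotential u a) η (k + 1) (x, p))
          - hamiltonian (ridgePotential u a) (leapfrog (ridgePotential u a) η k (x, p)))
        (hamiltonian (ridgePotential u a) (leapfrog (ridgePotential u a) η k (x, p))
          - hamiltonian (ridgePotential u a) (x, p))
      rw [sub_add_sub_cancel] at h3
      push_cast
      linarith
  refine (hsum K le_rfl).trans ?_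
  have hN2 : N ^ 2 ≤ 2 * (‖ridgeGrad u a x‖ ^ 2 + n * ρ * ‖ridgeMap a p‖ ^ 2) := by
    rw [← hs2, hN]
    nlinarith [sq_nonneg (‖ridgeGrad u a x‖ - s * ‖ridgeMap a p‖)]
  calc (K : ℝ) * (2 * (η * (4 * N)) ^ 2) = 32 * K * η ^ 2 * N ^ 2 := by ring
    _ ≤ 32 * K * η ^ 2 * (2 * (‖ridgeGrad u a x‖ ^ 2 + n * ρ * ‖ridgeMap a p‖ ^ 2)) := by gcongr
    _ = _ := by ring

end IsRidge


/-- A finite product of measures with integrable densities has the product density. -/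
lemma pi_withDensity_ofReal {ι : Type*} [Fintype ι] {X : ι → Type*} [∀ i, MeasurableSpace (X i)]
    (μ : ∀ i, Measure (X i)) [∀ i, SigmaFinite (μ i)] (f : ∀ i, X i → ℝ)
    (hf0 : ∀ i x, 0 ≤ f i x) (hfi : ∀ i, Integrable (f i) (μ i)) :
    Measure.pi (fun i => (μ i).withDensity fun x => ENNReal.ofReal (f i x))
      = (Measure.pi μ).withDensity fun x => ENNReal.ofReal (∏ i, f i (x i)) := by
  have (i : ι) : IsFiniteMeasure ((μ i).withDensity fun x => ENNReal.ofReal (f i x)) :=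
    isFiniteMeasure_withDensity_ofReal (hfi i).2
  refine Measure.pi_eq fun s hs => ?_
  rw [withDensity_apply _ (MeasurableSet.univ_pi hs),
    ← lintegral_indicator (MeasurableSet.univ_pi hs)]
  have h1 : ∀ x : ∀ i, X i, (Set.univ.pi s).indicator
      (fun x => ENNReal.ofReal (∏ i, f i (x i))) x
      = ENNReal.ofReal (∏ i, (s i).indicator (f i) (x i)) := by
    intro x
    by_cases hx : x ∈ Set.univ.pi s
    · rw [Set.indicator_of_mem hx]
      congr 1
      exact Finset.prod_congr rfl fun i _ =>
        (Set.indicator_of_mem (hx i (Set.mem_univ i)) _).symm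
    · rw [Set.indicator_of_notMem hx]
      simp only [Set.mem_pi, Set.mem_univ, true_imp_iff, not_forall] at hx
      obtain ⟨i, hi⟩ := hx
      rw [Finset.prod_eq_zero (Finset.mem_univ i) (Set.indicator_of_notMem hi _),
        ENNReal.ofReal_zero]
  have hI : ∀ i, Integrable ((s i).indicator (f i)) (μ i) := fun i => (hfi i).indicator (hs i)
  have h0 : ∀ i x, 0 ≤ (s i).indicator (f i) x := fun i x =>
    Set.indicator_nonneg (fun y _ => hf0 i y) x
  simp_rw [h1]
  rw [← ofReal_integral_eq_lintegral_ofReal (Integrable.fintype_prod_dep hI)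
    (.of_forall fun x => Finset.prod_nonneg fun i _ => h0 i _),
    integral_fintype_prod_eq_prod,
    ENNReal.ofReal_prod_of_nonneg fun i _ => integral_nonneg (h0 i)]
  refine Finset.prod_congr rfl fun i _ => ?_
  rw [ofReal_integral_eq_lintegral_ofReal (hI i) (.of_forall (h0 i)),
    withDensity_apply _ (hs i), ← lintegral_indicator (hs i)]
  refine lintegral_congr fun x => ?_
  by_cases hx : x ∈ s i <;> simp [hx]

lemma stdGaussian_eq (d : ℕ) : stdGaussian d = ProbabilityTheory.stdGaussian (Euc d) :=
  ProbabilityTheory.map_pi_eq_stdGaussian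

instance (d : ℕ) : IsProbabilityMeasure (stdGaussian d) := by
  rw [stdGaussian_eq]; infer_instance

/-- The standard Gaussian measure has density proportional to `exp (-‖p‖² / 2)`. -/
lemma exists_stdGaussian_eq_withDensity (d : ℕ) : ∃ c : ℝ, 0 < c ∧
    stdGaussian d = volume.withDensity fun p : Euc d => ENNReal.ofReal (c * exp (-‖p‖ ^ 2 / 2)) := by
  refine ⟨(√(2 * π))⁻¹ ^ d, by positivity, ?_⟩
  have h1 : ∀ x : ℝ, ProbabilityTheory.gaussianPDFReal 0 1 x = (√(2 * π))⁻¹ * exp (-x ^ 2 / 2) := by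
    intro x; simp [ProbabilityTheory.gaussianPDFReal]
  have h2 : (Measure.pi fun _ : Fin d => ProbabilityTheory.gaussianReal 0 1)
      = (volume : Measure (Fin d → ℝ)).withDensity fun x =>
        ENNReal.ofReal (∏ i, ProbabilityTheory.gaussianPDFReal 0 1 (x i)) := by
    rw [volume_pi, ← pi_withDensity_ofReal _ (fun _ => ProbabilityTheory.gaussianPDFReal 0 1)
      (fun _ => ProbabilityTheory.gaussianPDFReal_nonneg 0 1)
      (fun _ => ProbabilityTheory.integrable_gaussianPDFReal 0 1)]
    congr 1
    funext i
    rw [ProbabilityTheory.gaussianReal_of_var_ne_zero _ one_ne_zero]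
    rfl
  have h3 : stdGaussian d = (Measure.pi fun _ : Fin d => ProbabilityTheory.gaussianReal 0 1).map
      (MeasurableEquiv.toLp 2 (Fin d → ℝ)) := rfl
  rw [h3, h2]
  ext s hs
  have hmeas : MeasurableSet (MeasurableEquiv.toLp 2 (Fin d → ℝ) ⁻¹' s) :=
    (MeasurableEquiv.toLp 2 (Fin d → ℝ)).measurable hs
  rw [Measure.map_apply (MeasurableEquiv.measurable _) hs, withDensity_apply _ hmeas,
    withDensity_apply _ hs,
    ← (PiLp.volume_preserving_toLp (Fin d)).setLIntegral_comp_preimage hs (by fun_prop)]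
  refine lintegral_congr fun x => ?_
  congr 1
  simp_rw [h1]
  rw [Finset.prod_mul_distrib, Finset.prod_const, Finset.card_univ, Fintype.card_fin,
    ← Real.exp_sum, EuclideanSpace.norm_sq_eq]
  congr 2
  simp [neg_div, Finset.sum_div]

lemma integrable_inner_sq_stdGaussian {d : ℕ} (v : Euc d) :
    Integrable (fun p => ⟪v, p⟫ ^ 2) (stdGaussian d) := by
  rw [stdGaussian_eq]
  have := (ProbabilityTheory.IsGaussian.memLp_dual (ProbabilityTheory.stdGaussian (Euc d))
    (innerSL ℝ v) 2 (by norm_num)).integrable_sq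
  simpa using this

lemma integral_inner_sq_stdGaussian {d : ℕ} (v : Euc d) :
    ∫ p, ⟪v, p⟫ ^ 2 ∂(stdGaussian d) = ‖v‖ ^ 2 := by
  rw [stdGaussian_eq]
  have h1 := ProbabilityTheory.variance_dual_stdGaussian (E := Euc d) (innerSL ℝ v)
  rw [ProbabilityTheory.variance_of_integral_eq_zero (by fun_prop)
    (ProbabilityTheory.integral_strongDual_stdGaussian _), innerSL_apply_norm] at h1
  simpa using h1

lemma measureReal_lt_abs_inner_stdGaussian_le {d : ℕ} (v : Euc d) :
    (stdGaussian d).real {p | 4 * ‖v‖ < |⟪v, p⟫|} ≤ 1 / 16 := by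
  rcases eq_or_ne v 0 with rfl | hv
  · simp
  have hv' : 0 < ‖v‖ := norm_pos_iff.2 hv
  have h1 := mul_meas_ge_le_integral_of_nonneg (μ := stdGaussian d)
    (.of_forall fun p => sq_nonneg ⟪v, p⟫) (integrable_inner_sq_stdGaussian v) (16 * ‖v‖ ^ 2)
  rw [integral_inner_sq_stdGaussian] at h1
  have h2 : (stdGaussian d).real {p | 4 * ‖v‖ < |⟪v, p⟫|}
      ≤ (stdGaussian d).real {p | 16 * ‖v‖ ^ 2 ≤ ⟪v, p⟫ ^ 2} := by
    refine measureReal_mono fun p hp => ?_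
    simp only [Set.mem_ofPred_eq] at hp ⊢
    rw [← sq_abs ⟪v, p⟫]
    nlinarith
  refine h2.trans ?_
  have h3 : 0 < 16 * ‖v‖ ^ 2 := by positivity
  refine le_of_mul_le_mul_left ?_ h3
  linarith

lemma IsRidge.measureReal_lt_norm_ridgeMap_stdGaussian_le {d n : ℕ} {u : Fin n → ℝ → ℝ}
    {a : Fin n → Euc d} {ρ : ℝ} (hr : IsRidge u a ρ) :
    (stdGaussian d).real {p | 10 < ‖ridgeMap a p‖ ^ 2} ≤ 1 / 10 := by
  have hn := hr.card_cast_pos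
  have hI : Integrable (fun p => ‖ridgeMap a p‖ ^ 2) (stdGaussian d) := by
    simp_rw [norm_ridgeMap_sq]
    exact (integrable_finsetSum _ fun i _ => integrable_inner_sq_stdGaussian (a i)).div_const _
  have hE : ∫ p, ‖ridgeMap a p‖ ^ 2 ∂(stdGaussian d) = 1 := by
    simp_rw [norm_ridgeMap_sq]
    rw [integral_div, integral_finsetSum _ fun i _ => integrable_inner_sq_stdGaussian (a i)]
    simp_rw [integral_inner_sq_stdGaussian, hr.norm_eq_one]
    simp [hn.ne']
  have h1 := mul_meas_ge_le_integral_of_nonneg (μ := stdGaussian d)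
    (.of_forall fun p => sq_nonneg ‖ridgeMap a p‖) hI 10
  rw [hE] at h1
  have h2 : (stdGaussian d).real {p | 10 < ‖ridgeMap a p‖ ^ 2}
      ≤ (stdGaussian d).real {p | 10 ≤ ‖ridgeMap a p‖ ^ 2} :=
    measureReal_mono fun p hp => by
      simp only [Set.mem_ofPred_eq] at hp ⊢
      exact hp.le
  linarith


namespace IsRidge

variable {d n : ℕ} {u : Fin n → ℝ → ℝ} {a : Fin n → Euc d} {ρ : ℝ} (hr : IsRidge u a ρ)
include hr

lemma continuous_leapfrog (η : ℝ) (k : ℕ) :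
    Continuous (leapfrog (ridgePotential u a) η k) := by
  induction k with
  | zero => exact continuous_id
  | succ k ih =>
    have hg := hr.continuous_ridgeGrad
    simp only [leapfrog, hr.gradient_eq]
    fun_prop

/-- Inner-product version of `norm_leapfrog_sub_le`, with the ridge seminorm of the test vector. -/
lemma abs_inner_leapfrog_sub_le {η : ℝ} (hη : 0 ≤ η) {K : ℕ} (hK : n * ρ * (K * η) ^ 2 ≤ 1)
    (x y p p' v : Euc d) (k : ℕ) (hk : k ≤ K) :
    |⟪v, (leapfrog (ridgePotential u a) η k (y, p')).1
        - (leapfrog (ridgePotential u a) η k (x, p)).1 - (y - x) - (k * η) • (p' - p)⟫|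
      ≤ n * ρ * (k * η) ^ 2 * (‖y - x‖ + K * η * ‖p' - p‖) * ‖ridgeMap a v‖ ∧
    |⟪v, leapfrogHalf (ridgePotential u a) η k (y, p')
        - leapfrogHalf (ridgePotential u a) η k (x, p) - (p' - p)⟫|
      ≤ (2 * k + 1) * (η * (n * ρ)) * (‖y - x‖ + K * η * ‖p' - p‖) * ‖ridgeMap a v‖ := by
  have hL := hr.smooth_pos
  have hclose : ∀ k ≤ K, ‖(leapfrog (ridgePotential u a) η k (y, p')).1
      - (leapfrog (ridgePotential u a) η k (x, p)).1‖ ≤ 2 * (‖y - x‖ + K * η * ‖p' - p‖) := by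
    intro k hk
    have hkK : (k : ℝ) ≤ K := by exact_mod_cast hk
    have hv := (hr.norm_leapfrog_sub_le hη hK x y p p' k hk).1
    set w := (leapfrog (ridgePotential u a) η k (y, p')).1
      - (leapfrog (ridgePotential u a) η k (x, p)).1
    set S := ‖y - x‖ + K * η * ‖p' - p‖ with hS
    have h1 : n * ρ * (k * η) ^ 2 * S ≤ 1 * S := by
      refine mul_le_mul_of_nonneg_right (le_trans ?_ hK) (by positivity)
      gcongr
    have h2 : w = (w - (y - x) - (k * η) • (p' - p)) + ((y - x) + (k * η) • (p' - p)) := by abel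
    have h3 : ‖(y - x) + (k * η) • (p' - p)‖ ≤ S := by
      refine (norm_add_le _ _).trans ?_
      rw [norm_smul, Real.norm_of_nonneg (by positivity), hS]
      gcongr
    rw [h2]
    refine (norm_add_le _ _).trans ?_
    linarith
  set S := ‖y - x‖ + K * η * ‖p' - p‖ with hS
  have hS0 : 0 ≤ S := by positivity
  have hg : ∀ k ≤ K, |⟪v, ridgeGrad u a (leapfrog (ridgePotential u a) η k (y, p')).1
      - ridgeGrad u a (leapfrog (ridgePotential u a) η k (x, p)).1⟫|
      ≤ n * ρ * (2 * S * ‖ridgeMap a v‖) := fun k hk =>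
    (hr.abs_inner_ridgeGrad_sub_le _ _ v).trans
      (by gcongr; exact (hr.norm_ridgeMap_le _).trans (hclose k hk))
  induction k with
  | zero =>
    refine ⟨by simp [leapfrog], ?_⟩
    have e : leapfrogHalf (ridgePotential u a) η 0 (y, p')
        - leapfrogHalf (ridgePotential u a) η 0 (x, p) - (p' - p)
        = -(η / 2) • (ridgeGrad u a y - ridgeGrad u a x) := by
      simp only [leapfrogHalf, leapfrog, hr.gradient_eq]; module
    rw [e, inner_smul_right, abs_mul, abs_neg, abs_of_nonneg (by positivity)]
    have := hg 0 (by omega)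
    simp only [leapfrog] at this
    calc _ ≤ η / 2 * (n * ρ * (2 * S * ‖ridgeMap a v‖)) := by gcongr
      _ = _ := by push_cast; ring
  | succ k ih =>
    obtain ⟨h1, h2⟩ := ih (by omega)
    constructor
    · rw [leapfrog_succ_fst, leapfrog_succ_fst]
      set qy := (leapfrog (ridgePotential u a) η k (y, p')).1
      set qx := (leapfrog (ridgePotential u a) η k (x, p)).1
      set wy := leapfrogHalf (ridgePotential u a) η k (y, p')
      set wx := leapfrogHalf (ridgePotential u a) η k (x, p)
      have e : qy + η • wy - (qx + η • wx) - (y - x) - ((k + 1 : ℕ) * η) • (p' - p)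
          = (qy - qx - (y - x) - (k * η) • (p' - p)) + η • (wy - wx - (p' - p)) := by
        push_cast; module
      rw [e, inner_add_right, inner_smul_right]
      refine (abs_add_le _ _).trans ?_
      rw [abs_mul, abs_of_nonneg hη]
      have := mul_le_mul_of_nonneg_left h2 hη
      refine (add_le_add h1 this).trans (le_of_eq ?_)
      push_cast; ring
    · rw [leapfrogHalf_succ, leapfrogHalf_succ, hr.gradient_eq]
      have hg' := hg (k + 1) hk
      set gy := ridgeGrad u a (leapfrog (ridgePotential u a) η (k + 1) (y, p')).1
      set gx := ridgeGrad u a (leapfrog (ridgePotential u a) η (k + 1) (x, p)).1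
      set wy := leapfrogHalf (ridgePotential u a) η k (y, p')
      set wx := leapfrogHalf (ridgePotential u a) η k (x, p)
      have e : wy - η • gy - (wx - η • gx) - (p' - p)
          = (wy - wx - (p' - p)) - η • (gy - gx) := by module
      rw [e, inner_sub_right, inner_smul_right]
      refine (abs_sub _ _).trans ?_
      rw [abs_mul, abs_of_nonneg hη]
      have := mul_le_mul_of_nonneg_left hg' hη
      refine (add_le_add h2 this).trans (le_of_eq ?_)
      push_cast; ring

lemma bijective_leapfrog_fst {η : ℝ} (hη : 0 < η) {K : ℕ} (hK0 : 0 < K)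
    (hK : n * ρ * (K * η) ^ 2 ≤ 1 / 64) (x : Euc d) :
    Function.Bijective fun p => (leapfrog (ridgePotential u a) η K (x, p)).1 := by
  have hK0' : (0 : ℝ) < K := by exact_mod_cast hK0
  refine bijective_of_norm_sub_sub_smul_le (τ := K * η) (by positivity) fun p' p => ?_
  have h := (hr.norm_leapfrog_sub_le hη.le (hK.trans (by norm_num)) x x p p' K le_rfl).1
  rw [sub_self, sub_zero, norm_zero, zero_add] at h
  refine h.trans ?_
  calc n * ρ * (K * η) ^ 2 * (K * η * ‖p' - p‖) ≤ 1 / 4 * (K * η * ‖p' - p‖) := by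
        gcongr; linarith
    _ = _ := by ring

lemma exists_hasFDerivAt_leapfrog_det {η : ℝ} (hη : 0 < η) {K : ℕ} (hK0 : 0 < K)
    (hK : n * ρ * (K * η) ^ 2 ≤ 1 / 64) (x p : Euc d) :
    ∃ J : Euc d →L[ℝ] Euc d,
      HasFDerivAt (fun p => (leapfrog (ridgePotential u a) η K (x, p)).1) J p ∧
      (K * η) ^ d / 2 ≤ |J.det| ∧ |J.det| ≤ 2 * (K * η) ^ d := by
  have hK0' : (0 : ℝ) < K := by exact_mod_cast hK0
  obtain ⟨J, y, hJ, hJv, hy⟩ :=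
    (hr.exists_hasFDerivAt_leapfrog hη.le (hK.trans (by norm_num)) x p K le_rfl).1
  have hτ : 0 < K * η := by positivity
  refine ⟨J, hJ, ?_⟩
  obtain ⟨h1, h2⟩ := det_mem_Icc_of_forall_apply_eq a (fun i => (K * η)⁻¹ • y i)
    hr.norm_eq_one (fun i => by
      rw [norm_smul, Real.norm_of_nonneg (by positivity), inv_mul_le_iff₀ hτ]; exact hy i)
    ((K * η)⁻¹ • (J : Euc d →ₗ[ℝ] Euc d)) (fun v => by
      simp only [LinearMap.smul_apply, ContinuousLinearMap.coe_coe, hJv, smul_add, smul_smul,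
        inner_smul_left, Finset.smul_sum, conj_trivial]
      rw [inv_mul_cancel₀ hτ.ne', one_smul])
  rw [LinearMap.det_smul, finrank_euclideanSpace_fin, inv_pow] at h1 h2
  have hτd : 0 < (K * η) ^ d := by positivity
  change (K * η) ^ d / 2 ≤ |LinearMap.det (J : Euc d →ₗ[ℝ] Euc d)| ∧
    |LinearMap.det (J : Euc d →ₗ[ℝ] Euc d)| ≤ _
  set D := LinearMap.det (J : Euc d →ₗ[ℝ] Euc d)
  rw [le_inv_mul_iff₀ hτd] at h1
  rw [inv_mul_le_iff₀ hτd] at h2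
  have hD : 0 ≤ D := le_trans (by positivity) h1
  rw [abs_of_nonneg hD]
  constructor <;> linarith

/-- Two momenta that send nearby positions to the same proposal are close. -/
lemma momentum_comparison {η : ℝ} (hη : 0 < η) {K : ℕ} (hK0 : 0 < K)
    (hK : n * ρ * (K * η) ^ 2 ≤ 1 / 64) {x y p p' : Euc d} (hxy : ‖x - y‖ ≤ K * η)
    (hT : (leapfrog (ridgePotential u a) η K (x, p')).1
      = (leapfrog (ridgePotential u a) η K (y, p)).1)
    (hp : ‖ridgeMap a p‖ ^ 2 ≤ 10) (hpxy : |⟪x - y, p⟫| ≤ 4 * ‖x - y‖) :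
    ‖p'‖ ^ 2 ≤ ‖p‖ ^ 2 + 14 ∧ ‖ridgeMap a p'‖ ≤ 6 := by
  have hK0' : (0 : ℝ) < K := by exact_mod_cast hK0
  have hτ : 0 < K * η := by positivity
  have hK1 := hK.trans (by norm_num : (1 : ℝ) / 64 ≤ 1)
  have h1 := (hr.norm_leapfrog_sub_le hη.le hK1 y x p p' K le_rfl).1
  have h2 := (hr.abs_inner_leapfrog_sub_le hη.le hK1 y x p p' p K le_rfl).1
  rw [hT, sub_self, zero_sub] at h1 h2
  set τ := K * η with hτdef
  have hL := hr.smooth_pos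
  have h3 : τ * ‖p' - p‖ ≤ ‖-(x - y) - τ • (p' - p)‖ + ‖x - y‖ := by
    have e : τ • (p' - p) = -(-(x - y) - τ • (p' - p)) - (x - y) := by abel
    calc τ * ‖p' - p‖ = ‖τ • (p' - p)‖ := by rw [norm_smul, Real.norm_of_nonneg hτ.le]
      _ ≤ _ := by
        conv_lhs => rw [e]
        refine (norm_sub_le _ _).trans ?_
        rw [norm_neg]
  have h4 : n * ρ * τ ^ 2 * (‖x - y‖ + τ * ‖p' - p‖) ≤ 1 / 64 * (‖x - y‖ + τ * ‖p' - p‖) := by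
    gcongr
  have h5 : ‖p' - p‖ ≤ 2 := by
    refine le_of_mul_le_mul_left ?_ hτ
    linarith
  have hpA : ‖ridgeMap a p‖ ≤ 4 := by nlinarith [norm_nonneg (ridgeMap a p)]
  have h6 : |⟪p, p' - p⟫| ≤ 5 := by
    refine le_of_mul_le_mul_left ?_ hτ
    have h7 : n * ρ * τ ^ 2 * (‖x - y‖ + τ * ‖p' - p‖) * ‖ridgeMap a p‖ ≤ 1 / 64 * (τ + τ * 2) * 4 := by
      gcongr
    have h8 := h2.trans h7
    rw [inner_sub_right, inner_neg_right, inner_smul_right] at h8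
    rw [real_inner_comm] at hpxy
    have h9 := abs_le.1 hpxy
    have h10 := abs_le.1 h8
    rw [← abs_of_pos hτ, ← abs_mul, abs_of_pos hτ]
    rw [abs_le]
    constructor <;> linarith [h9.1, h9.2, h10.1, h10.2]
  constructor
  · have e : ‖p'‖ ^ 2 = ‖p‖ ^ 2 + 2 * ⟪p, p' - p⟫ + ‖p' - p‖ ^ 2 := by
      rw [← norm_add_sq_real]; congr 2; abel
    rw [e]
    have := (abs_le.1 h6).2
    nlinarith [norm_nonneg (p' - p)]
  · have e : ridgeMap a p' = ridgeMap a p + ridgeMap a (p' - p) := by rw [← map_add]; congr 1; abel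
    rw [e]
    refine (norm_add_le _ _).trans ?_
    linarith [hr.norm_ridgeMap_le (p' - p)]

/-- Proposals from nearby positions overlap. -/
lemma measure_proposal_le {η : ℝ} (hη : 0 < η) {K : ℕ} (hK0 : 0 < K)
    (hK : n * ρ * (K * η) ^ 2 ≤ 1 / 64) {x y : Euc d} (hxy : ‖x - y‖ ≤ K * η)
    {B : Set (Euc d)} (hB : MeasurableSet B) :
    (stdGaussian d).real {p | (‖ridgeMap a p‖ ^ 2 ≤ 10 ∧ |⟪x - y, p⟫| ≤ 4 * ‖x - y‖) ∧
        (leapfrog (ridgePotential u a) η K (y, p)).1 ∈ B}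
      ≤ 4 * exp 7 * (stdGaussian d).real {p | ‖ridgeMap a p‖ ≤ 6 ∧
        (leapfrog (ridgePotential u a) η K (x, p)).1 ∈ B} := by
  have hK0' : (0 : ℝ) < K := by exact_mod_cast hK0
  have hτd : 0 < (K * η) ^ d := by positivity
  set T : Euc d → Euc d → Euc d := fun x p => (leapfrog (ridgePotential u a) η K (x, p)).1 with hT
  have hTc : ∀ x, Continuous (T x) := fun x =>
    continuous_fst.comp ((hr.continuous_leapfrog η K).comp (by fun_prop))
  have hAc : Continuous (ridgeMap a) := LinearMap.continuous_of_finiteDimensional _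
  have hbij : ∀ x, Function.Bijective (T x) := hr.bijective_leapfrog_fst hη hK0 hK
  have hJ := fun x p => hr.exists_hasFDerivAt_leapfrog_det hη hK0 hK x p
  choose J hJ1 hJ2 using hJ
  obtain ⟨c, hc, hN⟩ := exists_stdGaussian_eq_withDensity d
  set G : Set (Euc d) := {p | (‖ridgeMap a p‖ ^ 2 ≤ 10 ∧ |⟪x - y, p⟫| ≤ 4 * ‖x - y‖) ∧ T y p ∈ B}
  set F : Set (Euc d) := {p | ‖ridgeMap a p‖ ≤ 6 ∧ T x p ∈ B}
  have hGm : MeasurableSet G :=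
    ((isClosed_le (f := fun p => ‖ridgeMap a p‖ ^ 2) (g := fun _ => (10 : ℝ))
        (by fun_prop) (by fun_prop)).measurableSet.inter
      (isClosed_le (f := fun p => |⟪x - y, p⟫|) (g := fun _ => 4 * ‖x - y‖)
        (by fun_prop) (by fun_prop)).measurableSet).inter ((hTc y).measurable hB)
  have hFm : MeasurableSet F :=
    (isClosed_le (f := fun p => ‖ridgeMap a p‖) (g := fun _ => (6 : ℝ))
      (by fun_prop) (by fun_prop)).measurableSet.inter ((hTc x).measurable hB)
  set w : Euc d → ℝ≥0∞ := fun p => ENNReal.ofReal (c * exp (-‖p‖ ^ 2 / 2))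
  let e := Equiv.ofBijective (T x) (hbij x)
  have hcmp : ∀ p, G.indicator w p
      ≤ ENNReal.ofReal (exp 7) * F.indicator w (e.symm (T y p)) := by
    intro p
    by_cases hp : p ∈ G
    · have hTe : T x (e.symm (T y p)) = T y p := e.apply_symm_apply _
      obtain ⟨h1, h2⟩ := hr.momentum_comparison hη hK0 hK hxy hTe hp.1.1 hp.1.2
      have hF : e.symm (T y p) ∈ F := ⟨h2, by rw [hTe]; exact hp.2⟩
      rw [Set.indicator_of_mem hp, Set.indicator_of_mem hF, ← ENNReal.ofReal_mul (exp_pos _).le]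
      refine ENNReal.ofReal_le_ofReal ?_
      calc c * exp (-‖p‖ ^ 2 / 2) ≤ c * exp (7 + -‖e.symm (T y p)‖ ^ 2 / 2) := by
            gcongr; linarith
        _ = _ := by rw [exp_add]; ring
    · rw [Set.indicator_of_notMem hp]; exact zero_le
  have h1 := (lintegral_comp_le_and_le_lintegral_comp volume (hbij y) (hJ1 y) hτd (hJ2 y)
    (fun q => F.indicator w (e.symm q))).1
  have h2 := (lintegral_comp_le_and_le_lintegral_comp volume (hbij x) (hJ1 x) hτd (hJ2 x)
    (fun q => F.indicator w (e.symm q))).2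
  have h3 : ∀ p, e.symm (T x p) = p := fun p => e.symm_apply_apply p
  simp_rw [h3] at h2
  have hmain : stdGaussian d G ≤ ENNReal.ofReal (4 * exp 7) * stdGaussian d F := by
    rw [hN, withDensity_apply _ hGm, withDensity_apply _ hFm, ← lintegral_indicator hGm,
      ← lintegral_indicator hFm]
    calc ∫⁻ p, G.indicator w p
        ≤ ∫⁻ p, ENNReal.ofReal (exp 7) * F.indicator w (e.symm (T y p)) := lintegral_mono hcmp
      _ = ENNReal.ofReal (exp 7) * ∫⁻ p, F.indicator w (e.symm (T y p)) :=
          lintegral_const_mul' _ _ ENNReal.ofReal_ne_top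
      _ ≤ ENNReal.ofReal (exp 7) * (ENNReal.ofReal (2 / (K * η) ^ d)
          * (ENNReal.ofReal (2 * (K * η) ^ d) * ∫⁻ p, F.indicator w p)) := by gcongr; exact h1.trans (by gcongr)
      _ = _ := by
          rw [← mul_assoc, ← mul_assoc, ← ENNReal.ofReal_mul (by positivity),
            ← ENNReal.ofReal_mul (by positivity)]
          congr 2
          field_simp; norm_num
  have := ENNReal.toReal_mono (ENNReal.mul_ne_top ENNReal.ofReal_ne_top (measure_ne_top _ _)) hmain
  rw [ENNReal.toReal_mul, ENNReal.toReal_ofReal (by positivity)] at this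
  exact this

/-- At most one of two nearby points on different sides of `S` has small escape probability. -/
lemma le_proposal_or_le_proposal {η : ℝ} (hη : 0 < η) {K : ℕ} (hK0 : 0 < K)
    (hK : n * ρ * (K * η) ^ 2 ≤ 1 / 64) {x y : Euc d} (hxy : ‖x - y‖ ≤ K * η)
    {S : Set (Euc d)} (hS : MeasurableSet S) :
    exp (-7) / 16 ≤ (stdGaussian d).real {p | ‖ridgeMap a p‖ ≤ 6 ∧
        (leapfrog (ridgePotential u a) η K (x, p)).1 ∈ Sᶜ} ∨
    exp (-7) / 16 ≤ (stdGaussian d).real {p | ‖ridgeMap a p‖ ≤ 6 ∧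
        (leapfrog (ridgePotential u a) η K (y, p)).1 ∈ S} := by
  by_contra! h
  obtain ⟨hx, hy⟩ := h
  have h1 := hr.measure_proposal_le hη hK0 hK hxy hS.compl
  have h2 : (stdGaussian d).real {p | (‖ridgeMap a p‖ ^ 2 ≤ 10 ∧
      |⟪x - y, p⟫| ≤ 4 * ‖x - y‖) ∧ (leapfrog (ridgePotential u a) η K (y, p)).1 ∈ S}
      ≤ (stdGaussian d).real {p | ‖ridgeMap a p‖ ≤ 6 ∧
        (leapfrog (ridgePotential u a) η K (y, p)).1 ∈ S} := by
    refine measureReal_mono fun p hp => ⟨?_, hp.2⟩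
    have := hp.1.1
    nlinarith [norm_nonneg (ridgeMap a p)]
  have h3 := hr.measureReal_lt_norm_ridgeMap_stdGaussian_le
  have h4 := measureReal_lt_abs_inner_stdGaussian_le (x - y)
  have h5 : (1 : ℝ) ≤ (stdGaussian d).real {p | 10 < ‖ridgeMap a p‖ ^ 2}
      + (stdGaussian d).real {p | 4 * ‖x - y‖ < |⟪x - y, p⟫|}
      + (stdGaussian d).real {p | (‖ridgeMap a p‖ ^ 2 ≤ 10 ∧
        |⟪x - y, p⟫| ≤ 4 * ‖x - y‖) ∧ (leapfrog (ridgePotential u a) η K (y, p)).1 ∈ Sᶜ}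
      + (stdGaussian d).real {p | (‖ridgeMap a p‖ ^ 2 ≤ 10 ∧
        |⟪x - y, p⟫| ≤ 4 * ‖x - y‖) ∧ (leapfrog (ridgePotential u a) η K (y, p)).1 ∈ S} := by
    rw [← probReal_univ (μ := stdGaussian d)]
    refine le_trans (measureReal_mono ?_) ((measureReal_union_le _ _).trans (add_le_add_left
      ((measureReal_union_le _ _).trans (add_le_add_left (measureReal_union_le _ _) _)) _))
    intro p _
    by_cases ha : 10 < ‖ridgeMap a p‖ ^ 2
    · exact .inl (.inl (.inl ha))
    by_cases hb : 4 * ‖x - y‖ < |⟪x - y, p⟫|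
    · exact .inl (.inl (.inr hb))
    by_cases hs : (leapfrog (ridgePotential u a) η K (y, p)).1 ∈ S
    · exact .inr ⟨⟨not_lt.1 ha, not_lt.1 hb⟩, hs⟩
    · exact .inl (.inr ⟨⟨not_lt.1 ha, not_lt.1 hb⟩, hs⟩)
  have h6 : 4 * exp 7 * (exp (-7) / 16) = 1 / 4 := by
    rw [Real.exp_neg]; field_simp; norm_num
  have h7 : exp (-7) / 16 ≤ 1 / 16 := by
    have : exp (-7) ≤ 1 := Real.exp_le_one_iff.2 (by norm_num)
    linarith
  have h8 := mul_lt_mul_of_pos_left hx (by positivity : 0 < 4 * exp 7)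
  linarith

end IsRidge


/-- The momentum-reversed leapfrog proposal. -/
noncomputable def leapfrogFlip {d : ℕ} (f : Euc d → ℝ) (η : ℝ) (K : ℕ) (z : Euc d × Euc d) :
    Euc d × Euc d :=
  ((leapfrog f η K z).1, -(leapfrog f η K z).2)

section Reversible

variable {d : ℕ} {f : Euc d → ℝ} {η : ℝ}

lemma leapfrog_eq_iterate (f : Euc d → ℝ) (η : ℝ) (k : ℕ) :
    leapfrog f η k = (leapfrog f η 1)^[k] := by
  induction k with
  | zero => rfl
  | succ k ih =>
    rw [Function.iterate_succ', ← ih]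
    rfl

lemma leapfrog_one_neg_leapfrog_one (f : Euc d → ℝ) (η : ℝ) (z : Euc d × Euc d) :
    leapfrog f η 1 ((leapfrog f η 1 z).1, -(leapfrog f η 1 z).2) = (z.1, -z.2) := by
  have e : (leapfrog f η 1 z).1 + η • -(leapfrog f η 1 z).2
      - (η ^ 2 / 2) • gradient f (leapfrog f η 1 z).1 = z.1 := by
    simp only [leapfrog]; module
  have h : leapfrog f η 1 ((leapfrog f η 1 z).1, -(leapfrog f η 1 z).2)
      = (z.1, -(leapfrog f η 1 z).2 - (η / 2) • gradient f (leapfrog f η 1 z).1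
          - (η / 2) • gradient f z.1) := by
    conv_lhs => rw [leapfrog]
    simp only [leapfrog] at e ⊢
    rw [e]
  rw [h]
  simp only [leapfrog, Prod.mk.injEq, true_and]
  module

lemma leapfrogFlip_leapfrogFlip (f : Euc d → ℝ) (η : ℝ) (k : ℕ) (z : Euc d × Euc d) :
    leapfrogFlip f η k (leapfrogFlip f η k z) = z := by
  have h : ∀ (k : ℕ) (z : Euc d × Euc d), leapfrog f η k (leapfrogFlip f η k z) = (z.1, -z.2) := by
    intro k
    induction k with
    | zero => intro z; rfl
    | succ k ih =>
      intro z
      have e1 : ∀ w, leapfrog f η (k + 1) w = leapfrog f η k (leapfrog f η 1 w) := by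
        intro w
        rw [leapfrog_eq_iterate f η (k + 1), Function.iterate_succ_apply, ← leapfrog_eq_iterate]
      have e2 : leapfrog f η (k + 1) z = leapfrog f η 1 (leapfrog f η k z) := rfl
      rw [e1]
      unfold leapfrogFlip
      rw [e2, leapfrog_one_neg_leapfrog_one]
      exact ih z
  unfold leapfrogFlip at h ⊢
  rw [h]
  simp

lemma measurePreserving_leapfrog (hg : Measurable (gradient f)) (η : ℝ) (k : ℕ) :
    MeasurePreserving (leapfrog f η k) (volume.prod volume) (volume.prod volume) := by
  have hA : MeasurePreserving (fun z : Euc d × Euc d => (z.1, -((η / 2) • gradient f z.1) + z.2))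
      (volume.prod volume) (volume.prod volume) := by
    refine (MeasurePreserving.id volume).skew_product
      (g := fun q p => -((η / 2) • gradient f q) + p) ?_ (.of_forall fun q => ?_)
    · simp only [Function.uncurry_def]; fun_prop
    · exact map_add_left_eq_self _ _
  have hB : MeasurePreserving (fun z : Euc d × Euc d => (z.1, η • z.1 + z.2))
      (volume.prod volume) (volume.prod volume) := by
    refine (MeasurePreserving.id volume).skew_product
      (g := fun p q => η • p + q) ?_ (.of_forall fun q => ?_)
    · simp only [Function.uncurry_def]; fun_prop
    · exact map_add_left_eq_self _ _
  have hs : MeasurePreserving (Prod.swap : Euc d × Euc d → Euc d × Euc d)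
      (volume.prod volume) (volume.prod volume) := Measure.measurePreserving_swap
  rw [leapfrog_eq_iterate]
  refine MeasurePreserving.iterate ?_ k
  have := hA.comp (hs.comp (hB.comp (hs.comp hA)))
  convert this using 1
  funext z
  simp only [leapfrog, Function.comp_apply, Prod.swap, Prod.mk.injEq]
  have e : z.1 + η • z.2 - (η ^ 2 / 2) • gradient f z.1
      = η • (-((η / 2) • gradient f z.1) + z.2) + z.1 := by module
  rw [e]
  refine ⟨rfl, ?_⟩
  module

lemma measurePreserving_leapfrogFlip (hg : Measurable (gradient f)) (η : ℝ) (k : ℕ) :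
    MeasurePreserving (leapfrogFlip f η k) (volume.prod volume) (volume.prod volume) :=
  ((MeasurePreserving.id volume).prod (Measure.measurePreserving_neg volume)).comp
    (measurePreserving_leapfrog hg η k)

lemma accProb_eq (f : Euc d → ℝ) (K : ℕ) (η : ℝ) (z : Euc d × Euc d) :
    accProb f K η z.1 z.2
      = min 1 (exp (hamiltonian f z - hamiltonian f (leapfrogFlip f η K z))) := by
  simp only [accProb, hamiltonian, leapfrogFlip, norm_neg]
  congr 2
  ring

lemma exp_neg_hamiltonian_mul_accProb (f : Euc d → ℝ) (K : ℕ) (η : ℝ) (z : Euc d × Euc d) :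
    exp (-hamiltonian f z) * accProb f K η z.1 z.2
      = min (exp (-hamiltonian f z)) (exp (-hamiltonian f (leapfrogFlip f η K z))) := by
  rw [accProb_eq, mul_min_of_nonneg _ _ (exp_pos _).le, mul_one, ← exp_add]
  congr 2
  ring

lemma accProb_nonneg (f : Euc d → ℝ) (K : ℕ) (η : ℝ) (q p : Euc d) : 0 ≤ accProb f K η q p :=
  le_min zero_le_one (exp_pos _).le

lemma accProb_le_one (f : Euc d → ℝ) (K : ℕ) (η : ℝ) (q p : Euc d) : accProb f K η q p ≤ 1 :=
  min_le_left _ _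

lemma measurable_leapfrog (hg : Measurable (gradient f)) (η : ℝ) (k : ℕ) :
    Measurable (leapfrog f η k) := (measurePreserving_leapfrog hg η k).measurable

lemma measurable_accProb (hf : Measurable f) (hg : Measurable (gradient f)) (K : ℕ) (η : ℝ) :
    Measurable fun z : Euc d × Euc d => accProb f K η z.1 z.2 := by
  have := measurable_leapfrog hg η K
  simp only [accProb]
  fun_prop

/-- The law of a stationary position-momentum pair, restricted to accepted proposals, is invariant
under the momentum-reversed leapfrog map. -/
lemma map_leapfrogFlip_withDensity_accProb (hf : Measurable f) (hg : Measurable (gradient f))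
    (hZ : IsProbabilityMeasure (targetMeasure f)) (K : ℕ) (η : ℝ) :
    (((targetMeasure f).prod (stdGaussian d)).withDensity
        fun z => ENNReal.ofReal (accProb f K η z.1 z.2)).map (leapfrogFlip f η K)
      = ((targetMeasure f).prod (stdGaussian d)).withDensity
        fun z => ENNReal.ofReal (accProb f K η z.1 z.2) := by
  obtain ⟨c, hc, hN⟩ := exists_stdGaussian_eq_withDensity d
  have hacc := measurable_accProb hf hg K η
  set Z : ℝ≥0∞ := (volume.withDensity fun x => ENNReal.ofReal (exp (-f x))) Set.univ
  have hμ : targetMeasure f = volume.withDensity fun x => Z⁻¹ * ENNReal.ofReal (exp (-f x)) := by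
    rw [targetMeasure]
    refine (withDensity_smul _ ?_).symm
    fun_prop
  have hΨ := measurePreserving_leapfrogFlip hg η K
  have hH : Measurable (hamiltonian f) := by unfold hamiltonian; fun_prop
  set D : Euc d × Euc d → ℝ≥0∞ := fun z => Z⁻¹ * ENNReal.ofReal (c *
    min (exp (-hamiltonian f z)) (exp (-hamiltonian f (leapfrogFlip f η K z)))) with hD
  have hDm : Measurable D := by
    have := hΨ.measurable
    fun_prop
  have hDinv : ∀ z, D (leapfrogFlip f η K z) = D z := by
    intro z
    simp only [hD, leapfrogFlip_leapfrogFlip]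
    rw [min_comm]
  have hprod : ((targetMeasure f).prod (stdGaussian d)).withDensity
      (fun z => ENNReal.ofReal (accProb f K η z.1 z.2))
      = (volume.prod volume).withDensity D := by
    have hSF : SFinite (targetMeasure f) := inferInstance
    have hm1 : Measurable fun x => Z⁻¹ * ENNReal.ofReal (exp (-f x)) := by fun_prop
    have hm2 : Measurable fun p : Euc d => ENNReal.ofReal (c * exp (-‖p‖ ^ 2 / 2)) := by fun_prop
    rw [hμ] at hSF ⊢
    have hSF2 : SFinite (volume.withDensity fun p : Euc d =>
      ENNReal.ofReal (c * exp (-‖p‖ ^ 2 / 2))) := hN ▸ inferInstance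
    rw [hN, prod_withDensity hm1 hm2, ← withDensity_mul _ (by fun_prop) (by fun_prop)]
    congr 1
    funext z
    simp only [Pi.mul_apply, hD]
    rw [mul_assoc, mul_assoc, ← ENNReal.ofReal_mul (by positivity),
      ← ENNReal.ofReal_mul (exp_pos _).le, ← exp_neg_hamiltonian_mul_accProb]
    congr 2
    simp only [hamiltonian]
    rw [neg_add, exp_add]
    ring_nf
  rw [hprod]
  ext s hs
  rw [Measure.map_apply hΨ.measurable hs, withDensity_apply _ (hΨ.measurable hs),
    withDensity_apply _ hs]
  conv_rhs => rw [← hΨ.map_eq, setLIntegral_map hs hDm hΨ.measurable]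
  simp_rw [hDinv]

end Reversible


section AcceptReject

variable {X P : Type*} [MeasurableSpace X] [MeasurableSpace P]

/-- The law of the accepted moves of an accept-reject chain with proposal map `T`, acceptance
probability `α`, position law `μ` and momentum law `N`. -/
noncomputable def acceptedFlow (μ : Measure X) (N : Measure P) (T : X × P → X) (α : X × P → ℝ) :
    Measure (X × X) :=
  ((μ.prod N).withDensity fun z => ENNReal.ofReal (α z)).map fun z => (z.1, T z)

variable {μ : Measure X} {N : Measure P} [IsProbabilityMeasure μ] [IsProbabilityMeasure N]
  {T : X × P → X} {α : X × P → ℝ}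

omit [IsProbabilityMeasure μ] [IsProbabilityMeasure N] in
lemma withDensity_ofReal_le_of_le_one (hα1 : ∀ z, α z ≤ 1) :
    (μ.prod N).withDensity (fun z => ENNReal.ofReal (α z)) ≤ μ.prod N := by
  calc _ ≤ (μ.prod N).withDensity 1 := withDensity_mono (.of_forall fun z => by
        simpa using hα1 z)
    _ = _ := withDensity_one

lemma map_fst_acceptedFlow_le (hT : Measurable T) (hα1 : ∀ z, α z ≤ 1) :
    (acceptedFlow μ N T α).map Prod.fst ≤ μ := by
  rw [acceptedFlow, Measure.map_map measurable_fst (by fun_prop)]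
  refine (Measure.map_mono (withDensity_ofReal_le_of_le_one hα1) (by fun_prop)).trans ?_
  have : (Prod.fst ∘ fun z : X × P => (z.1, T z)) = Prod.fst := rfl
  rw [this, Measure.map_fst_prod]
  simp

lemma map_snd_acceptedFlow_le (hT : Measurable T) (hα1 : ∀ z, α z ≤ 1)
    (hsymm : (acceptedFlow μ N T α).map Prod.swap = acceptedFlow μ N T α) :
    (acceptedFlow μ N T α).map Prod.snd ≤ μ := by
  refine le_trans (le_of_eq ?_) (map_fst_acceptedFlow_le (N := N) hT hα1)
  conv_rhs => rw [← hsymm]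
  rw [Measure.map_map measurable_fst measurable_swap]
  rfl

lemma isFiniteMeasure_acceptedFlow (hT : Measurable T) (hα1 : ∀ z, α z ≤ 1) :
    IsFiniteMeasure (acceptedFlow μ N T α) :=
  isFiniteMeasure_of_map_fst_le (map_fst_acceptedFlow_le hT hα1)

lemma integrable_of_measurable_of_bound {Y : Type*} [MeasurableSpace Y] {ν : Measure Y}
    [IsFiniteMeasure ν] {F : Y → ℝ} (hF : Measurable F) {B : ℝ} (hB : ∀ y, |F y| ≤ B) :
    Integrable F ν :=
  Integrable.of_bound hF.aestronglyMeasurable B (.of_forall hB)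

lemma integral_acceptedFlow (hT : Measurable T) (hα : Measurable α) (hα0 : ∀ z, 0 ≤ α z)
    (hα1 : ∀ z, α z ≤ 1) {G : X × X → ℝ} (hG : Measurable G) {B : ℝ} (hB : ∀ z, |G z| ≤ B) :
    ∫ z, G z ∂(acceptedFlow μ N T α) = ∫ q, ∫ p, G (q, T (q, p)) * α (q, p) ∂N ∂μ := by
  rw [acceptedFlow, integral_map (by fun_prop) hG.aestronglyMeasurable,
    integral_withDensity_eq_integral_toReal_smul (by fun_prop)
      (.of_forall fun _ => ENNReal.ofReal_lt_top)]
  simp_rw [ENNReal.toReal_ofReal (hα0 _), smul_eq_mul]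
  rw [integral_prod]
  · simp_rw [mul_comm]
  · refine integrable_of_measurable_of_bound (B := B) (by fun_prop) fun z => ?_
    rw [abs_mul, abs_of_nonneg (hα0 z)]
    calc α z * |G (z.1, T z)| ≤ 1 * B :=
        mul_le_mul (hα1 z) (hB _) (abs_nonneg _) zero_le_one
      _ = B := one_mul B

/-- Evolution of the density of a lazy reversible accept-reject chain in one step. -/
noncomputable def lazyDensityStep (N : Measure P) (T : X × P → X) (α : X × P → ℝ) (h : X → ℝ)
    (q : X) : ℝ :=
  h q + 1 / 2 * ∫ p, (h (T (q, p)) - h q) * α (q, p) ∂N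

lemma measurable_lazyDensityStep (hT : Measurable T) (hα : Measurable α) {h : X → ℝ}
    (hh : Measurable h) : Measurable (lazyDensityStep N T α h) := by
  have : StronglyMeasurable fun q => ∫ p, (h (T (q, p)) - h q) * α (q, p) ∂N := by
    refine StronglyMeasurable.integral_prod_right'
      (f := fun z : X × P => (h (T z) - h z.1) * α z) ?_
    exact Measurable.stronglyMeasurable (by fun_prop)
  have := this.measurable
  unfold lazyDensityStep
  fun_prop

lemma lazyDensityStep_mem_Icc (hT : Measurable T) (hα : Measurable α) (hα0 : ∀ z, 0 ≤ α z)
    (hα1 : ∀ z, α z ≤ 1) {h : X → ℝ} (hh : Measurable h) {M : ℝ} (h0 : ∀ x, 0 ≤ h x)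
    (hM : ∀ x, h x ≤ M) (q : X) :
    0 ≤ lazyDensityStep N T α h q ∧ lazyDensityStep N T α h q ≤ M := by
  have hl : ∀ p, -h q ≤ (h (T (q, p)) - h q) * α (q, p) := fun p => by
    nlinarith [h0 q, h0 (T (q, p)), hα0 (q, p), hα1 (q, p), mul_nonneg (h0 (T (q, p))) (hα0 (q, p)),
      mul_nonneg (h0 q) (sub_nonneg.2 (hα1 (q, p)))]
  have hu : ∀ p, (h (T (q, p)) - h q) * α (q, p) ≤ M - h q := fun p => by
    nlinarith [mul_nonneg (sub_nonneg.2 (hM (T (q, p)))) (hα0 (q, p)),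
      mul_nonneg (sub_nonneg.2 (hM q)) (sub_nonneg.2 (hα1 (q, p)))]
  have hI : Integrable (fun p => (h (T (q, p)) - h q) * α (q, p)) N := by
    refine integrable_of_measurable_of_bound (B := M) (by fun_prop) fun p => ?_
    rw [abs_le]
    constructor <;> linarith [hl p, hu p, h0 q, hM q]
  have e1 : -h q ≤ ∫ p, (h (T (q, p)) - h q) * α (q, p) ∂N := by
    have := integral_mono (integrable_const (-h q)) hI hl
    simpa using this
  have e2 : ∫ p, (h (T (q, p)) - h q) * α (q, p) ∂N ≤ M - h q := by
    have := integral_mono hI (integrable_const (M - h q)) hu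
    simpa using this
  unfold lazyDensityStep
  constructor <;> linarith [h0 q, hM q]

/-- The variance of the density decreases by at least a quarter of the Dirichlet form. -/
lemma integral_lazyDensityStep_sub_one_sq_le (hT : Measurable T) (hα : Measurable α)
    (hα0 : ∀ z, 0 ≤ α z) (hα1 : ∀ z, α z ≤ 1)
    (hsymm : (acceptedFlow μ N T α).map Prod.swap = acceptedFlow μ N T α)
    {h : X → ℝ} (hh : Measurable h) {M : ℝ} (h0 : ∀ x, 0 ≤ h x) (hM : ∀ x, h x ≤ M) :
    ∫ q, (lazyDensityStep N T α h q - 1) ^ 2 ∂μ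
      ≤ ∫ q, (h q - 1) ^ 2 ∂μ - 1 / 4 * ∫ z, (h z.1 - h z.2) ^ 2 ∂(acceptedFlow μ N T α) := by
  have hfin := isFiniteMeasure_acceptedFlow (μ := μ) (N := N) hT hα1
  obtain ⟨x₀⟩ : Nonempty X := nonempty_of_isProbabilityMeasure μ
  have hM0 : 0 ≤ M := (h0 x₀).trans (hM x₀)
  have hd : ∀ x y, |h y - h x| ≤ M := fun x y => by
    rw [abs_le]; constructor <;> linarith [h0 x, h0 y, hM x, hM y]
  have hd1 : ∀ x, |h x - 1| ≤ M + 1 := fun x => by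
    rw [abs_le]; constructor <;> linarith [h0 x, hM x]
  have hdα : ∀ z : X × P, |(h (T z) - h z.1) * α z| ≤ M := fun z => by
    rw [abs_mul, abs_of_nonneg (hα0 z)]
    calc _ ≤ M * 1 := mul_le_mul (hd _ _) (hα1 z) (hα0 z) hM0
      _ = M := mul_one M
  set k : X → ℝ := fun q => ∫ p, (h (T (q, p)) - h q) * α (q, p) ∂N with hk
  have hkm : Measurable k := by
    refine (StronglyMeasurable.integral_prod_right'
      (f := fun z : X × P => (h (T z) - h z.1) * α z) ?_).measurable
    exact Measurable.stronglyMeasurable (by fun_prop)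
  have hkb : ∀ q, |k q| ≤ M := fun q => by
    have := norm_integral_le_of_norm_le_const (μ := N) (C := M)
      (f := fun p => (h (T (q, p)) - h q) * α (q, p)) (.of_forall fun p => hdα (q, p))
    simpa using this
  set D := ∫ z, (h z.1 - h z.2) ^ 2 ∂(acceptedFlow μ N T α) with hD
  have hDeq : D = ∫ q, ∫ p, (h q - h (T (q, p))) ^ 2 * α (q, p) ∂N ∂μ :=
    integral_acceptedFlow hT hα hα0 hα1 (G := fun z => (h z.1 - h z.2) ^ 2) (by fun_prop)
      (B := M ^ 2) fun z => by
        rw [abs_pow]; exact pow_le_pow_left₀ (abs_nonneg _) (hd _ _) 2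
  have hk2 : ∫ q, k q ^ 2 ∂μ ≤ D := by
    rw [hDeq]
    have hb : ∀ z : X × P, |(h z.1 - h (T z)) ^ 2 * α z| ≤ M ^ 2 := fun z => by
      rw [abs_mul, abs_of_nonneg (hα0 z), abs_pow]
      calc _ ≤ M ^ 2 * 1 := mul_le_mul (pow_le_pow_left₀ (abs_nonneg _) (hd _ _) 2) (hα1 z)
            (hα0 z) (by positivity)
        _ = _ := mul_one _
    refine integral_mono (integrable_of_measurable_of_bound (B := M ^ 2) (by fun_prop) fun q => ?_)
      ?_ fun q => ?_
    · rw [abs_pow]; exact pow_le_pow_left₀ (abs_nonneg _) (hkb _) 2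
    · exact Integrable.integral_prod_left (f := fun z : X × P => (h z.1 - h (T z)) ^ 2 * α z)
        (integrable_of_measurable_of_bound (B := M ^ 2) (by fun_prop) hb)
    · -- expand the square of `(h (T (q, p)) - h q) α - k q`
      have hI1 : Integrable (fun p => (h q - h (T (q, p))) ^ 2 * α (q, p)) N :=
        integrable_of_measurable_of_bound (B := M ^ 2) (by fun_prop) fun p => hb (q, p)
      have hI2 : Integrable (fun p => (h (T (q, p)) - h q) * α (q, p)) N :=
        integrable_of_measurable_of_bound (B := M) (by fun_prop) fun p => hdα (q, p)
      have e : ∀ p, 2 * k q * ((h (T (q, p)) - h q) * α (q, p)) - k q ^ 2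
          ≤ (h q - h (T (q, p))) ^ 2 * α (q, p) := fun p => by
        nlinarith [mul_nonneg (sq_nonneg (h q - h (T (q, p)) + k q)) (hα0 (q, p)),
          mul_nonneg (sq_nonneg (k q)) (sub_nonneg.2 (hα1 (q, p)))]
      have := integral_mono ((hI2.const_mul (2 * k q)).sub (integrable_const (k q ^ 2))) hI1 e
      simp only [Pi.sub_apply] at this
      rw [integral_sub (hI2.const_mul _) (integrable_const _), integral_const_mul] at this
      simp only [integral_const, probReal_univ, smul_eq_mul, one_mul] at this
      have e2 : ∫ p, (h (T (q, p)) - h q) * α (q, p) ∂N = k q := rfl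
      rw [e2] at this
      show k q ^ 2 ≤ _
      linarith
  have hb3 : ∀ x y : X, |(h x - 1) * (h y - h x)| ≤ (M + 1) * M := fun x y => by
    rw [abs_mul]; exact mul_le_mul (hd1 x) (hd x y) (abs_nonneg _) (by linarith)
  have hhk : ∫ q, (h q - 1) * k q ∂μ = -(1 / 2) * D := by
    have e1 : ∫ q, (h q - 1) * k q ∂μ
        = ∫ z, (h z.1 - 1) * (h z.2 - h z.1) ∂(acceptedFlow μ N T α) := by
      rw [integral_acceptedFlow hT hα hα0 hα1
        (G := fun z => (h z.1 - 1) * (h z.2 - h z.1)) (by fun_prop) (fun z => hb3 z.1 z.2)]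
      refine integral_congr_ae (.of_forall fun q => ?_)
      simp only [hk]
      rw [← integral_const_mul]
      simp_rw [mul_assoc]
    have e2 : ∫ z, (h z.1 - 1) * (h z.2 - h z.1) ∂(acceptedFlow μ N T α)
        = ∫ z, (h z.2 - 1) * (h z.1 - h z.2) ∂(acceptedFlow μ N T α) := by
      conv_lhs => rw [← hsymm]
      rw [integral_map measurable_swap.aemeasurable
        (Measurable.aestronglyMeasurable (by fun_prop))]
      rfl
    have e3 : ∫ z, (h z.1 - 1) * (h z.2 - h z.1) ∂(acceptedFlow μ N T α)
        + ∫ z, (h z.2 - 1) * (h z.1 - h z.2) ∂(acceptedFlow μ N T α) = -D := by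
      rw [← integral_add, hD, ← integral_neg]
      · congr 1; funext z; ring
      · exact integrable_of_measurable_of_bound (by fun_prop) fun z => hb3 z.1 z.2
      · exact integrable_of_measurable_of_bound (by fun_prop) fun z => hb3 z.2 z.1
    linarith
  have hI1 : Integrable (fun q => (h q - 1) ^ 2) μ :=
    integrable_of_measurable_of_bound (B := (M + 1) ^ 2) (by fun_prop) fun q => by
      rw [abs_pow]; exact pow_le_pow_left₀ (abs_nonneg _) (hd1 _) 2
  have hI2 : Integrable (fun q => (h q - 1) * k q) μ :=
    integrable_of_measurable_of_bound (B := (M + 1) * M) (by fun_prop) fun q => by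
      rw [abs_mul]; exact mul_le_mul (hd1 q) (hkb q) (abs_nonneg _) (by linarith)
  have hI3 : Integrable (fun q => 1 / 4 * k q ^ 2) μ :=
    (integrable_of_measurable_of_bound (B := M ^ 2) (by fun_prop) fun q => by
      rw [abs_pow]; exact pow_le_pow_left₀ (abs_nonneg _) (hkb _) 2).const_mul _
  have hexp : ∫ q, (lazyDensityStep N T α h q - 1) ^ 2 ∂μ
      = ∫ q, (h q - 1) ^ 2 ∂μ + ∫ q, (h q - 1) * k q ∂μ + 1 / 4 * ∫ q, k q ^ 2 ∂μ := by
    rw [← integral_const_mul, ← integral_add hI1 hI2,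
      ← integral_add (f := fun q => (h q - 1) ^ 2 + (h q - 1) * k q) (hI1.add hI2) hI3]
    refine integral_congr_ae (.of_forall fun q => ?_)
    simp only [lazyDensityStep, hk]
    ring
  rw [hexp, hhk]
  linarith

/-- Densities with respect to the stationary law evolve by `lazyDensityStep`. -/
lemma withDensity_bind_eq (hT : Measurable T) (hα : Measurable α)
    (hα0 : ∀ z, 0 ≤ α z) (hα1 : ∀ z, α z ≤ 1)
    (hsymm : (acceptedFlow μ N T α).map Prod.swap = acceptedFlow μ N T α)
    {κ : X → Measure X} (hκ : ∀ q A, MeasurableSet A →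
      κ q A = ENNReal.ofReal (lazyDensityStep N T α (A.indicator 1) q))
    {h : X → ℝ} (hh : Measurable h) {M : ℝ} (h0 : ∀ x, 0 ≤ h x) (hM : ∀ x, h x ≤ M) :
    (μ.withDensity fun q => ENNReal.ofReal (h q)).bind κ
      = μ.withDensity fun q => ENNReal.ofReal (lazyDensityStep N T α h q) := by
  have hfin := isFiniteMeasure_acceptedFlow (μ := μ) (N := N) hT hα1
  obtain ⟨x₀⟩ : Nonempty X := nonempty_of_isProbabilityMeasure μ
  have hM0 : 0 ≤ M := (h0 x₀).trans (hM x₀)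
  have hκm : Measurable κ := by
    refine Measure.measurable_of_measurable_coe _ fun A hA => ?_
    simp_rw [fun q => hκ q A hA]
    exact (measurable_lazyDensityStep hT hα (measurable_one.indicator hA)).ennreal_ofReal
  -- the identity `∫ f (step g) = ∫ g (step f)` for bounded nonnegative `f`, `g`
  have key : ∀ (f g : X → ℝ), Measurable f → Measurable g → ∀ A B : ℝ, 0 ≤ A → 0 ≤ B →
      (∀ x, 0 ≤ f x) → (∀ x, f x ≤ A) → (∀ x, 0 ≤ g x) → (∀ x, g x ≤ B) →
      ∫ q, f q * lazyDensityStep N T α g q ∂μ = ∫ q, f q * g q ∂μ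
        + 1 / 2 * (∫ z, f z.1 * g z.2 ∂(acceptedFlow μ N T α)
          - ∫ z, f z.1 * g z.1 ∂(acceptedFlow μ N T α)) := by
    intro f g hf hg A B hA0 hB0 hf0 hfA hg0 hgB
    have hfg : ∀ x y, |f x * g y| ≤ A * B := fun x y => by
      rw [abs_of_nonneg (mul_nonneg (hf0 x) (hg0 y))]
      exact mul_le_mul (hfA x) (hgB y) (hg0 y) hA0
    have hfd : ∀ x y, |f x * (g y - g x)| ≤ A * B := fun x y => by
      rw [abs_mul, abs_of_nonneg (hf0 x)]
      refine mul_le_mul (hfA x) ?_ (abs_nonneg _) hA0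
      rw [abs_le]; constructor <;> linarith [hg0 x, hg0 y, hgB x, hgB y]
    rw [← integral_sub (f := fun z : X × X => f z.1 * g z.2) (g := fun z : X × X => f z.1 * g z.1)
      (integrable_of_measurable_of_bound (by fun_prop) fun z => hfg z.1 z.2)
      (integrable_of_measurable_of_bound (by fun_prop) fun z => hfg z.1 z.1)]
    have e : ∫ z, (f z.1 * g z.2 - f z.1 * g z.1) ∂(acceptedFlow μ N T α)
        = ∫ q, f q * ∫ p, (g (T (q, p)) - g q) * α (q, p) ∂N ∂μ := by
      simp_rw [← mul_sub]
      rw [integral_acceptedFlow hT hα hα0 hα1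
        (G := fun z => f z.1 * (g z.2 - g z.1)) (by fun_prop) (fun z => hfd z.1 z.2)]
      refine integral_congr_ae (.of_forall fun q => ?_)
      simp only
      rw [← integral_const_mul]
      simp_rw [mul_assoc]
    rw [e, ← integral_const_mul, ← integral_add]
    · refine integral_congr_ae (.of_forall fun q => ?_)
      simp only [lazyDensityStep]
      ring
    · exact integrable_of_measurable_of_bound (by fun_prop) fun q => hfg q q
    · refine Integrable.const_mul ?_ _
      have hm : Measurable fun q => ∫ p, (g (T (q, p)) - g q) * α (q, p) ∂N :=
        (StronglyMeasurable.integral_prod_right'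
          (f := fun z : X × P => (g (T z) - g z.1) * α z)
          (Measurable.stronglyMeasurable (by fun_prop))).measurable
      refine integrable_of_measurable_of_bound (B := A * B) (by fun_prop) fun q => ?_
      rw [abs_mul, abs_of_nonneg (hf0 q)]
      refine mul_le_mul (hfA q) ?_ (abs_nonneg _) hA0
      have := norm_integral_le_of_norm_le_const (μ := N) (C := B)
        (f := fun p => (g (T (q, p)) - g q) * α (q, p)) (.of_forall fun p => ?_)
      · simpa using this
      · rw [Real.norm_eq_abs, abs_mul, abs_of_nonneg (hα0 _)]
        calc _ ≤ B * 1 := by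
              refine mul_le_mul ?_ (hα1 _) (hα0 _) hB0
              rw [abs_le]
              constructor <;> linarith [hg0 q, hg0 (T (q, p)), hgB q, hgB (T (q, p))]
          _ = B := mul_one B
  have hbd := fun q => lazyDensityStep_mem_Icc (N := N) hT hα hα0 hα1 hh h0 hM q
  ext A hA
  have hi0 : ∀ x, 0 ≤ A.indicator (1 : X → ℝ) x := fun x =>
    Set.indicator_nonneg (fun _ _ => zero_le_one) x
  have hi1 : ∀ x, A.indicator (1 : X → ℝ) x ≤ 1 := fun x =>
    Set.indicator_le_self' (fun _ _ => zero_le_one) x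
  have him : Measurable (A.indicator (1 : X → ℝ)) := measurable_one.indicator hA
  have hsm := measurable_lazyDensityStep (N := N) hT hα hh
  have hsi := measurable_lazyDensityStep (N := N) hT hα him
  have hbi := fun q => lazyDensityStep_mem_Icc (N := N) hT hα hα0 hα1 him hi0 hi1 q
  rw [Measure.bind_apply hA hκm.aemeasurable, withDensity_apply _ hA,
    lintegral_withDensity_eq_lintegral_mul (g := fun q => κ q A) _ (by fun_prop)
      ((Measure.measurable_coe hA).comp hκm)]
  simp only [Pi.mul_apply, hκ _ A hA]
  rw [← lintegral_indicator hA]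
  have e1 : ∀ q, ENNReal.ofReal (h q) * ENNReal.ofReal (lazyDensityStep N T α (A.indicator 1) q)
      = ENNReal.ofReal (h q * lazyDensityStep N T α (A.indicator 1) q) := fun q =>
    (ENNReal.ofReal_mul (h0 q)).symm
  have e2 : ∀ q, A.indicator (fun q => ENNReal.ofReal (lazyDensityStep N T α h q)) q
      = ENNReal.ofReal (A.indicator (1 : X → ℝ) q * lazyDensityStep N T α h q) := fun q => by
    by_cases hq : q ∈ A <;> simp [hq]
  simp_rw [e1, e2]
  rw [← ofReal_integral_eq_lintegral_ofReal, ← ofReal_integral_eq_lintegral_ofReal]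
  · rw [key h _ hh him M 1 hM0 zero_le_one h0 hM hi0 hi1,
      key _ h him hh 1 M zero_le_one hM0 hi0 hi1 h0 hM]
    have e3 : ∫ z, h z.1 * A.indicator 1 z.2 ∂(acceptedFlow μ N T α)
        = ∫ z, A.indicator 1 z.1 * h z.2 ∂(acceptedFlow μ N T α) := by
      conv_lhs => rw [← hsymm]
      rw [integral_map measurable_swap.aemeasurable
        (Measurable.aestronglyMeasurable (by fun_prop))]
      refine integral_congr_ae (.of_forall fun z => ?_)
      exact mul_comm _ _
    rw [e3]
    simp_rw [mul_comm (h _)]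
  · refine integrable_of_measurable_of_bound (B := 1 * M) (by fun_prop) fun q => ?_
    rw [abs_of_nonneg (mul_nonneg (hi0 q) (hbd q).1)]
    exact mul_le_mul (hi1 q) (hbd q).2 (hbd q).1 zero_le_one
  · exact .of_forall fun q => mul_nonneg (hi0 q) (hbd q).1
  · refine integrable_of_measurable_of_bound (B := M * 1) (by fun_prop) fun q => ?_
    rw [abs_of_nonneg (mul_nonneg (h0 q) (hbi q).1)]
    exact mul_le_mul (hM q) (hbi q).2 (hbi q).1 hM0
  · exact .of_forall fun q => mul_nonneg (h0 q) (hbi q).1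

end AcceptReject


/-- A measure dominated by a multiple of `μ` has a bounded density. -/
lemma Warm.exists_density {X : Type*} [MeasurableSpace X] {μ₀ μ : Measure X}
    [IsFiniteMeasure μ₀] [IsFiniteMeasure μ] {M : ℝ} (hM0 : 0 ≤ M) (hw : Warm μ₀ μ M) :
    ∃ h : X → ℝ, Measurable h ∧ (∀ x, 0 ≤ h x) ∧ (∀ x, h x ≤ M) ∧
      μ₀ = μ.withDensity fun x => ENNReal.ofReal (h x) := by
  have hac : μ₀ ≪ μ := by
    refine Measure.AbsolutelyContinuous.mk fun s hs h0 => ?_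
    have := hw s hs
    simpa [h0] using this
  have hle : μ₀.rnDeriv μ ≤ᵐ[μ] fun _ => ENNReal.ofReal M := by
    refine ae_le_of_forall_setLIntegral_le_of_sigmaFinite (Measure.measurable_rnDeriv _ _)
      fun s hs _ => ?_
    rw [setLIntegral_const]
    exact (Measure.setLIntegral_rnDeriv_le s).trans (hw s hs)
  refine ⟨fun x => min (μ₀.rnDeriv μ x).toReal M, by fun_prop,
    fun x => le_min ENNReal.toReal_nonneg hM0, fun x => min_le_right _ _, ?_⟩
  conv_lhs => rw [← Measure.withDensity_rnDeriv_eq μ₀ μ hac]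
  refine withDensity_congr_ae ?_
  filter_upwards [hle] with x hx
  have hx' : (μ₀.rnDeriv μ x).toReal ≤ M := ENNReal.toReal_le_of_le_ofReal hM0 hx
  rw [min_eq_left hx', ENNReal.ofReal_toReal (ne_top_of_le_ne_top ENNReal.ofReal_ne_top hx)]

lemma tvDist_withDensity_le {X : Type*} [MeasurableSpace X] {μ : Measure X}
    [IsProbabilityMeasure μ] {h : X → ℝ} (hh : Measurable h) {M : ℝ} (h0 : ∀ x, 0 ≤ h x)
    (hM : ∀ x, h x ≤ M) {ε : ℝ} (hε : 0 < ε) (hV : ∫ x, (h x - 1) ^ 2 ∂μ ≤ ε ^ 2) :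
    tvDist (μ.withDensity fun x => ENNReal.ofReal (h x)) μ ≤ ε := by
  refine Real.sSup_le ?_ hε.le
  rintro r ⟨A, hA, rfl⟩
  have hM0 : 0 ≤ M := by
    obtain ⟨x⟩ : Nonempty X := nonempty_of_isProbabilityMeasure μ
    exact (h0 x).trans (hM x)
  have hI : Integrable h μ := integrable_of_measurable_of_bound hh (B := M) fun x => by
    rw [abs_of_nonneg (h0 x)]; exact hM x
  have hb : ∀ x, |h x - 1| ≤ M + 1 := fun x => by
    rw [abs_le]; constructor <;> linarith [h0 x, hM x]
  have hI2 : Integrable (fun x => (h x - 1) ^ 2) μ :=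
    integrable_of_measurable_of_bound (by fun_prop) (B := (M + 1) ^ 2) fun x => by
      rw [abs_pow]; exact pow_le_pow_left₀ (abs_nonneg _) (hb x) 2
  have hI3 : Integrable (fun x => |h x - 1|) μ :=
    integrable_of_measurable_of_bound (by fun_prop) (B := M + 1) fun x => by
      rw [abs_abs]; exact hb x
  rw [withDensity_apply _ hA, ← ofReal_integral_eq_lintegral_ofReal hI.integrableOn
    (.of_forall h0), ENNReal.toReal_ofReal (integral_nonneg h0)]
  have e : ∫ x in A, h x ∂μ - (μ A).toReal = ∫ x in A, (h x - 1) ∂μ := by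
    rw [integral_sub hI.integrableOn (integrable_const _)]
    simp [Measure.real]
  rw [e]
  calc |∫ x in A, (h x - 1) ∂μ| ≤ ∫ x in A, |h x - 1| ∂μ := abs_integral_le_integral_abs
    _ ≤ ∫ x, |h x - 1| ∂μ := setIntegral_le_integral hI3 (.of_forall fun x => abs_nonneg _)
    _ ≤ ∫ x, (1 / (2 * ε) * (h x - 1) ^ 2 + ε / 2) ∂μ := by
        refine integral_mono hI3 ((hI2.const_mul _).add (integrable_const _)) fun x => ?_
        show |h x - 1| ≤ 1 / (2 * ε) * (h x - 1) ^ 2 + ε / 2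
        rw [← sq_abs (h x - 1)]
        have : 1 / (2 * ε) * |h x - 1| ^ 2 + ε / 2 - |h x - 1|
            = 1 / (2 * ε) * (|h x - 1| - ε) ^ 2 := by field_simp; ring
        have h2 : 0 ≤ 1 / (2 * ε) * (|h x - 1| - ε) ^ 2 := by positivity
        linarith
    _ = 1 / (2 * ε) * ∫ x, (h x - 1) ^ 2 ∂μ + ε / 2 := by
        rw [integral_add (hI2.const_mul _) (integrable_const _), integral_const_mul]
        simp
    _ ≤ 1 / (2 * ε) * ε ^ 2 + ε / 2 := by gcongr
    _ = ε := by field_simp; ring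

section HMC

variable {d : ℕ} {f : Euc d → ℝ}

/-- The law of accepted moves of stationary Metropolized HMC. -/
noncomputable def hmcFlow (f : Euc d → ℝ) (K : ℕ) (η : ℝ) : Measure (Euc d × Euc d) :=
  acceptedFlow (targetMeasure f) (stdGaussian d) (fun z => (leapfrog f η K z).1)
    fun z => accProb f K η z.1 z.2

lemma map_swap_hmcFlow (hf : Measurable f) (hg : Measurable (gradient f))
    (hZ : IsProbabilityMeasure (targetMeasure f)) (K : ℕ) (η : ℝ) :
    (hmcFlow f K η).map Prod.swap = hmcFlow f K η := by
  have hT := measurable_leapfrog hg η K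
  have hΨ := (measurePreserving_leapfrogFlip hg η K).measurable
  unfold hmcFlow acceptedFlow
  rw [Measure.map_map measurable_swap (by fun_prop)]
  conv_rhs => rw [← map_leapfrogFlip_withDensity_accProb hf hg hZ K η]
  rw [Measure.map_map (by fun_prop) hΨ]
  congr 1
  funext z
  have := leapfrogFlip_leapfrogFlip f η K z
  have h1 : (leapfrog f η K (leapfrogFlip f η K z)).1 = z.1 :=
    (congrArg Prod.fst this :)
  simp only [Function.comp_apply, h1, Prod.swap]
  rfl

lemma lazyHMC_apply (hf : Measurable f) (hg : Measurable (gradient f)) (K : ℕ) (η : ℝ) (q : Euc d)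
    {A : Set (Euc d)} (hA : MeasurableSet A) :
    lazyHMC f K η q A = ENNReal.ofReal (lazyDensityStep (stdGaussian d)
      (fun z => (leapfrog f η K z).1) (fun z => accProb f K η z.1 z.2) (A.indicator 1) q) := by
  have hT : Measurable fun p => (leapfrog f η K (q, p)).1 :=
    measurable_fst.comp ((measurable_leapfrog hg η K).comp (by fun_prop))
  have hα : Measurable fun p => accProb f K η q p :=
    (measurable_accProb hf hg K η).comp (g := fun z : Euc d × Euc d => accProb f K η z.1 z.2)
      (f := fun p => (q, p)) (by fun_prop)
  have hi0 : ∀ x, 0 ≤ A.indicator (1 : Euc d → ℝ) x := fun x =>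
    Set.indicator_nonneg (fun _ _ => zero_le_one) x
  have hi1 : ∀ x, A.indicator (1 : Euc d → ℝ) x ≤ 1 := fun x =>
    Set.indicator_le_self' (fun _ _ => zero_le_one) x
  have him : Measurable (A.indicator (1 : Euc d → ℝ)) := measurable_one.indicator hA
  have hdir : ∀ x, Measure.dirac x A = ENNReal.ofReal (A.indicator (1 : Euc d → ℝ) x) := fun x => by
    rw [Measure.dirac_apply' _ hA]
    by_cases hx : x ∈ A <;> simp [hx]
  have hK : hmcKernel f K η q A = ENNReal.ofReal (∫ p, (accProb f K η q p
      * A.indicator 1 (leapfrog f η K (q, p)).1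
      + (1 - accProb f K η q p) * A.indicator 1 q) ∂(stdGaussian d)) := by
    unfold hmcKernel
    rw [Measure.bind_apply hA]
    · rw [ofReal_integral_eq_lintegral_ofReal]
      · refine lintegral_congr fun p => ?_
        rw [Measure.add_apply, Measure.smul_apply, Measure.smul_apply, smul_eq_mul, smul_eq_mul,
          hdir, hdir, ← ENNReal.ofReal_mul (accProb_nonneg _ _ _ _ _),
          ← ENNReal.ofReal_mul (sub_nonneg.2 (accProb_le_one _ _ _ _ _)), ← ENNReal.ofReal_add]
        · exact mul_nonneg (accProb_nonneg _ _ _ _ _) (hi0 _)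
        · exact mul_nonneg (sub_nonneg.2 (accProb_le_one _ _ _ _ _)) (hi0 _)
      · refine integrable_of_measurable_of_bound (B := 1) (by fun_prop) fun p => ?_
        have a0 := accProb_nonneg f K η q p
        have a1 := accProb_le_one f K η q p
        rw [abs_le]
        constructor <;> nlinarith [hi0 (leapfrog f η K (q, p)).1, hi1 (leapfrog f η K (q, p)).1,
          hi0 q, hi1 q]
      · exact .of_forall fun p => add_nonneg (mul_nonneg (accProb_nonneg _ _ _ _ _) (hi0 _))
          (mul_nonneg (sub_nonneg.2 (accProb_le_one _ _ _ _ _)) (hi0 _))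
    · refine (Measure.measurable_of_measurable_coe _ fun B hB => ?_).aemeasurable
      simp only [Measure.add_apply, Measure.smul_apply, smul_eq_mul, Measure.dirac_apply' _ hB]
      have : Measurable (B.indicator (1 : Euc d → ℝ≥0∞)) := measurable_one.indicator hB
      fun_prop
  have e1 : ∀ p, accProb f K η q p * A.indicator 1 (leapfrog f η K (q, p)).1
      + (1 - accProb f K η q p) * A.indicator 1 q = A.indicator 1 q
      + (A.indicator 1 (leapfrog f η K (q, p)).1 - A.indicator 1 q) * accProb f K η q p :=
    fun p => by ring
  have hnn : 0 ≤ A.indicator 1 q + ∫ p, (A.indicator 1 (leapfrog f η K (q, p)).1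
      - A.indicator 1 q) * accProb f K η q p ∂(stdGaussian d) ∧
      hmcKernel f K η q A = ENNReal.ofReal (A.indicator 1 q
        + ∫ p, (A.indicator 1 (leapfrog f η K (q, p)).1
      - A.indicator 1 q) * accProb f K η q p ∂(stdGaussian d)) := by
    have e2 : A.indicator 1 q + ∫ p, (A.indicator 1 (leapfrog f η K (q, p)).1
      - A.indicator 1 q) * accProb f K η q p ∂(stdGaussian d) = ∫ p, (accProb f K η q p
      * A.indicator 1 (leapfrog f η K (q, p)).1
      + (1 - accProb f K η q p) * A.indicator 1 q) ∂(stdGaussian d) := by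
      simp_rw [e1]
      rw [integral_add (integrable_const _)]
      · simp
      · refine integrable_of_measurable_of_bound (B := 1) (by fun_prop) fun p => ?_
        rw [abs_mul, abs_of_nonneg (accProb_nonneg f K η q p)]
        refine mul_le_one₀ ?_ (accProb_nonneg f K η q p) (accProb_le_one f K η q p)
        rw [abs_le]
        constructor <;> linarith [hi0 (leapfrog f η K (q, p)).1, hi1 (leapfrog f η K (q, p)).1,
          hi0 q, hi1 q]
    rw [e2]
    refine ⟨integral_nonneg fun p => add_nonneg (mul_nonneg (accProb_nonneg _ _ _ _ _) (hi0 _))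
          (mul_nonneg (sub_nonneg.2 (accProb_le_one _ _ _ _ _)) (hi0 _)), hK⟩
  have hhalf : (2 : ℝ≥0∞)⁻¹ = ENNReal.ofReal (1 / 2) := by
    rw [one_div, ENNReal.ofReal_inv_of_pos (by norm_num)]; simp
  rw [lazyHMC, Measure.add_apply, Measure.smul_apply, Measure.smul_apply, smul_eq_mul, smul_eq_mul,
    hdir, hnn.2, hhalf, ← ENNReal.ofReal_mul (by norm_num), ← ENNReal.ofReal_mul (by norm_num),
    ← ENNReal.ofReal_add (mul_nonneg (by norm_num) (hi0 q)) (mul_nonneg (by norm_num) hnn.1)]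
  congr 1
  simp only [lazyDensityStep]
  ring

/-- A mixing time bound from a lower bound on the stationary flow. -/
lemma mixingTime_le_of_flow (hf : Measurable f) (hg : Measurable (gradient f))
    (hZ : IsProbabilityMeasure (targetMeasure f)) {K : ℕ} {η : ℝ} {Φ s M ε : ℝ}
    (hΦ : 0 < Φ) (hΦ1 : Φ ≤ 1) (hs : 0 ≤ s) (hM1 : 1 ≤ M) (hε : 0 < ε)
    (hflow : ∀ S, MeasurableSet S → Φ * ((targetMeasure f).real S * (targetMeasure f).real Sᶜ - s)
      ≤ (hmcFlow f K η).real (S ×ˢ Sᶜ))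
    {μ₀ : Measure (Euc d)} [IsProbabilityMeasure μ₀] (hw : Warm μ₀ (targetMeasure f) M) {m : ℕ}
    (hm : exp (-(m * (Φ ^ 2 / 256))) * M ^ 2 + 8 * s * M ^ 2 ≤ ε ^ 2) :
    mixingTime f K η μ₀ ε ≤ m := by
  have hT : Measurable fun z => (leapfrog f η K z).1 :=
    measurable_fst.comp (measurable_leapfrog hg η K)
  have hα := measurable_accProb hf hg K η
  have hα0 := fun z : Euc d × Euc d => accProb_nonneg f K η z.1 z.2
  have hα1 := fun z : Euc d × Euc d => accProb_le_one f K η z.1 z.2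
  have hsymm := map_swap_hmcFlow hf hg hZ K η
  set r : ℝ := Φ ^ 2 / 256 with hr
  have hr1 : 0 ≤ 1 - r := by rw [hr]; nlinarith
  have main : ∀ k : ℕ, ∃ h : Euc d → ℝ, Measurable h ∧ (∀ x, 0 ≤ h x) ∧ (∀ x, h x ≤ M) ∧
      hmcIter f K η μ₀ k = (targetMeasure f).withDensity (fun x => ENNReal.ofReal (h x)) ∧
      ∫ x, h x ∂(targetMeasure f) = 1 ∧
      ∫ x, (h x - 1) ^ 2 ∂(targetMeasure f) - 8 * s * M ^ 2 ≤ (1 - r) ^ k * M ^ 2 := by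
    intro k
    induction k with
    | zero =>
      obtain ⟨h, hh, h0, hM, he⟩ := hw.exists_density (by linarith)
      have hI : Integrable h (targetMeasure f) :=
        integrable_of_measurable_of_bound hh (B := M) fun x => by
          rw [abs_of_nonneg (h0 x)]; exact hM x
      refine ⟨h, hh, h0, hM, he, ?_, ?_⟩
      · have h1 : μ₀ Set.univ = 1 := measure_univ
        rw [he, withDensity_apply _ MeasurableSet.univ, Measure.restrict_univ,
          ← ofReal_integral_eq_lintegral_ofReal hI (.of_forall h0)] at h1
        simpa using h1
      · have hle : ∫ x, (h x - 1) ^ 2 ∂(targetMeasure f) ≤ ∫ _x, M ^ 2 ∂(targetMeasure f) := by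
          refine integral_mono_of_nonneg (.of_forall fun x => sq_nonneg _) (integrable_const _)
            (.of_forall fun x => ?_)
          show (h x - 1) ^ 2 ≤ M ^ 2
          refine sq_le_sq' ?_ ?_ <;> linarith [h0 x, hM x]
        simp only [integral_const, probReal_univ, one_smul] at hle
        have : 0 ≤ 8 * s * M ^ 2 := by positivity
        simpa using by linarith
    | succ k ih =>
      obtain ⟨h, hh, h0, hM, he, h1, hV⟩ := ih
      have hbd := fun q => lazyDensityStep_mem_Icc (N := stdGaussian d) hT hα hα0 hα1 hh h0 hM q
      have hmeas := measurable_lazyDensityStep (N := stdGaussian d) hT hα hh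
      have hbind := withDensity_bind_eq (μ := targetMeasure f) hT hα hα0 hα1 hsymm
        (κ := lazyHMC f K η) (fun q A hA => lazyHMC_apply hf hg K η q hA) hh h0 hM
      have hdec := integral_lazyDensityStep_sub_one_sq_le (μ := targetMeasure f) hT hα hα0 hα1
        hsymm hh h0 hM
      have hvar := variance_le_of_flow_lower_bound (map_fst_acceptedFlow_le hT hα1)
        (map_snd_acceptedFlow_le hT hα1 hsymm) hΦ hs hflow hh h0 hM h1.symm
      set h' := lazyDensityStep (stdGaussian d) (fun z => (leapfrog f η K z).1)
        (fun z => accProb f K η z.1 z.2) h with hh'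
      have hI' : Integrable h' (targetMeasure f) :=
        integrable_of_measurable_of_bound hmeas (B := M) fun x => by
          rw [abs_of_nonneg (hbd x).1]; exact (hbd x).2
      refine ⟨h', hmeas, fun q => (hbd q).1, fun q => (hbd q).2, ?_, ?_, ?_⟩
      · rw [hmcIter, he, hbind]
      · have e := congrArg (fun ν : Measure (Euc d) => ν Set.univ) hbind
        rw [Measure.bind_apply MeasurableSet.univ] at e
        · simp only [lazyHMC_apply hf hg K η _ MeasurableSet.univ, lazyDensityStep,
            Set.indicator_univ, Pi.one_apply, sub_self, zero_mul, integral_zero, mul_zero,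
            add_zero, ENNReal.ofReal_one, lintegral_const, one_mul] at e
          have hI : Integrable h (targetMeasure f) :=
            integrable_of_measurable_of_bound hh (B := M) fun x => by
              rw [abs_of_nonneg (h0 x)]; exact hM x
          rw [withDensity_apply _ MeasurableSet.univ, withDensity_apply _ MeasurableSet.univ,
            Measure.restrict_univ,
            ← ofReal_integral_eq_lintegral_ofReal hI (.of_forall h0), h1] at e
          have e2 : ∫⁻ q, ENNReal.ofReal (h' q) ∂(targetMeasure f) = ENNReal.ofReal 1 := e.symm
          rw [← ofReal_integral_eq_lintegral_ofReal hI' (.of_forall fun q => (hbd q).1)] at e2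
          simpa using e2
        · refine (Measure.measurable_of_measurable_coe _ fun A hA => ?_).aemeasurable
          simp_rw [fun q => lazyHMC_apply hf hg K η q hA]
          exact (measurable_lazyDensityStep hT hα (measurable_one.indicator hA)).ennreal_ofReal
      · set V := ∫ x, (h x - 1) ^ 2 ∂(targetMeasure f)
        set D := ∫ z, (h z.1 - h z.2) ^ 2 ∂(acceptedFlow (targetMeasure f) (stdGaussian d)
          (fun z => (leapfrog f η K z).1) fun z => accProb f K η z.1 z.2)
        have hD : r * (V - 8 * s * M ^ 2) ≤ 1 / 4 * D := by
          have : V - 8 * s * M ^ 2 ≤ 64 / Φ ^ 2 * D := by linarith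
          calc r * (V - 8 * s * M ^ 2) ≤ r * (64 / Φ ^ 2 * D) := by gcongr
            _ = 1 / 4 * D := by rw [hr]; field_simp; ring
        calc _ ≤ (1 - r) * (V - 8 * s * M ^ 2) := by linarith
          _ ≤ (1 - r) * ((1 - r) ^ k * M ^ 2) := by gcongr
          _ = _ := by ring
  refine Nat.sInf_le ?_
  obtain ⟨h, hh, h0, hM, he, h1, hV⟩ := main m
  simp only [Set.mem_ofPred_eq]
  rw [he]
  refine tvDist_withDensity_le hh h0 hM hε ?_
  have hpow : (1 - r) ^ m ≤ exp (-(m * r)) := by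
    have : 1 - r ≤ exp (-r) := by have := add_one_le_exp (-r); linarith
    calc (1 - r) ^ m ≤ exp (-r) ^ m := by gcongr
      _ = _ := by rw [← exp_nat_mul]; congr 1; ring
  have : (1 - r) ^ m * M ^ 2 ≤ exp (-(m * r)) * M ^ 2 := by gcongr
  linarith

end HMC


lemma lintegral_targetMeasure {d : ℕ} {f : Euc d → ℝ} (hf : Measurable f) {w : Euc d → ℝ≥0∞}
    (hw : Measurable w) :
    ∫⁻ x, w x ∂(targetMeasure f)
      = ((volume.withDensity fun x => ENNReal.ofReal (exp (-f x))) Set.univ)⁻¹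
        * ∫⁻ x, ENNReal.ofReal (exp (-f x)) * w x := by
  rw [targetMeasure, lintegral_smul_measure, lintegral_withDensity_eq_lintegral_mul _
    (by fun_prop) hw, smul_eq_mul]
  rfl

/-- One step of gradient descent for a ridge separable potential. -/
noncomputable def ridgeStep {d n : ℕ} (u : Fin n → ℝ → ℝ) (a : Fin n → Euc d) (h : ℝ)
    (x : Euc d) : Euc d :=
  x - h • ridgeGrad u a x

namespace IsRidge

variable {d n : ℕ} {u : Fin n → ℝ → ℝ} {a : Fin n → Euc d} {ρ : ℝ} (hr : IsRidge u a ρ)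
include hr

lemma continuous_ridgeStep (h : ℝ) : Continuous (ridgeStep u a h) := by
  have := hr.continuous_ridgeGrad
  unfold ridgeStep
  fun_prop

variable {h : ℝ} (h0 : 0 ≤ h) (hL : h * (n * ρ) ≤ 1 / 4)
include h0 hL

lemma norm_ridgeStep_sub_sub_le (x y : Euc d) :
    ‖ridgeStep u a h x - ridgeStep u a h y - (x - y)‖ ≤ 1 / 4 * ‖x - y‖ := by
  have e : ridgeStep u a h x - ridgeStep u a h y - (x - y)
      = -(h • (ridgeGrad u a x - ridgeGrad u a y)) := by unfold ridgeStep; module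
  rw [e, norm_neg, norm_smul, Real.norm_of_nonneg h0]
  calc h * ‖ridgeGrad u a x - ridgeGrad u a y‖ ≤ h * (n * ρ * ‖x - y‖) := by
        gcongr; exact hr.norm_ridgeGrad_sub_le' x y
    _ = h * (n * ρ) * ‖x - y‖ := by ring
    _ ≤ _ := by gcongr

lemma norm_ridgeStep_sub_le (x y : Euc d) :
    ‖ridgeStep u a h x - ridgeStep u a h y‖ ≤ 5 / 4 * ‖x - y‖ := by
  have h1 := hr.norm_ridgeStep_sub_sub_le h0 hL x y
  have h2 := norm_le_norm_add_norm_sub' (ridgeStep u a h x - ridgeStep u a h y) (x - y)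
  linarith

lemma bijective_ridgeStep : Function.Bijective (ridgeStep u a h) :=
  bijective_of_norm_sub_sub_smul_le zero_lt_one fun x y => by
    rw [one_smul]; exact hr.norm_ridgeStep_sub_sub_le h0 hL x y

lemma exists_hasFDerivAt_ridgeStep (x : Euc d) :
    ∃ J : Euc d →L[ℝ] Euc d, HasFDerivAt (ridgeStep u a h) J x ∧
      1 / 2 ≤ |J.det| ∧ |J.det| ≤ 2 * 1 := by
  refine ⟨_, (hasFDerivAt_id x).sub ((hr.hasFDerivAt_ridgeGrad x).const_smul h), ?_⟩
  obtain ⟨h1, h2⟩ := det_mem_Icc_of_forall_apply_eq a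
    (fun i => -(h * deriv (deriv (u i)) ⟪a i, x⟫) • a i) hr.norm_eq_one (fun i => by
      rw [norm_smul, hr.norm_eq_one, mul_one, norm_neg, Real.norm_eq_abs, abs_mul, abs_of_nonneg h0,
        le_div_iff₀ hr.card_cast_pos]
      calc _ ≤ h * ρ * n := by gcongr; exact hr.abs_deriv_deriv_le i _
        _ = h * (n * ρ) := by ring
        _ ≤ _ := hL)
    ((ContinuousLinearMap.id ℝ (Euc d) - h • ∑ i, (deriv (deriv (u i)) ⟪a i, x⟫ •
      innerSL ℝ (a i)).smulRight (a i) : Euc d →L[ℝ] Euc d) : Euc d →ₗ[ℝ] Euc d) (fun v => by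
      simp [sub_eq_add_neg, Finset.smul_sum, inner_smul_left,
        smul_smul, mul_assoc])
  change 1 / 2 ≤ |LinearMap.det _| ∧ |LinearMap.det _| ≤ _
  rw [abs_of_nonneg (by linarith)]
  exact ⟨h1, by linarith⟩

lemma lintegral_comp_ridgeStep (w : Euc d → ℝ≥0∞) :
    ∫⁻ x, w (ridgeStep u a h x) ≤ 2 * ∫⁻ x, w x ∧
      ∫⁻ x, w x ≤ 2 * ∫⁻ x, w (ridgeStep u a h x) := by
  choose J hJ1 hJ2 using hr.exists_hasFDerivAt_ridgeStep h0 hL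
  have := lintegral_comp_le_and_le_lintegral_comp volume (hr.bijective_ridgeStep h0 hL) hJ1
    zero_lt_one hJ2 w
  simpa using this

lemma norm_ridgeGrad_ridgeStep_sub_le (x : Euc d) :
    ‖ridgeGrad u a (ridgeStep u a h x) - ridgeGrad u a x‖ ≤ 1 / 4 * ‖ridgeGrad u a x‖ := by
  refine (hr.norm_ridgeGrad_sub_le' _ _).trans ?_
  have e : ridgeStep u a h x - x = -(h • ridgeGrad u a x) := by unfold ridgeStep; abel
  rw [e, norm_neg, norm_smul, Real.norm_of_nonneg h0]
  calc n * ρ * (h * ‖ridgeGrad u a x‖) = h * (n * ρ) * ‖ridgeGrad u a x‖ := by ring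
    _ ≤ _ := by gcongr

lemma norm_sq_ridgeGrad_ridgeStep (x : Euc d) :
    ‖ridgeGrad u a (ridgeStep u a h x)‖ ^ 2 ≤ 25 / 16 * ‖ridgeGrad u a x‖ ^ 2 ∧
      ‖ridgeGrad u a x‖ ^ 2 ≤ 16 / 9 * ‖ridgeGrad u a (ridgeStep u a h x)‖ ^ 2 := by
  have h1 := hr.norm_ridgeGrad_ridgeStep_sub_le h0 hL x
  have h2 := norm_le_norm_add_norm_sub' (ridgeGrad u a (ridgeStep u a h x)) (ridgeGrad u a x)
  have h3 := norm_le_norm_add_norm_sub (ridgeGrad u a (ridgeStep u a h x)) (ridgeGrad u a x)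
  have p1 := norm_nonneg (ridgeGrad u a x)
  have p2 := norm_nonneg (ridgeGrad u a (ridgeStep u a h x))
  constructor <;> nlinarith

lemma ridgePotential_ridgeStep (x : Euc d) :
    ridgePotential u a (ridgeStep u a h x) ≤ ridgePotential u a x - 7 / 8 * h * ‖ridgeGrad u a x‖ ^ 2 ∧
      ridgePotential u a x ≤ ridgePotential u a (ridgeStep u a h x)
        + 9 / 8 * h * ‖ridgeGrad u a x‖ ^ 2 := by
  have h1 := hr.abs_ridgePotential_add_sub_le x (-(h • ridgeGrad u a x))
  have e : x + -(h • ridgeGrad u a x) = ridgeStep u a h x := by unfold ridgeStep; abel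
  rw [e, inner_neg_left, inner_smul_left, real_inner_self_eq_norm_sq, map_neg, norm_neg, map_smul,
    norm_smul, mul_pow, Real.norm_eq_abs, sq_abs, conj_trivial] at h1
  have h2 := hr.norm_ridgeMap_le (ridgeGrad u a x)
  have h3 : n * ρ / 2 * (h ^ 2 * ‖ridgeMap a (ridgeGrad u a x)‖ ^ 2)
      ≤ 1 / 8 * h * ‖ridgeGrad u a x‖ ^ 2 := by
    have hs := hr.smooth_pos
    calc _ ≤ n * ρ / 2 * (h ^ 2 * ‖ridgeGrad u a x‖ ^ 2) := by gcongr
      _ = h * (n * ρ) * (h / 2 * ‖ridgeGrad u a x‖ ^ 2) := by ring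
      _ ≤ 1 / 4 * (h / 2 * ‖ridgeGrad u a x‖ ^ 2) := by gcongr
      _ = _ := by ring
  have h4 := abs_le.1 h1
  constructor <;> linarith [h4.1, h4.2]

/-- Upper bound on the image of the target measure under a gradient step. -/
lemma measure_ridgeStep_preimage_le {S : Set (Euc d)} (hS : MeasurableSet S) :
    targetMeasure (ridgePotential u a) (ridgeStep u a h ⁻¹' S)
      ≤ 2 * ∫⁻ x in S, ENNReal.ofReal (exp (-(h / 2 * ‖ridgeGrad u a x‖ ^ 2)))
        ∂(targetMeasure (ridgePotential u a)) := by
  have hf := hr.continuous_ridgePotential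
  have hg := hr.continuous_ridgeGrad
  have hF := (hr.continuous_ridgeStep h).measurable
  have hm : Measurable fun x => ENNReal.ofReal (exp (-(h / 2 * ‖ridgeGrad u a x‖ ^ 2))) := by
    fun_prop
  rw [← lintegral_indicator_one (hF hS), ← lintegral_indicator hS,
    lintegral_targetMeasure hf.measurable (measurable_one.indicator (hF hS)),
    lintegral_targetMeasure hf.measurable (hm.indicator hS), ← mul_assoc, mul_comm 2, mul_assoc]
  gcongr
  refine le_trans (lintegral_mono fun x => ?_) (hr.lintegral_comp_ridgeStep h0 hL fun y =>
    ENNReal.ofReal (exp (-ridgePotential u a y)) * S.indicator (fun x =>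
      ENNReal.ofReal (exp (-(h / 2 * ‖ridgeGrad u a x‖ ^ 2)))) y).1
  by_cases hx : ridgeStep u a h x ∈ S
  · rw [Set.indicator_of_mem hx, Set.indicator_of_mem (by exact hx), Pi.one_apply, mul_one,
      ← ENNReal.ofReal_mul (exp_pos _).le, ← exp_add]
    gcongr
    have h1 := (hr.ridgePotential_ridgeStep h0 hL x).1
    have h2 := (hr.norm_sq_ridgeGrad_ridgeStep h0 hL x).1
    nlinarith [mul_le_mul_of_nonneg_left h2 h0, mul_nonneg h0 (sq_nonneg ‖ridgeGrad u a x‖)]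
  · rw [Set.indicator_of_notMem (by exact hx)]
    simp

/-- Lower bound on the image of the target measure under a gradient step. -/
lemma le_measure_ridgeStep_preimage {S : Set (Euc d)} (hS : MeasurableSet S) :
    ∫⁻ x in S, ENNReal.ofReal (exp (-(2 * h * ‖ridgeGrad u a x‖ ^ 2)))
        ∂(targetMeasure (ridgePotential u a))
      ≤ 2 * targetMeasure (ridgePotential u a) (ridgeStep u a h ⁻¹' S) := by
  have hf := hr.continuous_ridgePotential
  have hg := hr.continuous_ridgeGrad
  have hF := (hr.continuous_ridgeStep h).measurable
  have hm : Measurable fun x => ENNReal.ofReal (exp (-(2 * h * ‖ridgeGrad u a x‖ ^ 2))) := by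
    fun_prop
  rw [← lintegral_indicator_one (hF hS), ← lintegral_indicator hS,
    lintegral_targetMeasure hf.measurable (measurable_one.indicator (hF hS)),
    lintegral_targetMeasure hf.measurable (hm.indicator hS), mul_left_comm]
  refine mul_le_mul' le_rfl ?_
  refine le_trans (hr.lintegral_comp_ridgeStep h0 hL fun y =>
    ENNReal.ofReal (exp (-ridgePotential u a y)) * S.indicator (fun x =>
      ENNReal.ofReal (exp (-(2 * h * ‖ridgeGrad u a x‖ ^ 2)))) y).2 ?_
  refine mul_le_mul' le_rfl (lintegral_mono fun x => ?_)
  by_cases hx : ridgeStep u a h x ∈ S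
  · rw [Set.indicator_of_mem hx, Set.indicator_of_mem (by exact hx), Pi.one_apply, mul_one,
      ← ENNReal.ofReal_mul (exp_pos _).le, ← exp_add]
    gcongr
    have h1 := (hr.ridgePotential_ridgeStep h0 hL x).2
    have h2 := (hr.norm_sq_ridgeGrad_ridgeStep h0 hL x).2
    nlinarith [mul_le_mul_of_nonneg_left h2 h0]
  · rw [Set.indicator_of_notMem hx]
    simp

omit h0 hL in
lemma lintegral_exp_norm_sq_ridgeGrad_le
    (hZ : IsProbabilityMeasure (targetMeasure (ridgePotential u a))) :
    ∫⁻ x, ENNReal.ofReal (exp (7 / 32 * (‖ridgeGrad u a x‖ ^ 2 / (n * ρ))))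
      ∂(targetMeasure (ridgePotential u a)) ≤ 2 := by
  have hf := hr.continuous_ridgePotential
  have hg := hr.continuous_ridgeGrad
  have hs := hr.smooth_pos
  have h0 : 0 ≤ 1 / (4 * (n * ρ)) := by positivity
  have hL : 1 / (4 * (n * ρ)) * (n * ρ) ≤ 1 / 4 := by
    rw [div_mul_eq_mul_div, one_mul, div_le_iff₀ (by positivity)]; linarith
  have h1 : ∫⁻ _x, (1 : ℝ≥0∞) ∂(targetMeasure (ridgePotential u a)) = 1 := by simp
  rw [lintegral_targetMeasure hf.measurable measurable_const] at h1
  rw [lintegral_targetMeasure hf.measurable (by fun_prop)]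
  have h2 := congrArg (fun r : ℝ≥0∞ => 2 * r) h1
  simp only [mul_one] at h2
  refine le_trans ?_ h2.le
  rw [mul_left_comm]
  refine mul_le_mul' le_rfl ?_
  refine le_trans (lintegral_mono fun x => ?_) (hr.lintegral_comp_ridgeStep h0 hL fun y =>
    ENNReal.ofReal (exp (-ridgePotential u a y))).1
  rw [← ENNReal.ofReal_mul (exp_pos _).le, ← exp_add]
  gcongr
  have h1 := (hr.ridgePotential_ridgeStep h0 hL x).1
  have e : 7 / 8 * (1 / (4 * (n * ρ))) * ‖ridgeGrad u a x‖ ^ 2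
      = 7 / 32 * (‖ridgeGrad u a x‖ ^ 2 / (n * ρ)) := by ring
  linarith

omit h0 hL in
/-- Subgaussian concentration of the gradient under the target measure. -/
lemma measureReal_lt_norm_sq_ridgeGrad_le
    (hZ : IsProbabilityMeasure (targetMeasure (ridgePotential u a))) (r : ℝ) :
    (targetMeasure (ridgePotential u a)).real {x | r * (n * ρ) < ‖ridgeGrad u a x‖ ^ 2}
      ≤ 2 * exp (-(7 / 32 * r)) := by
  have hg := hr.continuous_ridgeGrad
  have hs := hr.smooth_pos
  have h1 := mul_meas_ge_le_lintegral (μ := targetMeasure (ridgePotential u a))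
    (f := fun x => ENNReal.ofReal (exp (7 / 32 * (‖ridgeGrad u a x‖ ^ 2 / (n * ρ)))))
    (by fun_prop) (ENNReal.ofReal (exp (7 / 32 * r)))
  have h2 := h1.trans (hr.lintegral_exp_norm_sq_ridgeGrad_le hZ)
  have h3 := ENNReal.toReal_mono (by simp) h2
  rw [ENNReal.toReal_mul, ENNReal.toReal_ofReal (exp_pos _).le] at h3
  have h4 : (targetMeasure (ridgePotential u a)).real {x | r * (n * ρ) < ‖ridgeGrad u a x‖ ^ 2}
      ≤ (targetMeasure (ridgePotential u a)).real {x | ENNReal.ofReal (exp (7 / 32 * r))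
        ≤ ENNReal.ofReal (exp (7 / 32 * (‖ridgeGrad u a x‖ ^ 2 / (n * ρ))))} := by
    refine measureReal_mono fun x hx => ?_
    simp only [Set.mem_ofPred_eq] at hx ⊢
    gcongr
    rw [le_div_iff₀ hs]; exact hx.le
  rw [exp_neg, ← div_eq_mul_inv, le_div_iff₀ (exp_pos _), mul_comm]
  refine le_trans ?_ h3
  gcongr
  exact h4

omit h0 hL in
/-- Half of the upper tail mass survives a short translation, up to a constant. -/
lemma measureReal_le_translate
    (hZ : IsProbabilityMeasure (targetMeasure (ridgePotential u a))) {v : Euc d}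
    (hv : ‖v‖ ^ 2 * (n * ρ) ≤ 4) {A : Set (Euc d)} (hA : MeasurableSet A) :
    exp (-10) * ((targetMeasure (ridgePotential u a)).real {x | x + v ∈ A} - 1 / 8)
      ≤ (targetMeasure (ridgePotential u a)).real A := by
  have hf := hr.continuous_ridgePotential
  have hg := hr.continuous_ridgeGrad
  have hs := hr.smooth_pos
  set μ := targetMeasure (ridgePotential u a)
  set B : Set (Euc d) := {x | x + v ∈ A} with hB
  have hBm : MeasurableSet B := (measurable_add_const v) hA
  set C : Set (Euc d) := {x | 16 * (n * ρ) < ‖ridgeGrad u a x‖ ^ 2} with hC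
  have hCm : MeasurableSet C := (isOpen_lt (f := fun _ => 16 * (n * ρ))
    (g := fun x => ‖ridgeGrad u a x‖ ^ 2) (by fun_prop) (by fun_prop)).measurableSet
  have h1 : μ.real C ≤ 1 / 8 := by
    refine (hr.measureReal_lt_norm_sq_ridgeGrad_le hZ 16).trans ?_
    have : exp (-(7 / 32 * 16)) ≤ 1 / 16 := by
      rw [exp_neg, inv_le_comm₀ (exp_pos _) (by norm_num)]
      have e1 : exp (7 / 32 * 16) = exp 1 ^ 3 * exp (1 / 2) := by
        rw [← exp_nat_mul, ← exp_add]; norm_num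
      have e2 := exp_one_gt_d9
      have e3 := add_one_le_exp (1 / 2 : ℝ)
      rw [e1]
      calc ((1 : ℝ) / 16)⁻¹ ≤ 2.7 ^ 3 * (1 / 2 + 1) := by norm_num
        _ ≤ _ := by gcongr; linarith
    linarith
  have h2 : μ.real B - 1 / 8 ≤ μ.real (B \ C) := by
    have := measureReal_mono (μ := μ) (s₁ := B) (s₂ := C ∪ (B \ C)) (by intro x hx; by_cases h : x ∈ C <;> simp [h, hx])
    have h3 := measureReal_union_le (μ := μ) C (B \ C)
    linarith
  have hBC : MeasurableSet (B \ C) := hBm.diff hCm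
  have key : ENNReal.ofReal (exp (-10)) * μ (B \ C) ≤ μ A := by
    rw [← lintegral_indicator_one hA, ← lintegral_indicator_one hBC,
      lintegral_targetMeasure hf.measurable (measurable_one.indicator hA),
      lintegral_targetMeasure hf.measurable (measurable_one.indicator hBC), mul_left_comm]
    gcongr
    rw [← lintegral_const_mul' _ _ ENNReal.ofReal_ne_top]
    conv_rhs => rw [← lintegral_add_right_eq_self _ v]
    refine lintegral_mono fun x => ?_
    by_cases hx : x ∈ B \ C
    · have hxA : x + v ∈ A := hx.1
      rw [Set.indicator_of_mem hx, Set.indicator_of_mem hxA, Pi.one_apply, Pi.one_apply, mul_one,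
        mul_one, ← ENNReal.ofReal_mul (exp_pos _).le, ← exp_add]
      gcongr
      have hx2 : ‖ridgeGrad u a x‖ ^ 2 ≤ 16 * (n * ρ) := not_lt.1 hx.2
      have e1 := (abs_le.1 (hr.abs_ridgePotential_add_sub_le x v)).2
      have e2 := real_inner_le_norm v (ridgeGrad u a x)
      have e3 : ‖v‖ * ‖ridgeGrad u a x‖ ≤ 8 := by
        refine le_of_sq_le_sq ?_ (by norm_num)
        rw [mul_pow]
        calc ‖v‖ ^ 2 * ‖ridgeGrad u a x‖ ^ 2 ≤ ‖v‖ ^ 2 * (16 * (n * ρ)) := by gcongr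
          _ = ‖v‖ ^ 2 * (n * ρ) * 16 := by ring
          _ ≤ 4 * 16 := by gcongr
          _ = _ := by norm_num
      have e4 : n * ρ / 2 * ‖ridgeMap a v‖ ^ 2 ≤ 2 := by
        calc _ ≤ n * ρ / 2 * ‖v‖ ^ 2 := by gcongr; exact hr.norm_ridgeMap_le v
          _ = ‖v‖ ^ 2 * (n * ρ) / 2 := by ring
          _ ≤ _ := by linarith
      linarith
    · rw [Set.indicator_of_notMem hx]; simp
  have h3 := ENNReal.toReal_mono (measure_ne_top _ _) key
  rw [ENNReal.toReal_mul, ENNReal.toReal_ofReal (exp_pos _).le] at h3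
  refine le_trans ?_ h3
  gcongr
  exact h2

end IsRidge


lemma le_setDistance {α : Type*} [PseudoMetricSpace α] {S T : Set α} {r : ℝ} (hS : S.Nonempty)
    (hT : T.Nonempty) (h : ∀ x ∈ S, ∀ y ∈ T, r ≤ dist x y) : r ≤ setDistance S T := by
  obtain ⟨x, hx⟩ := hS
  obtain ⟨y, hy⟩ := hT
  refine le_csInf ⟨_, x, hx, y, hy, rfl⟩ ?_
  rintro _ ⟨x, hx, y, hy, rfl⟩
  exact h x hx y hy

/-- Cheeger's inequality for two separated sets. -/
lemma CheegerIso.le_measureReal_compl {d : ℕ} {μ : Measure (Euc d)} {ψ : ℝ} (hC : CheegerIso μ ψ)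
    (hψ : 0 ≤ ψ) {S T : Set (Euc d)} (hS : MeasurableSet S) (hT : MeasurableSet T)
    (hST : Disjoint S T) {r : ℝ} (h : ∀ x ∈ S, ∀ y ∈ T, r ≤ dist x y) :
    ψ * r * μ.real S * μ.real T ≤ μ.real (S ∪ T)ᶜ := by
  rcases S.eq_empty_or_nonempty with rfl | hS0
  · simp
  rcases T.eq_empty_or_nonempty with rfl | hT0
  · simp
  refine le_trans ?_ (hC S T (S ∪ T)ᶜ hS hT (hS.union hT).compl hST
    (disjoint_compl_right.mono_left Set.subset_union_left)
    (disjoint_compl_right.mono_left Set.subset_union_right) (Set.union_compl_self _))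
  have := le_setDistance hS0 hT0 h
  change ψ * r * μ.real S * μ.real T ≤ ψ * setDistance S T * μ.real S * μ.real T
  gcongr

/-- A real random variable has an approximate median on the grid of mesh `D`. -/
lemma exists_int_measureReal_lt_half {α : Type*} [MeasurableSpace α] (μ : Measure α)
    [IsProbabilityMeasure μ] {X : α → ℝ} (hX : Measurable X) {D : ℝ} (hD : 0 < D) :
    ∃ k : ℤ, μ.real {x | X x ≤ k * D} < 1 / 2 ∧ 1 / 2 ≤ μ.real {x | X x ≤ (k + 1) * D} := by
  have : IsProbabilityMeasure (μ.map X) := Measure.isProbabilityMeasure_map hX.aemeasurable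
  have hF : ∀ r, ProbabilityTheory.cdf (μ.map X) r = μ.real {x | X x ≤ r} := fun r => by
    rw [ProbabilityTheory.cdf_eq_real, map_measureReal_apply hX measurableSet_Iic]
    rfl
  have h1 := (ProbabilityTheory.tendsto_cdf_atBot (μ.map X)).eventually
    (gt_mem_nhds (show (0 : ℝ) < 1 / 2 by norm_num))
  have h2 := (ProbabilityTheory.tendsto_cdf_atTop (μ.map X)).eventually
    (lt_mem_nhds (show (1 / 2 : ℝ) < 1 by norm_num))
  obtain ⟨b, hb⟩ := Filter.eventually_atBot.1 h1
  obtain ⟨t, ht⟩ := Filter.eventually_atTop.1 h2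
  obtain ⟨m, hm, hmin⟩ := Int.exists_least_of_bdd
    (P := fun z : ℤ => 1 / 2 ≤ μ.real {x | X x ≤ z * D})
    ⟨⌊b / D⌋, fun z hz => by
      by_contra hlt
      push Not at hlt
      have h3 : (z : ℝ) * D ≤ b := by
        rw [← le_div_iff₀ hD]
        exact (Int.cast_le.2 hlt.le).trans (Int.floor_le _)
      have h4 := hb _ h3
      rw [hF] at h4
      linarith⟩
    ⟨⌈t / D⌉, by
      have h3 : t ≤ (⌈t / D⌉ : ℝ) * D := by
        rw [← div_le_iff₀ hD]; exact Int.le_ceil _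
      have h4 := ht _ h3
      rw [hF] at h4
      exact h4.le⟩
  refine ⟨m - 1, ?_, ?_⟩
  · by_contra hle
    have := hmin (m - 1) (not_lt.1 hle)
    omega
  · push_cast
    rw [sub_add_cancel]
    exact hm

namespace IsRidge

variable {d n : ℕ} {u : Fin n → ℝ → ℝ} {a : Fin n → Euc d} {ρ : ℝ} (hr : IsRidge u a ρ)
include hr

/-- The Cheeger coefficient of a ridge separable target is at most of order `√L`. -/
lemma cheeger_le (hZ : IsProbabilityMeasure (targetMeasure (ridgePotential u a))) {ψ : ℝ}
    (hψ : 0 ≤ ψ) (hC : CheegerIso (targetMeasure (ridgePotential u a)) ψ) :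
    ψ ≤ 6 * exp 10 * √(n * ρ) := by
  have hs := hr.smooth_pos
  set μ := targetMeasure (ridgePotential u a)
  set e : Euc d := a ⟨0, hr.card_pos⟩ with he
  have he1 : ‖e‖ = 1 := hr.norm_eq_one _
  set D : ℝ := 1 / √(n * ρ) with hD
  have hsq : 0 < √(n * ρ) := sqrt_pos.2 hs
  have hD0 : 0 < D := by positivity
  have hX : Continuous fun x : Euc d => ⟪e, x⟫ := by fun_prop
  obtain ⟨k, hk1, hk2⟩ := exists_int_measureReal_lt_half μ hX.measurable hD0
  have hm1 : MeasurableSet {x : Euc d | ⟪e, x⟫ ≤ k * D} :=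
    (isClosed_le (f := fun x : Euc d => ⟪e, x⟫) (g := fun _ => k * D) hX
      continuous_const).measurableSet
  have hm2 : MeasurableSet {x : Euc d | ⟪e, x⟫ ≤ (k + 1) * D} :=
    (isClosed_le (f := fun x : Euc d => ⟪e, x⟫) (g := fun _ => (k + 1) * D) hX
      continuous_const).measurableSet
  have hm3 : MeasurableSet {x : Euc d | (k + 2) * D < ⟪e, x⟫} :=
    (isOpen_lt (f := fun _ : Euc d => (k + 2) * D) (g := fun x : Euc d => ⟪e, x⟫)
      continuous_const hX).measurableSet
  have hv : ‖(2 * D) • e‖ ^ 2 * (n * ρ) ≤ 4 := by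
    rw [norm_smul, he1, mul_one, Real.norm_of_nonneg (by positivity), hD, mul_pow, div_pow,
      sq_sqrt hs.le]
    apply le_of_eq
    rw [mul_assoc, div_mul_cancel₀ _ hs.ne']
    norm_num
  have h1 := hr.measureReal_le_translate hZ hv hm3
  have h2 : 1 / 2 ≤ μ.real {x | x + (2 * D) • e ∈ {x : Euc d | (k + 2) * D < ⟪e, x⟫}} := by
    have e1 : {x | x + (2 * D) • e ∈ {x : Euc d | (k + 2) * D < ⟪e, x⟫}}
        = {x : Euc d | ⟪e, x⟫ ≤ k * D}ᶜ := by
      ext x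
      simp only [Set.mem_ofPred_eq, Set.mem_compl_iff, not_le, inner_add_right, inner_smul_right,
        real_inner_self_eq_norm_sq, he1]
      constructor <;> intro h <;> linarith
    rw [e1, probReal_compl_eq_one_sub hm1]
    linarith
  have h3 : exp (-10) * (3 / 8) ≤ μ.real {x : Euc d | (k + 2) * D < ⟪e, x⟫} := by
    refine le_trans ?_ h1
    gcongr
    linarith
  have h4 := hC.le_measureReal_compl hψ hm2 hm3 (r := D)
    (Set.disjoint_left.2 fun x hx hx' => by
      simp only [Set.mem_ofPred_eq] at hx hx'
      nlinarith)
    (fun x hx y hy => by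
      simp only [Set.mem_ofPred_eq] at hx hy
      have h5 := real_inner_le_norm e (y - x)
      rw [inner_sub_right, he1, one_mul, ← dist_eq_norm, dist_comm] at h5
      linarith)
  have h5 : ψ * D * (1 / 2) * (exp (-10) * (3 / 8)) ≤ 1 := by
    refine le_trans ?_ (h4.trans measureReal_le_one)
    gcongr
  rw [exp_neg, hD] at h5
  have hE := exp_pos (10 : ℝ)
  have h6 : ψ * (3 / 16) ≤ exp 10 * √(n * ρ) := by
    have e : ψ * (1 / √(n * ρ)) * (1 / 2) * ((exp 10)⁻¹ * (3 / 8))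
        = ψ * (3 / 16) / (exp 10 * √(n * ρ)) := by field_simp; ring
    rw [e, div_le_one (by positivity)] at h5
    exact h5
  have : 0 < exp 10 * √(n * ρ) := by positivity
  nlinarith

end IsRidge


/-- Momenta of controlled size that lead the leapfrog proposal from `x` into `B`. -/
noncomputable def proposalSet {d n : ℕ} (u : Fin n → ℝ → ℝ) (a : Fin n → Euc d) (η : ℝ) (K : ℕ)
    (B : Set (Euc d)) (x : Euc d) : Set (Euc d) :=
  {p | ‖ridgeMap a p‖ ≤ 6 ∧ (leapfrog (ridgePotential u a) η K (x, p)).1 ∈ B}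

namespace IsRidge

variable {d n : ℕ} {u : Fin n → ℝ → ℝ} {a : Fin n → Euc d} {ρ : ℝ} (hr : IsRidge u a ρ)
include hr

lemma measurable_gradient : Measurable (gradient (ridgePotential u a)) := by
  rw [hr.gradient_eq]; exact hr.continuous_ridgeGrad.measurable

lemma measurableSet_uncurry_proposalSet (η : ℝ) (K : ℕ) {B : Set (Euc d)}
    (hB : MeasurableSet B) :
    MeasurableSet {z : Euc d × Euc d | z.2 ∈ proposalSet u a η K B z.1} := by
  have h1 : MeasurableSet {z : Euc d × Euc d | ‖ridgeMap a z.2‖ ≤ 6} := by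
    have : Continuous (ridgeMap a) := (ridgeMap a).continuous_of_finiteDimensional
    exact (isClosed_le (f := fun z : Euc d × Euc d => ‖ridgeMap a z.2‖) (g := fun _ => (6 : ℝ))
      (by fun_prop) continuous_const).measurableSet
  exact h1.inter ((measurable_leapfrog hr.measurable_gradient η K).fst hB)

lemma measurable_measure_proposalSet (η : ℝ) (K : ℕ) {B : Set (Euc d)} (hB : MeasurableSet B) :
    Measurable fun x => (stdGaussian d).real (proposalSet u a η K B x) :=
  (measurable_measure_prodMk_left
    (hr.measurableSet_uncurry_proposalSet η K hB)).ennreal_toReal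

/-- Lower bound on the acceptance probability for momenta of controlled size. -/
lemma le_accProb {η h : ℝ} (hη : 0 ≤ η) {K : ℕ} (hK : (K + 1) * η * √(n * ρ) ≤ 1 / 4)
    (hh : 64 * K * η ^ 2 ≤ h / 2) (hL : h * (n * ρ) ≤ 1 / 4) {x p : Euc d}
    (hp : ‖ridgeMap a p‖ ≤ 6) :
    exp (-5) * exp (-(h / 2 * ‖ridgeGrad u a x‖ ^ 2))
      ≤ accProb (ridgePotential u a) K η x p := by
  have hs := hr.smooth_pos
  have h0 : 0 ≤ h := by
    have : 0 ≤ 64 * K * η ^ 2 := by positivity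
    linarith
  have h1 := hr.abs_hamiltonian_leapfrog_sub_le hη hK x p
  have h2 : ‖ridgeMap a p‖ ^ 2 ≤ 36 := by nlinarith [norm_nonneg (ridgeMap a p)]
  have h3 : 64 * K * η ^ 2 * (‖ridgeGrad u a x‖ ^ 2 + n * ρ * ‖ridgeMap a p‖ ^ 2)
      ≤ h / 2 * ‖ridgeGrad u a x‖ ^ 2 + 5 := by
    calc _ ≤ h / 2 * (‖ridgeGrad u a x‖ ^ 2 + n * ρ * 36) := by gcongr
      _ = h / 2 * ‖ridgeGrad u a x‖ ^ 2 + 18 * (h * (n * ρ)) := by ring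
      _ ≤ _ := by linarith
  have h4 := (abs_le.1 (h1.trans h3)).2
  simp only [hamiltonian] at h4
  rw [← exp_add, accProb]
  refine le_min ?_ ?_
  · rw [exp_le_one_iff]
    have : 0 ≤ h / 2 * ‖ridgeGrad u a x‖ ^ 2 := by positivity
    linarith
  · exact exp_le_exp.2 (by linarith)

/-- Flow out of a set from which the proposal leads into `B` with probability at least `κ`. -/
lemma le_hmcFlow {η h κ : ℝ} (hη : 0 ≤ η) {K : ℕ} (hK : (K + 1) * η * √(n * ρ) ≤ 1 / 4)
    (hh : 64 * K * η ^ 2 ≤ h / 2) (hL : h * (n * ρ) ≤ 1 / 4) {Q S B : Set (Euc d)}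
    (hκ : 0 ≤ κ)
    (hQ : MeasurableSet Q) (hB : MeasurableSet B) (hS : MeasurableSet S) (hQS : Q ⊆ S)
    (hQκ : ∀ x ∈ Q, κ ≤ (stdGaussian d).real (proposalSet u a η K B x)) :
    ENNReal.ofReal (κ * exp (-5)) *
        targetMeasure (ridgePotential u a) (ridgeStep u a h ⁻¹' Q)
      ≤ 2 * hmcFlow (ridgePotential u a) K η (S ×ˢ B) := by
  have hf := hr.continuous_ridgePotential
  have hgr := hr.continuous_ridgeGrad
  have hg := hr.measurable_gradient
  have hE := hr.measurableSet_uncurry_proposalSet η K hB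
  have h0 : 0 ≤ h := by
    have : 0 ≤ 64 * K * η ^ 2 := by positivity
    linarith
  have hT : Measurable fun z : Euc d × Euc d =>
    (leapfrog (ridgePotential u a) η K z).1 := (measurable_leapfrog hg η K).fst
  have hacc := measurable_accProb hf.measurable hg K η
  set μ := targetMeasure (ridgePotential u a)
  set w : Euc d → ℝ≥0∞ :=
    fun x => ENNReal.ofReal (exp (-(h / 2 * ‖ridgeGrad u a x‖ ^ 2))) with hw
  have hwm : Measurable w := by fun_prop
  have hflow : hmcFlow (ridgePotential u a) K η (S ×ˢ B)
      = ∫⁻ x, ∫⁻ p, (S ×ˢ B).indicator 1 (x, (leapfrog (ridgePotential u a) η K (x, p)).1)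
          * ENNReal.ofReal (accProb (ridgePotential u a) K η x p) ∂(stdGaussian d) ∂μ := by
    have hm : Measurable fun z : Euc d × Euc d => (z.1, (leapfrog (ridgePotential u a) η K z).1) :=
      measurable_fst.prodMk hT
    have hi : Measurable ((S ×ˢ B).indicator (1 : Euc d × Euc d → ℝ≥0∞)) :=
      measurable_one.indicator (hS.prod hB)
    rw [← lintegral_indicator_one (hS.prod hB), hmcFlow, acceptedFlow, lintegral_map hi hm,
      lintegral_withDensity_eq_lintegral_mul _ hacc.ennreal_ofReal
        (g := fun z => (S ×ˢ B).indicator 1 (z.1, (leapfrog (ridgePotential u a) η K z).1))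
        (hi.comp hm),
      lintegral_prod _ (by exact ((hacc.ennreal_ofReal).mul (hi.comp hm)).aemeasurable)]
    refine lintegral_congr fun x => lintegral_congr fun p => ?_
    simp only [Pi.mul_apply]
    rw [mul_comm]
  have hlow : ∫⁻ x, Q.indicator w x * ENNReal.ofReal (κ * exp (-5)) ∂μ
      ≤ hmcFlow (ridgePotential u a) K η (S ×ˢ B) := by
    rw [hflow]
    refine lintegral_mono fun x => ?_
    by_cases hx : x ∈ Q
    · have hEx : MeasurableSet (proposalSet u a η K B x) := measurable_prodMk_left hE
      have h1 : ENNReal.ofReal κ ≤ stdGaussian d (proposalSet u a η K B x) :=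
        (ENNReal.ofReal_le_ofReal (hQκ x hx)).trans ENNReal.ofReal_toReal_le
      calc Q.indicator w x * ENNReal.ofReal (κ * exp (-5))
          = w x * ENNReal.ofReal (exp (-5)) * ENNReal.ofReal κ := by
            rw [Set.indicator_of_mem hx, ENNReal.ofReal_mul hκ]; ring
        _ ≤ w x * ENNReal.ofReal (exp (-5)) * stdGaussian d (proposalSet u a η K B x) := by
            gcongr
        _ = ∫⁻ p, (proposalSet u a η K B x).indicator (fun _ => w x * ENNReal.ofReal (exp (-5))) p
              ∂(stdGaussian d) := by rw [lintegral_indicator_const hEx]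
        _ ≤ _ := by
            refine lintegral_mono fun p => ?_
            by_cases hp : p ∈ proposalSet u a η K B x
            · have hmem : (x, (leapfrog (ridgePotential u a) η K (x, p)).1) ∈ S ×ˢ B :=
                ⟨hQS hx, hp.2⟩
              rw [Set.indicator_of_mem hp, Set.indicator_of_mem hmem, Pi.one_apply, one_mul, hw,
                ← ENNReal.ofReal_mul (exp_pos _).le, mul_comm]
              exact ENNReal.ofReal_le_ofReal (hr.le_accProb hη hK hh hL hp.1)
            · rw [Set.indicator_of_notMem hp]; exact zero_le
    · rw [Set.indicator_of_notMem hx, zero_mul]; exact zero_le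
  rw [lintegral_mul_const _ (hwm.indicator hQ), lintegral_indicator hQ] at hlow
  calc _ ≤ ENNReal.ofReal (κ * exp (-5)) * (2 * ∫⁻ x in Q, w x ∂μ) := by
        gcongr; exact hr.measure_ridgeStep_preimage_le h0 hL hQ
    _ = 2 * ((∫⁻ x in Q, w x ∂μ) * ENNReal.ofReal (κ * exp (-5))) := by ring
    _ ≤ _ := by gcongr

/-- Conductance of Metropolized HMC with respect to the image of the target measure under a
gradient step. -/
lemma mul_le_hmcFlow (hZ : IsProbabilityMeasure (targetMeasure (ridgePotential u a))) {ψ : ℝ}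
    (hψ : 0 ≤ ψ) (hC : CheegerIso (targetMeasure (ridgePotential u a)) ψ)
    {η h : ℝ} (hη : 0 < η) {K : ℕ} (hK0 : 0 < K) (hK : (K + 1) * η * √(n * ρ) ≤ 1 / 4)
    (hK' : n * ρ * (K * η) ^ 2 ≤ 1 / 64)
    (hh : 64 * K * η ^ 2 ≤ h / 2) (hL : h * (n * ρ) ≤ 1 / 4) {S : Set (Euc d)}
    (hS : MeasurableSet S) :
    min (ψ * (K * η / 2)) 1 *
        ((targetMeasure (ridgePotential u a)).real (ridgeStep u a h ⁻¹' S) *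
          (targetMeasure (ridgePotential u a)).real (ridgeStep u a h ⁻¹' Sᶜ))
      ≤ 96 * exp 12 * (hmcFlow (ridgePotential u a) K η).real (S ×ˢ Sᶜ) := by
  have h0 : 0 ≤ h := by
    have : 0 ≤ 64 * K * η ^ 2 := by positivity
    linarith
  have hf := hr.continuous_ridgePotential
  have hg := hr.measurable_gradient
  have hF := (hr.continuous_ridgeStep h).measurable
  have hT : Measurable fun z : Euc d × Euc d =>
    (leapfrog (ridgePotential u a) η K z).1 := (measurable_leapfrog hg η K).fst
  have hfin : IsFiniteMeasure (hmcFlow (ridgePotential u a) K η) :=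
    isFiniteMeasure_acceptedFlow hT fun z => accProb_le_one _ K η z.1 z.2
  set μ := targetMeasure (ridgePotential u a) with hμ
  set Fl := hmcFlow (ridgePotential u a) K η with hFl
  set κ : ℝ := exp (-7) / 16 with hκ
  have hκ0 : 0 < κ := by positivity
  have hswap : Fl (Sᶜ ×ˢ S) = Fl (S ×ˢ Sᶜ) := by
    have h1 := map_swap_hmcFlow hf.measurable hg hZ K η
    rw [← hFl] at h1
    conv_lhs => rw [← h1]
    rw [Measure.map_apply measurable_swap (hS.compl.prod hS), Set.preimage_swap_prod]
  have hm1 := hr.measurable_measure_proposalSet η K hS.compl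
  have hm2 := hr.measurable_measure_proposalSet η K hS
  set Q1 : Set (Euc d) := S ∩
    (fun x => (stdGaussian d).real (proposalSet u a η K Sᶜ x)) ⁻¹' Set.Ici κ with hQ1
  set Q2 : Set (Euc d) := Sᶜ ∩
    (fun x => (stdGaussian d).real (proposalSet u a η K S x)) ⁻¹' Set.Ici κ with hQ2
  have hQ1m : MeasurableSet Q1 := hS.inter (hm1 measurableSet_Ici)
  have hQ2m : MeasurableSet Q2 := hS.compl.inter (hm2 measurableSet_Ici)
  have real_le : ∀ {Q : Set (Euc d)}, ENNReal.ofReal (κ * exp (-5)) * μ (ridgeStep u a h ⁻¹' Q)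
      ≤ 2 * Fl (S ×ˢ Sᶜ) → μ.real (ridgeStep u a h ⁻¹' Q) ≤ 32 * exp 12 * Fl.real (S ×ˢ Sᶜ) := by
    intro Q hQ
    have h1 := ENNReal.toReal_mono (ENNReal.mul_ne_top (by simp) (measure_ne_top _ _)) hQ
    rw [ENNReal.toReal_mul, ENNReal.toReal_mul, ENNReal.toReal_ofReal (by positivity)] at h1
    have h2 : κ * exp (-5) = (16 * exp 12)⁻¹ := by
      rw [hκ, div_mul_eq_mul_div, ← exp_add, mul_inv, ← exp_neg]; norm_num; ring
    rw [h2, inv_mul_le_iff₀ (by positivity)] at h1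
    calc _ ≤ _ := h1
      _ = _ := by simp only [ENNReal.toReal_ofNat]; unfold Measure.real; ring
  have b1 := real_le (hr.le_hmcFlow hη.le hK hh hL hκ0.le hQ1m hS.compl hS Set.inter_subset_left
    fun x hx => hx.2)
  have b2 := real_le (Q := Q2) (by
    have := hr.le_hmcFlow hη.le hK hh hL hκ0.le hQ2m hS hS.compl Set.inter_subset_left
      fun x hx => hx.2
    rwa [← hFl, hswap] at this)
  have iso := hC.le_measureReal_compl hψ (S := ridgeStep u a h ⁻¹' (S \ Q1))
    (T := ridgeStep u a h ⁻¹' (Sᶜ \ Q2)) (hF (hS.diff hQ1m)) (hF (hS.compl.diff hQ2m))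
    (Disjoint.preimage _ (disjoint_compl_right.mono Set.sdiff_subset Set.sdiff_subset))
    (r := K * η / 2) (by
      intro x hx y hy
      by_contra hlt
      push Not at hlt
      have h1 := hr.norm_ridgeStep_sub_le h0 hL x y
      rw [dist_eq_norm] at hlt
      have h2 : ‖ridgeStep u a h x - ridgeStep u a h y‖ ≤ K * η := by
        have : 0 ≤ K * η := by positivity
        linarith
      have hx1 : ridgeStep u a h x ∈ S := hx.1
      have hy1 : ridgeStep u a h y ∈ Sᶜ := hy.1
      rcases hr.le_proposal_or_le_proposal hη hK0 hK' h2 hS with h3 | h3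
      · exact hx.2 ⟨hx1, h3⟩
      · exact hy.2 ⟨hy1, h3⟩)
  have hsub : μ.real (ridgeStep u a h ⁻¹' (S \ Q1) ∪ ridgeStep u a h ⁻¹' (Sᶜ \ Q2))ᶜ
      ≤ μ.real (ridgeStep u a h ⁻¹' Q1) + μ.real (ridgeStep u a h ⁻¹' Q2) := by
    refine (measureReal_mono fun x hx => ?_).trans (measureReal_union_le _ _)
    by_contra hx'
    apply hx
    simp only [Set.mem_union, Set.mem_preimage, not_or] at hx'
    by_cases hxS : ridgeStep u a h x ∈ S
    · exact Or.inl ⟨hxS, hx'.1⟩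
    · exact Or.inr ⟨hxS, hx'.2⟩
  have hd1 : μ.real (ridgeStep u a h ⁻¹' (S \ Q1))
      = μ.real (ridgeStep u a h ⁻¹' S) - μ.real (ridgeStep u a h ⁻¹' Q1) := by
    rw [Set.preimage_sdiff]
    exact measureReal_sdiff (Set.preimage_mono Set.inter_subset_left) (hF hQ1m)
  have hd2 : μ.real (ridgeStep u a h ⁻¹' (Sᶜ \ Q2))
      = μ.real (ridgeStep u a h ⁻¹' Sᶜ) - μ.real (ridgeStep u a h ⁻¹' Q2) := by
    rw [Set.preimage_sdiff]
    exact measureReal_sdiff (Set.preimage_mono Set.inter_subset_left) (hF hQ2m)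
  rw [hd1, hd2] at iso
  have hsum : μ.real (ridgeStep u a h ⁻¹' S) + μ.real (ridgeStep u a h ⁻¹' Sᶜ) = 1 := by
    have := probReal_compl_eq_one_sub (μ := μ) (hF hS)
    rw [Set.preimage_compl, this]; ring
  have hA0 : 0 ≤ μ.real (ridgeStep u a h ⁻¹' S) := measureReal_nonneg
  have hB0 : 0 ≤ μ.real (ridgeStep u a h ⁻¹' Sᶜ) := measureReal_nonneg
  set A := μ.real (ridgeStep u a h ⁻¹' S)
  set B := μ.real (ridgeStep u a h ⁻¹' Sᶜ)
  set x := μ.real (ridgeStep u a h ⁻¹' Q1)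
  set y := μ.real (ridgeStep u a h ⁻¹' Q2)
  have hfl0 : 0 ≤ Fl.real (S ×ˢ Sᶜ) := measureReal_nonneg
  set z := 32 * exp 12 * Fl.real (S ×ˢ Sᶜ) with hz
  have hz0 : 0 ≤ z := by positivity
  set β := min (ψ * (K * η / 2)) 1 with hβ
  have hβ0 : 0 ≤ β := le_min (by positivity) zero_le_one
  have hβ1 : β ≤ 1 := min_le_right _ _
  have goal : β * (A * B) ≤ 3 * z := by
    have hAB : A * B ≤ A := by nlinarith
    have hAB' : A * B ≤ B := by nlinarith
    have hAB0 : 0 ≤ A * B := by positivity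
    have hle : β * (A * B) ≤ A * B := mul_le_of_le_one_left hAB0 hβ1
    rcases le_or_gt A z with h1 | h1
    · linarith
    rcases le_or_gt B z with h2 | h2
    · linarith
    have h3 : β * ((A - z) * (B - z)) ≤ 2 * z := by
      calc β * ((A - z) * (B - z)) ≤ ψ * (K * η / 2) * ((A - x) * (B - y)) := by
            refine mul_le_mul (min_le_left _ _) ?_ ?_ (by positivity)
            · refine mul_le_mul ?_ ?_ ?_ ?_ <;> linarith
            · exact mul_nonneg (by linarith) (by linarith)
        _ ≤ 2 * z := by linarith
    have h4 : (A - z) * (B - z) = A * B - z + z ^ 2 := by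
      linear_combination (-z) * hsum
    rw [h4] at h3
    nlinarith [mul_nonneg hβ0 (sq_nonneg z), mul_le_of_le_one_left hz0 hβ1]
  calc _ ≤ 3 * z := goal
    _ = _ := by rw [hz]; ring

/-- The image of the target measure under a short gradient step dominates a multiple of the target
measure, up to a small additive error. -/
lemma le_measureReal_ridgeStep_preimage
    (hZ : IsProbabilityMeasure (targetMeasure (ridgePotential u a))) {h r : ℝ} (h0 : 0 ≤ h)
    (hL : h * (n * ρ) ≤ 1 / 4) (hr8 : h * (r * (n * ρ)) ≤ 8) {S : Set (Euc d)}
    (hS : MeasurableSet S) :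
    exp (-16) / 2 * ((targetMeasure (ridgePotential u a)).real S - 2 * exp (-(7 / 32 * r)))
      ≤ (targetMeasure (ridgePotential u a)).real (ridgeStep u a h ⁻¹' S) := by
  have hg := hr.continuous_ridgeGrad
  have htail := hr.measureReal_lt_norm_sq_ridgeGrad_le hZ r
  have h1 := hr.le_measure_ridgeStep_preimage h0 hL hS
  set μ := targetMeasure (ridgePotential u a)
  set C : Set (Euc d) := {x | r * (n * ρ) < ‖ridgeGrad u a x‖ ^ 2} with hC
  have hCm : MeasurableSet C := (isOpen_lt (f := fun _ => r * (n * ρ))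
    (g := fun x => ‖ridgeGrad u a x‖ ^ 2) (by fun_prop) (by fun_prop)).measurableSet
  have h2 : μ.real S - 2 * exp (-(7 / 32 * r)) ≤ μ.real (S \ C) := by
    have h3 := le_measureReal_sdiff (μ := μ) (s₁ := S) (s₂ := C)
    linarith
  have h3 : ENNReal.ofReal (exp (-16)) * μ (S \ C)
      ≤ 2 * μ (ridgeStep u a h ⁻¹' S) := by
    refine le_trans ?_ h1
    rw [← lintegral_indicator_const (hS.diff hCm), ← lintegral_indicator hS]
    refine lintegral_mono fun x => ?_
    by_cases hx : x ∈ S \ C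
    · rw [Set.indicator_of_mem hx, Set.indicator_of_mem hx.1]
      gcongr
      have h4 : ‖ridgeGrad u a x‖ ^ 2 ≤ r * (n * ρ) := not_lt.1 hx.2
      have := mul_le_mul_of_nonneg_left h4 h0
      linarith
    · rw [Set.indicator_of_notMem hx]; exact zero_le
  have h4 := ENNReal.toReal_mono (ENNReal.mul_ne_top (by simp) (measure_ne_top _ _)) h3
  rw [ENNReal.toReal_mul, ENNReal.toReal_mul, ENNReal.toReal_ofReal (by positivity),
    ENNReal.toReal_ofNat] at h4
  have h5 : exp (-16) * (μ.real S - 2 * exp (-(7 / 32 * r))) ≤ exp (-16) * μ.real (S \ C) := by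
    gcongr
  have h6 : exp (-16) * μ.real (S \ C) ≤ 2 * μ.real (ridgeStep u a h ⁻¹' S) := h4
  linarith

/-- Conductance of Metropolized HMC, up to a small additive error. -/
lemma mul_sub_le_hmcFlow (hZ : IsProbabilityMeasure (targetMeasure (ridgePotential u a))) {ψ : ℝ}
    (hψ : 0 ≤ ψ) (hC : CheegerIso (targetMeasure (ridgePotential u a)) ψ)
    {η h r : ℝ} (hη : 0 < η) {K : ℕ} (hK0 : 0 < K) (hK : (K + 1) * η * √(n * ρ) ≤ 1 / 4)
    (hK' : n * ρ * (K * η) ^ 2 ≤ 1 / 64)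
    (hh : 64 * K * η ^ 2 ≤ h / 2) (hL : h * (n * ρ) ≤ 1 / 4) (hr8 : h * (r * (n * ρ)) ≤ 8)
    {S : Set (Euc d)} (hS : MeasurableSet S) :
    min (ψ * (K * η / 2)) 1 / (384 * exp 44) *
        ((targetMeasure (ridgePotential u a)).real S * (targetMeasure (ridgePotential u a)).real Sᶜ
          - 2 * exp (-(7 / 32 * r)))
      ≤ (hmcFlow (ridgePotential u a) K η).real (S ×ˢ Sᶜ) := by
  have h0 : 0 ≤ h := by
    have : 0 ≤ 64 * K * η ^ 2 := by positivity
    linarith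
  have h1 := hr.mul_le_hmcFlow hZ hψ hC hη hK0 hK hK' hh hL hS
  have h2 := hr.le_measureReal_ridgeStep_preimage hZ h0 hL hr8 hS
  have h3 := hr.le_measureReal_ridgeStep_preimage hZ h0 hL hr8 hS.compl
  set μ := targetMeasure (ridgePotential u a)
  have hsum : μ.real Sᶜ = 1 - μ.real S := probReal_compl_eq_one_sub hS
  have hA0 : 0 ≤ μ.real S := measureReal_nonneg
  have hA1 : μ.real S ≤ 1 := measureReal_le_one
  have hν0 : 0 ≤ μ.real (ridgeStep u a h ⁻¹' S) := measureReal_nonneg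
  set s := 2 * exp (-(7 / 32 * r)) with hs
  have hs0 : 0 < s := by positivity
  have hfl0 : 0 ≤ (hmcFlow (ridgePotential u a) K η).real (S ×ˢ Sᶜ) := measureReal_nonneg
  set β := min (ψ * (K * η / 2)) 1 with hβ
  have hβ0 : 0 ≤ β := le_min (by positivity) zero_le_one
  rw [hsum] at h3 ⊢
  set m := μ.real S
  rcases le_or_gt (m * (1 - m) - s) 0 with h4 | h4
  · exact (mul_nonpos_of_nonneg_of_nonpos (by positivity) h4).trans hfl0
  have hm1 : 0 ≤ m - s := by nlinarith
  have hm2 : 0 ≤ 1 - m - s := by nlinarith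
  have hE := exp_pos (-16 : ℝ)
  have h5 : exp (-16) / 2 * (m - s) * (exp (-16) / 2 * (1 - m - s))
      ≤ μ.real (ridgeStep u a h ⁻¹' S) * μ.real (ridgeStep u a h ⁻¹' Sᶜ) :=
    mul_le_mul h2 h3 (by positivity) hν0
  have h6 : exp (-32) / 4 * (m * (1 - m) - s)
      ≤ exp (-16) / 2 * (m - s) * (exp (-16) / 2 * (1 - m - s)) := by
    have e : exp (-32 : ℝ) = exp (-16) * exp (-16) := by rw [← exp_add]; norm_num
    rw [e]
    have : exp (-16) / 2 * (m - s) * (exp (-16) / 2 * (1 - m - s))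
      = exp (-16) * exp (-16) / 4 * (m * (1 - m) - s + s ^ 2) := by ring
    rw [this]
    gcongr
    nlinarith
  have h7 : β * (exp (-32) / 4 * (m * (1 - m) - s))
      ≤ 96 * exp 12 * (hmcFlow (ridgePotential u a) K η).real (S ×ˢ Sᶜ) :=
    le_trans (mul_le_mul_of_nonneg_left (h6.trans h5) hβ0) h1
  have e1 : exp (-32 : ℝ) = (exp 32)⁻¹ := exp_neg _
  have e2 : exp (44 : ℝ) = exp 12 * exp 32 := by rw [← exp_add]; norm_num
  have hE1 := exp_pos (12 : ℝ)
  have hE2 := exp_pos (32 : ℝ)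
  calc _ = β * (exp (-32) / 4 * (m * (1 - m) - s)) / (96 * exp 12) := by
        rw [e1, e2]; field_simp; ring
    _ ≤ _ := by rw [div_le_iff₀ (by positivity)]; linarith

end IsRidge


lemma Warm.tvDist_le {α : Type*} [MeasurableSpace α] {μ₀ μ : Measure α} [IsProbabilityMeasure μ₀]
    [IsProbabilityMeasure μ] {M : ℝ} (hM : 1 ≤ M) (hw : Warm μ₀ μ M) :
    tvDist μ₀ μ ≤ 1 - 1 / M := by
  have hM0 : 0 < M := by linarith
  have key : ∀ A, MeasurableSet A → μ₀.real A - μ.real A ≤ 1 - 1 / M := by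
    intro A hA
    have h1 := ENNReal.toReal_mono (ENNReal.mul_ne_top (by simp) (measure_ne_top _ _)) (hw A hA)
    rw [ENNReal.toReal_mul, ENNReal.toReal_ofReal hM0.le] at h1
    have h2 : μ₀.real A ≤ M * μ.real A := h1
    have h3 : μ₀.real A ≤ 1 := measureReal_le_one
    have h4 : μ₀.real A / M ≤ μ.real A := by rw [div_le_iff₀ hM0]; linarith
    have h5 : 0 ≤ 1 - 1 / M := by
      rw [sub_nonneg, div_le_one hM0]; exact hM
    have h6 : μ₀.real A * (1 - 1 / M) ≤ 1 * (1 - 1 / M) := by gcongr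
    have h7 : μ₀.real A * (1 - 1 / M) = μ₀.real A - μ₀.real A / M := by ring
    linarith
  refine csSup_le ⟨_, ∅, MeasurableSet.empty, rfl⟩ ?_
  rintro _ ⟨A, hA, rfl⟩
  refine abs_le.2 ⟨?_, key A hA⟩
  have h1 := key Aᶜ hA.compl
  rw [probReal_compl_eq_one_sub hA, probReal_compl_eq_one_sub hA] at h1
  change -(1 - 1 / M) ≤ μ₀.real A - μ.real A
  linarith

lemma mixingTime_eq_zero {d : ℕ} {f : Euc d → ℝ} [IsProbabilityMeasure (targetMeasure f)]
    {μ₀ : Measure (Euc d)} [IsProbabilityMeasure μ₀] {M ε : ℝ} (hM : 1 ≤ M)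
    (hw : Warm μ₀ (targetMeasure f) M) (hε : 1 - 1 / M ≤ ε) (K : ℕ) (η : ℝ) :
    mixingTime f K η μ₀ ε = 0 :=
  Nat.sInf_eq_zero.2 (Or.inl ((hw.tvDist_le hM).trans hε))

lemma one_le_log_div {M ε : ℝ} (hM : 1 ≤ M) (hε : 0 < ε) (h : ε < 1 - 1 / M) :
    1 ≤ log (M / ε) := by
  have hM0 : 0 < M := by linarith
  have h1 : 4 ≤ M / ε := by
    rw [le_div_iff₀ hε]
    have h2 : M * ε ≤ M * (1 - 1 / M) := by gcongr
    have h3 : M * (1 - 1 / M) = M - 1 := by field_simp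
    have h4 : 0 ≤ (M - 2) ^ 2 := sq_nonneg _
    nlinarith
  rw [le_log_iff_exp_le (by positivity)]
  have := exp_one_lt_d9
  linarith

namespace IsRidge

variable {d n : ℕ} {u : Fin n → ℝ → ℝ} {a : Fin n → Euc d} {ρ : ℝ} (hr : IsRidge u a ρ)
include hr

/-- Gradient complexity of Metropolized HMC for a ridge separable target, with the step size and the
number of leapfrog steps expressed through `X` and `y`. -/
lemma mul_mixingTime_le (hZ : IsProbabilityMeasure (targetMeasure (ridgePotential u a))) {ψ : ℝ}
    (hψ : 0 < ψ) (hC : CheegerIso (targetMeasure (ridgePotential u a)) ψ) {M ε X y η : ℝ}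
    (hM : 1 ≤ M) (hε : 0 < ε) (hℓ : 1 ≤ log (M / ε)) (hX : log (M / ε) ≤ X) (hy1 : 1 ≤ y)
    (hy2 : y ≤ 2) (hη : η = 1 / (64 * √(n * ρ) * y * X)) {μ₀ : Measure (Euc d)}
    [IsProbabilityMeasure μ₀] (hw : Warm μ₀ (targetMeasure (ridgePotential u a)) M) :
    (⌈4 * X⌉₊ : ℝ) * mixingTime (ridgePotential u a) ⌈4 * X⌉₊ η μ₀ ε
      ≤ 3845 * (24576 * exp 54) ^ 2 * (n * ρ) * (X * log (M / ε)) / ψ ^ 2 := by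
  have hL := hr.smooth_pos
  have hs : 0 < √(n * ρ) := sqrt_pos.2 hL
  have hs2 : √(n * ρ) ^ 2 = n * ρ := sq_sqrt hL.le
  have hψs := hr.cheeger_le hZ hψ.le hC
  set ℓ := log (M / ε) with hℓd
  have hX1 : 1 ≤ X := hℓ.trans hX
  have hM0 : 0 < M := by linarith
  have hη0 : 0 < η := by rw [hη]; positivity
  set K := ⌈4 * X⌉₊ with hKd
  have hK1 : 4 * X ≤ K := Nat.le_ceil _
  have hK2 : (K : ℝ) ≤ 4 * X + 1 := (Nat.ceil_lt_add_one (by positivity)).le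
  have hK0 : 0 < K := by
    have : (0 : ℝ) < K := by linarith
    exact_mod_cast this
  set s := √(n * ρ) with hsd
  have hηX : η * s * (64 * y * X) = 1 := by rw [hη]; field_simp
  have hηX1 : η * s * X ≤ 1 / 64 := by
    have : η * s * X * 1 ≤ η * s * X * y := by gcongr
    linarith
  have hηX2 : 1 / 128 ≤ η * s * X := by
    have : η * s * X * y ≤ η * s * X * 2 := by gcongr
    linarith
  have hηs : η * s ≤ η * s * X := le_mul_of_one_le_right (by positivity) hX1
  have ht1 : K * (η * s) ≤ 5 / 64 := by
    calc K * (η * s) ≤ (4 * X + 1) * (η * s) := by gcongr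
      _ = 4 * (η * s * X) + η * s := by ring
      _ ≤ _ := by linarith
  have ht2 : 1 / 32 ≤ K * (η * s) := by
    calc 1 / 32 ≤ 4 * X * (η * s) := by linarith
      _ ≤ _ := by gcongr
  set h : ℝ := 1 / (4 * ℓ * (n * ρ)) with hh
  have hhL : h * (n * ρ) * (4 * ℓ) = 1 := by
    rw [hh, mul_assoc, one_div_mul_eq_div, mul_comm (n * ρ : ℝ)]
    exact div_self (by positivity)
  have hcond1 : (K + 1) * η * s ≤ 1 / 4 := by linarith
  have hcond2 : n * ρ * (K * η) ^ 2 ≤ 1 / 64 := by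
    rw [← hs2]
    calc s ^ 2 * (K * η) ^ 2 = (K * (η * s)) ^ 2 := by ring
      _ ≤ (5 / 64) ^ 2 := by gcongr
      _ ≤ _ := by norm_num
  have hcond3 : 64 * K * η ^ 2 ≤ h / 2 := by
    rw [hh, div_div, le_div_iff₀ (by positivity), ← hs2]
    calc 64 * K * η ^ 2 * (4 * ℓ * s ^ 2 * 2) = 512 * (K * (η * s)) * (η * s * ℓ) := by ring
      _ ≤ 512 * (5 / 64) * (η * s * X) := by gcongr
      _ ≤ _ := by linarith
  have hcond4 : h * (n * ρ) ≤ 1 / 4 := by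
    have : h * (n * ρ) * (4 * 1) ≤ h * (n * ρ) * (4 * ℓ) := by gcongr
    linarith
  have hcond5 : h * (32 * ℓ * (n * ρ)) ≤ 8 := by linarith
  set β := min (ψ * (K * η / 2)) 1 with hβ
  have hβ1 : β ≤ 1 := min_le_right _ _
  have hβψ : ψ / (64 * exp 10 * s) ≤ β := by
    have hE : 1 ≤ exp 10 := one_le_exp (by norm_num)
    refine le_min ?_ ?_
    · rw [div_le_iff₀ (by positivity)]
      calc ψ ≤ ψ * (32 * (K * (η * s))) * exp 10 := by
            have h1 : 1 ≤ 32 * (K * (η * s)) := by linarith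
            have h2 : ψ * 1 * 1 ≤ ψ * (32 * (K * (η * s))) * exp 10 := by gcongr
            linarith
        _ = _ := by ring
    · rw [div_le_one (by positivity)]
      have : 0 < exp 10 * s := by positivity
      linarith
  have hβ0 : 0 < β := lt_of_lt_of_le (by positivity) hβψ
  set Φ := β / (384 * exp 44) with hΦ
  have hΦ0 : 0 < Φ := by positivity
  have hΦ1 : Φ ≤ 1 := by
    rw [hΦ, div_le_one (by positivity)]
    have : 1 ≤ exp 44 := one_le_exp (by norm_num)
    linarith
  have hΦψ : ψ / (24576 * exp 54 * s) ≤ Φ := by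
    have e : exp (54 : ℝ) = exp 10 * exp 44 := by rw [← exp_add]; norm_num
    calc ψ / (24576 * exp 54 * s) = ψ / (64 * exp 10 * s) / (384 * exp 44) := by
          rw [e, div_div]; congr 1; ring
      _ ≤ _ := by rw [hΦ]; gcongr
  set m := ⌈768 * ℓ / Φ ^ 2⌉₊ with hm
  have hm1 : 768 * ℓ / Φ ^ 2 ≤ m := Nat.le_ceil _
  have hm2 : (m : ℝ) ≤ 769 * ℓ / Φ ^ 2 := by
    have h1 : (m : ℝ) ≤ 768 * ℓ / Φ ^ 2 + 1 := (Nat.ceil_lt_add_one (by positivity)).le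
    have h2 : 1 ≤ ℓ / Φ ^ 2 := by
      rw [le_div_iff₀ (by positivity), one_mul]
      exact (pow_le_one₀ hΦ0.le hΦ1).trans hℓ
    calc (m : ℝ) ≤ 768 * ℓ / Φ ^ 2 + ℓ / Φ ^ 2 := by linarith
      _ = _ := by ring
  have hεM : ε = M * exp (-ℓ) := by
    rw [exp_neg, hℓd, exp_log (by positivity)]; field_simp
  have he2 : exp (-ℓ) ≤ 1 / 2 := by
    rw [exp_neg, inv_le_comm₀ (exp_pos _) (by norm_num)]
    have := add_one_le_exp ℓ
    norm_num
    linarith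
  have hmix : mixingTime (ridgePotential u a) K η μ₀ ε ≤ m := by
    refine mixingTime_le_of_flow hr.continuous_ridgePotential.measurable hr.measurable_gradient hZ
      hΦ0 hΦ1 (s := 2 * exp (-(7 / 32 * (32 * ℓ)))) (by positivity) hM hε (fun S hS =>
      hr.mul_sub_le_hmcFlow hZ hψ.le hC hη0 hK0 hcond1 hcond2 hcond3 hcond4 hcond5 hS) hw ?_
    have h1 : exp (-(m * (Φ ^ 2 / 256))) ≤ exp (-ℓ) ^ 3 := by
      rw [← exp_nat_mul]
      apply exp_le_exp.2
      rw [div_le_iff₀ (by positivity)] at hm1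
      push_cast
      linarith
    have h2 : exp (-(7 / 32 * (32 * ℓ))) = exp (-ℓ) ^ 7 := by
      rw [← exp_nat_mul]; congr 1; push_cast; ring
    rw [h2, hεM]
    set E := exp (-ℓ)
    have hE0 : 0 < E := exp_pos _
    have h3 : E ^ 5 ≤ (1 / 2) ^ 5 := by gcongr
    calc _ ≤ E ^ 3 * M ^ 2 + 8 * (2 * E ^ 7) * M ^ 2 := by gcongr
      _ = (E + 16 * E ^ 5) * (M * E) ^ 2 := by ring
      _ ≤ 1 * (M * E) ^ 2 := by gcongr; linarith
      _ = _ := one_mul _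
  have hmix' : (mixingTime (ridgePotential u a) K η μ₀ ε : ℝ) ≤ m := by exact_mod_cast hmix
  calc (K : ℝ) * mixingTime (ridgePotential u a) K η μ₀ ε
      ≤ (5 * X) * (769 * ℓ / Φ ^ 2) := by
        gcongr
        · linarith
        · exact hmix'.trans hm2
    _ ≤ (5 * X) * (769 * ℓ / (ψ / (24576 * exp 54 * s)) ^ 2) := by gcongr
    _ = _ := by rw [← hs2]; field_simp; ring

end IsRidge

/-- **Corollary (HMC gradient complexity for ridge separable targets).** -/
theorem hmc_ridge_separable_gradient_complexity :
    ∃ C c c' : ℝ, 0 < C ∧ 0 < c ∧ 0 < c' ∧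
    ∀ (d n : ℕ) (u : Fin n → ℝ → ℝ) (a : Fin n → Euc d) (ρ₂ ρ₃ ψ ε M : ℝ),
      (∀ i, ContDiff ℝ 3 (u i)) →
      (∀ i, ‖a i‖ = 1) →
      (∀ i z, |deriv (deriv (u i)) z| ≤ ρ₂) →
      (∀ i z, |deriv (deriv (deriv (u i))) z| ≤ ρ₃) →
      let f : Euc d → ℝ := fun θ => ∑ i, u i ⟪a i, θ⟫
      let γ : ℝ := ρ₃ / ((n : ℝ) ^ ((1:ℝ)/2) * ρ₂ ^ ((3:ℝ)/2))
      γ ≤ 1 →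
      0 < ψ → CheegerIso (targetMeasure f) ψ →
      IsProbabilityMeasure (targetMeasure f) →
      0 < ε → ε < 1 → 1 ≤ M →
      let η : ℝ := Real.sqrt (c / ((n : ℝ) * ρ₂ * ((d : ℝ) + Real.log (M / ε)) ^ ((1:ℝ)/2)
        * (γ + 1) ^ ((2:ℝ)/3) * Real.log (M / ε) ^ ((3:ℝ)/2)))
      let K : ℕ := ⌈c' / (2 * ((n : ℝ) * ρ₂) ^ ((1:ℝ)/2) * (γ + 1) ^ ((1:ℝ)/3) * η)⌉₊
      ∀ μ0 : Measure (Euc d), IsProbabilityMeasure μ0 → Warm μ0 (targetMeasure f) M →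
        (K : ℝ) * (mixingTime f K η μ0 ε : ℝ)
          ≤ C * ((n : ℝ) * ρ₂ + (n : ℝ) ^ ((1:ℝ)/2) * ρ₃ * ρ₂ ^ (-(1:ℝ)/2))
            * ((d : ℝ) + Real.log (M / ε)) ^ ((1:ℝ)/4) / ψ^2
            * Real.log (M / ε) ^ ((7:ℝ)/4) := by
  refine ⟨3845 * (24576 * exp 54) ^ 2, 1 / 4096, 1 / 8, by positivity, by norm_num, by norm_num, ?_⟩
  intro d n u a ρ₂ ρ₃ ψ ε M hu ha h2 h3 f γ hγ hψ hC hZ hε hε1 hM η K μ₀ hμ₀ hw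
  have hℓ0 : 0 ≤ log (M / ε) := log_nonneg (by rw [le_div_iff₀ hε]; linarith)
  rcases Nat.eq_zero_or_pos n with hn | hn
  · have hK : K = 0 := by simp [K, hn]
    rw [hK]
    simp [hn]
  have hρ₂ : 0 ≤ ρ₂ := (abs_nonneg _).trans (h2 ⟨0, hn⟩ 0)
  have hρ₃ : 0 ≤ ρ₃ := (abs_nonneg _).trans (h3 ⟨0, hn⟩ 0)
  have hn0 : (0 : ℝ) < n := by exact_mod_cast hn
  have hRHS : 0 ≤ 3845 * (24576 * exp 54) ^ 2
      * ((n : ℝ) * ρ₂ + (n : ℝ) ^ ((1:ℝ)/2) * ρ₃ * ρ₂ ^ (-(1:ℝ)/2))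
      * ((d : ℝ) + log (M / ε)) ^ ((1:ℝ)/4) / ψ^2 * log (M / ε) ^ ((7:ℝ)/4) := by positivity
  rcases hρ₂.eq_or_lt with hρ | hρ
  · have hK : K = 0 := by simp [K, ← hρ]
    rw [hK]
    simpa using hRHS
  rcases le_or_gt (1 - 1 / M) ε with hεM | hεM
  · rw [mixingTime_eq_zero hM hw hεM]
    simpa using hRHS
  have hℓ := one_le_log_div hM hε hεM
  have hr : IsRidge u a ρ₂ := ⟨hu, ha, h2, hρ, hn⟩
  have hγ0 : 0 ≤ γ := by positivity
  have hL : 0 < n * ρ₂ := by positivity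
  set ℓ := log (M / ε) with hℓd
  have hΛ : ℓ ≤ d + ℓ := le_add_of_nonneg_left (Nat.cast_nonneg d)
  have hΛ0 : 0 < d + ℓ := by linarith
  set X := ((d : ℝ) + ℓ) ^ ((1:ℝ)/4) * ℓ ^ ((3:ℝ)/4) with hX
  set y := (γ + 1) ^ ((1:ℝ)/3) with hy
  have hX0 : 0 < X := by positivity
  have hXℓ : ℓ ≤ X := by
    calc ℓ = ℓ ^ ((1:ℝ)/4) * ℓ ^ ((3:ℝ)/4) := by
          rw [← rpow_add (by linarith)]; norm_num
      _ ≤ X := by rw [hX]; gcongr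
  have hy1 : 1 ≤ y := one_le_rpow (by linarith) (by norm_num)
  have hy2 : y ≤ 2 := by
    calc y ≤ (γ + 1) ^ (1:ℝ) := rpow_le_rpow_of_exponent_le (by linarith) (by norm_num)
      _ ≤ 2 := by rw [rpow_one]; linarith
  have hη : η = 1 / (64 * √(n * ρ₂) * y * X) := by
    have e : (1 : ℝ) / 4096 / ((n : ℝ) * ρ₂ * ((d : ℝ) + ℓ) ^ ((1:ℝ)/2)
        * (γ + 1) ^ ((2:ℝ)/3) * ℓ ^ ((3:ℝ)/2)) = (1 / (64 * √(n * ρ₂) * y * X)) ^ 2 := by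
      have e1 : ((d : ℝ) + ℓ) ^ ((1:ℝ)/2) = (((d : ℝ) + ℓ) ^ ((1:ℝ)/4)) ^ 2 := by
        rw [← rpow_mul_natCast hΛ0.le]; norm_num
      have e2 : (γ + 1) ^ ((2:ℝ)/3) = y ^ 2 := by
        rw [hy, ← rpow_mul_natCast (by linarith)]; norm_num
      have e3 : ℓ ^ ((3:ℝ)/2) = (ℓ ^ ((3:ℝ)/4)) ^ 2 := by
        rw [← rpow_mul_natCast (by linarith)]; norm_num
      have e4 := (sq_sqrt hL.le).symm
      generalize √(n * ρ₂) = w at e4 ⊢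
      rw [e1, e2, e3, e4, hX, div_div, one_div_pow]
      congr 1
      ring
    change √_ = _
    rw [e, sqrt_sq (by positivity)]
  have hK : K = ⌈4 * X⌉₊ := by
    change ⌈1 / 8 / (2 * ((n : ℝ) * ρ₂) ^ ((1:ℝ)/2) * y * η)⌉₊ = _
    congr 1
    rw [hη, ← sqrt_eq_rpow]
    have := sqrt_pos.2 hL
    field_simp
    ring
  have key := hr.mul_mixingTime_le hZ hψ hC hM hε hℓ hXℓ hy1 hy2 hη hw
  rw [hK]
  refine key.trans ?_
  have e : X * ℓ = ((d : ℝ) + ℓ) ^ ((1:ℝ)/4) * ℓ ^ ((7:ℝ)/4) := by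
    rw [hX, mul_assoc]
    congr 1
    nth_rw 2 [← rpow_one ℓ]
    rw [← rpow_add (by linarith)]; norm_num
  rw [e]
  calc _ = 3845 * (24576 * exp 54) ^ 2 * ((n : ℝ) * ρ₂ + 0)
        * ((d : ℝ) + ℓ) ^ ((1:ℝ)/4) / ψ^2 * ℓ ^ ((7:ℝ)/4) := by ring
    _ ≤ _ := by gcongr; positivity
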